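/- Let G be a finite group whose character graph Δ(G) is K₄-free with exactly seven vertices, and let M be a normal subgroup of G with R(G) < M such that S := M/R(G) ≅ PSL₂(2^f) for some integer f ≥ 2, the centralizer of M/R(G) in G/R(G) is trivial, and the complement of the induced subgraph of Δ(G) on π(S) is not bipartite. Then it is impossible that one of |π(2^f − 1)|, |π(2^f + 1)| equals 2 while the other equals 3 (i.e. Δ(S) is not isomorphic to K₂ ∪ K₁ ∪ K₃). -/

import Mathlib

open CategoryTheory

/-- `cd(G)`: the set of character degrees of `G`, i.e. the dimensions of the simple
finite-dimensional complex representations of `G`. -/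
def charDegrees (G : Type) [Group G] : Set ℕ :=
  { n | ∃ V : FDRep ℂ G, Simple V ∧ Module.finrank ℂ V = n }

/-- `ρ(G)`: the set of primes dividing some character degree of `G`. -/
def charPrimes (G : Type) [Group G] : Set ℕ :=
  { p | p.Prime ∧ ∃ n ∈ charDegrees G, p ∣ n }

/-- The character graph `Δ(G)`, on vertex set `ρ(G)`: two distinct primes `p`, `q`
are adjacent iff `p * q` divides some character degree of `G`. -/
def charGraph (G : Type) [Group G] : SimpleGraph (charPrimes G) where
  Adj p q := (p : ℕ) ≠ (q : ℕ) ∧ ∃ n ∈ charDegrees G, (p : ℕ) * (q : ℕ) ∣ n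
  symm := by
    refine ⟨?_⟩
    rintro p q ⟨h, n, hn, hd⟩
    exact ⟨fun e => h e.symm, n, hn, by rwa [mul_comm]⟩
  loopless := by refine ⟨?_⟩; rintro p ⟨h, -⟩; exact h rfl

/-- The solvable radical `R(G)` of `G`: the largest solvable normal subgroup of `G`
(realized as the join of all solvable normal subgroups). -/
def solvableRadical (G : Type*) [Group G] : Subgroup G :=
  ⨆ N : { N : Subgroup G // N.Normal ∧ IsSolvable ↥N }, (N : Subgroup G)

instance solvableRadical_normal (G : Type*) [Group G] : (solvableRadical G).Normal := by
  constructor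
  intro n hn g
  refine Subgroup.iSup_induction (C := fun x => g * x * g⁻¹ ∈ solvableRadical G)
    (fun N : { N : Subgroup G // N.Normal ∧ IsSolvable ↥N } => (N : Subgroup G)) hn ?_ ?_ ?_
  · intro N x hx
    exact Subgroup.mem_iSup_of_mem N (N.2.1.conj_mem x hx g)
  · simpa using Subgroup.one_mem _
  · intro x y hx hy
    have h : g * (x * y) * g⁻¹ = (g * x * g⁻¹) * (g * y * g⁻¹) := by group
    rw [h]; exact Subgroup.mul_mem _ hx hy

/-- `PSL₂(F)`: the special linear group `SL₂(F)` modulo its center. -/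
abbrev PSL2 (F : Type) [Field F] :=
  Matrix.SpecialLinearGroup (Fin 2) F ⧸
    Subgroup.center (Matrix.SpecialLinearGroup (Fin 2) F)

/-- The join `Γ ⋆ Δ` of two simple graphs: the disjoint union together with all
edges between the two vertex sets. -/
def graphJoin {α β : Type*} (G : SimpleGraph α) (H : SimpleGraph β) :
    SimpleGraph (α ⊕ β) :=
  (G ⊕g H) ⊔
    { Adj := fun u v => u.isLeft ≠ v.isLeft
      symm := ⟨fun _ _ h => h.symm⟩
      loopless := ⟨fun _ h => h rfl⟩ }

/-- The image of a subgroup `M` of `G` in `G/R(G)`; when `R(G) ≤ M` this is `M/R(G)`. -/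
def radicalQuotImage {G : Type*} [Group G] (M : Subgroup G) :
    Subgroup (G ⧸ solvableRadical G) :=
  M.map (QuotientGroup.mk' (solvableRadical G))

noncomputable section
namespace CD
open scoped Classical
open Representation

theorem irr_iff {G V : Type*} [Monoid G] [AddCommGroup V] [Module ℂ V] (ρ : Representation ℂ G V) :
    ρ.IsIrreducible ↔ Nontrivial V ∧
      ∀ U : Submodule ℂ V, (∀ g, ∀ u ∈ U, ρ g u ∈ U) → U = ⊥ ∨ U = ⊤ := by
  constructor
  · intro h
    have hn : (⊥ : Subrepresentation ρ) ≠ ⊤ := bot_ne_top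
    refine ⟨?_, fun U hU => ?_⟩
    · by_contra hc
      rw [not_nontrivial_iff_subsingleton] at hc
      exact hn (Subrepresentation.toSubmodule_injective (Subsingleton.elim _ _))
    · rcases h.eq_bot_or_eq_top (⟨U, fun g v hv => hU g v hv⟩ : Subrepresentation ρ) with h | h
      · left; exact congrArg Subrepresentation.toSubmodule h
      · right; exact congrArg Subrepresentation.toSubmodule h
  · rintro ⟨hn, h⟩
    have : Nontrivial (Subrepresentation ρ) :=
      ⟨⊥, ⊤, fun e => bot_ne_top (α := Submodule ℂ V) (congrArg Subrepresentation.toSubmodule e)⟩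
    refine ⟨fun U => ?_⟩
    rcases h U.toSubmodule (fun g u hu => U.apply_mem_toSubmodule g hu) with h | h
    · left; exact Subrepresentation.toSubmodule_injective h
    · right; exact Subrepresentation.toSubmodule_injective h

theorem schur {G V : Type*} [Monoid G] [AddCommGroup V] [Module ℂ V] [FiniteDimensional ℂ V]
    (ρ : Representation ℂ G V) (h : ρ.IsIrreducible) (T : Module.End ℂ V)
    (hT : ∀ g, T * ρ g = ρ g * T) : ∃ c : ℂ, T = c • (1 : Module.End ℂ V) := by
  have hn := (irr_iff ρ).1 h
  have := hn.1
  obtain ⟨c, hc⟩ := Module.End.exists_eigenvalue T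
  refine ⟨c, ?_⟩
  rcases hn.2 (Module.End.eigenspace T c) (fun g u hu => by
    rw [Module.End.mem_eigenspace_iff] at hu ⊢
    have := LinearMap.congr_fun (hT g) u
    simp only [Module.End.mul_apply] at this
    rw [this, hu, map_smul]) with h | h
  · exact absurd h hc
  · ext v
    have : v ∈ Module.End.eigenspace T c := by rw [h]; trivial
    rw [Module.End.mem_eigenspace_iff] at this
    simpa using this

theorem sub_asAlgebraHom {G V : Type*} [Group G] [AddCommGroup V] [Module ℂ V]
    {ρ : Representation ℂ G V} (U : Subrepresentation ρ) (a : MonoidAlgebra ℂ G)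
    (u : U.toSubmodule) :
    ((U.toRepresentation.asAlgebraHom a u : U.toSubmodule) : V) = ρ.asAlgebraHom a (u : V) := by
  induction a using MonoidAlgebra.induction_linear with
  | zero => simp
  | add x y hx hy => simp [hx, hy]
  | single g c => simp [asAlgebraHom_single, Subrepresentation.toRepresentation]

theorem killed_rep {G : Type} [Group G] [Finite G] (a : MonoidAlgebra ℂ G)
    (h : ∀ (V : Type) [AddCommGroup V] [Module ℂ V] [FiniteDimensional ℂ V]
      (ρ : Representation ℂ G V), ρ.IsIrreducible → ρ.asAlgebraHom a = 0)
    (n : ℕ) : ∀ (V : Type) [AddCommGroup V] [Module ℂ V] [FiniteDimensional ℂ V]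
      (ρ : Representation ℂ G V), Module.finrank ℂ V = n → ρ.asAlgebraHom a = 0 := by
  induction n using Nat.strong_induction_on with
  | _ n ih =>
  intro V _ _ _ ρ hn
  by_cases hi : ρ.IsIrreducible
  · exact h V ρ hi
  rcases subsingleton_or_nontrivial V with hs | hs
  · ext v; exact Subsingleton.elim _ _
  rw [irr_iff] at hi
  push Not at hi
  obtain ⟨U, hU, hb, ht⟩ := hi hs
  let U' : Subrepresentation ρ := ⟨U, fun g v hv => hU g v hv⟩
  obtain ⟨C, hC⟩ := exists_isCompl U'
  have hsub : ∀ W : Subrepresentation ρ, W.toSubmodule ≠ ⊤ → ∀ w ∈ W.toSubmodule,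
      ρ.asAlgebraHom a w = 0 := by
    intro W hW w hw
    have := ih _ (hn ▸ Submodule.finrank_lt hW) W.toSubmodule W.toRepresentation rfl
    rw [← sub_asAlgebraHom W a ⟨w, hw⟩, this]; rfl
  have hC1 : C.toSubmodule ≠ ⊤ := by
    intro hc
    have h1 := congrArg Subrepresentation.toSubmodule (hC.inf_eq_bot)
    rw [Subrepresentation.toSubmodule_inf, hc, inf_top_eq] at h1
    exact hb h1
  ext v
  have hv : v ∈ U'.toSubmodule ⊔ C.toSubmodule := by
    have h1 := congrArg Subrepresentation.toSubmodule (hC.sup_eq_top)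
    rw [Subrepresentation.toSubmodule_sup] at h1
    rw [h1]; trivial
  obtain ⟨x, hx, y, hy, rfl⟩ := Submodule.mem_sup.1 hv
  rw [map_add, hsub U' ht x hx, hsub C hC1 y hy]; simp

theorem killed {G : Type} [Group G] [Finite G] (a : MonoidAlgebra ℂ G)
    (h : ∀ (V : Type) [AddCommGroup V] [Module ℂ V] [FiniteDimensional ℂ V]
      (ρ : Representation ℂ G V), ρ.IsIrreducible → ρ.asAlgebraHom a = 0) : a = 0 := by
  have h1 := killed_rep a h _ _ (leftRegular ℂ G) rfl
  have h2 : ∀ b : MonoidAlgebra ℂ G, (leftRegular ℂ G).asAlgebraHom b 1 = b := by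
    intro b
    induction b using MonoidAlgebra.induction_linear with
    | zero => simp
    | add x y hx hy => simp [hx, hy]
    | single g c => simp [asAlgebraHom_single, MonoidAlgebra.one_def]
  rw [← h2 a, h1]; rfl

/-- group algebra element with given coefficients -/
def el {G : Type} [Group G] [Fintype G] (f : G → ℂ) : MonoidAlgebra ℂ G :=
  ∑ g, MonoidAlgebra.single g (f g)

theorem asAlg_el {G V : Type} [Group G] [Fintype G] [AddCommGroup V] [Module ℂ V]
    (ρ : Representation ℂ G V) (f : G → ℂ) : ρ.asAlgebraHom (el f) = ∑ g, f g • ρ g := by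
  simp [el, asAlgebraHom_single]

theorem el_inj {G : Type} [Group G] [Fintype G] {f : G → ℂ} (h : el f = 0) (g : G) : f g = 0 := by
  have := congrArg (fun a => MonoidAlgebra.coeffLinearEquiv ℂ a g) h
  simpa [el, map_sum, Finsupp.single_apply] using this

theorem class_comm {G V : Type} [Group G] [Fintype G] [AddCommGroup V] [Module ℂ V]
    (ρ : Representation ℂ G V) (f : G → ℂ) (x : G) (hf : ∀ g, f (x * g * x⁻¹) = f g) :
    (∑ g, f g • ρ g) * ρ x = ρ x * ∑ g, f g • ρ g := by
  rw [Finset.sum_mul, Finset.mul_sum]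
  rw [← Equiv.sum_comp (MulAut.conj x).toEquiv]
  refine Finset.sum_congr rfl fun g _ => ?_
  simp only [MulEquiv.toEquiv_eq_coe, EquivLike.coe_coe, MulAut.conj_apply, hf, smul_mul_assoc,
    mul_smul_comm, ← map_mul]
  congr 2
  group

/-- the central idempotent attached to an irreducible representation -/
def idm {G V : Type} [Group G] [AddCommGroup V] [Module ℂ V]
    (ρ : Representation ℂ G V) : G → ℂ :=
  fun g => (Module.finrank ℂ V : ℂ) / (Nat.card G : ℂ) * ρ.character g⁻¹

theorem idm_conj {G V : Type} [Group G] [AddCommGroup V] [Module ℂ V]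
    (ρ : Representation ℂ G V) (x g : G) : idm ρ (x * g * x⁻¹) = idm ρ g := by
  unfold idm
  rw [show (x * g * x⁻¹)⁻¹ = x * g⁻¹ * x⁻¹ by group, char_conj]

theorem orth {G V W : Type} [Group G] [Fintype G] [AddCommGroup V] [Module ℂ V]
    [FiniteDimensional ℂ V] [AddCommGroup W] [Module ℂ W] [FiniteDimensional ℂ W]
    (ρ : Representation ℂ G V) (σ : Representation ℂ G W) :
    ∑ g, ρ.character g⁻¹ * σ.character g =
      Nat.card G * Module.finrank ℂ (IntertwiningMap ρ σ) := by
  have : (Nat.card G : ℂ) ≠ 0 := by exact_mod_cast Nat.card_pos.ne'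
  have := invertibleOfNonzero this
  rw [← card_inv_mul_sum_char_mul_char_eq_finrank, ← mul_assoc, mul_inv_cancel₀ ‹_›, one_mul]
  exact Finset.sum_congr rfl fun g _ => mul_comm _ _

theorem trace_idm {G V W : Type} [Group G] [Fintype G] [AddCommGroup V] [Module ℂ V]
    [FiniteDimensional ℂ V] [AddCommGroup W] [Module ℂ W] [FiniteDimensional ℂ W]
    (ρ : Representation ℂ G V) (σ : Representation ℂ G W) :
    LinearMap.trace ℂ W (∑ g, idm ρ g • σ g) =
      Module.finrank ℂ V * Module.finrank ℂ (IntertwiningMap ρ σ) := by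
  have h : (Nat.card G : ℂ) ≠ 0 := by exact_mod_cast Nat.card_pos.ne'
  have := orth ρ σ
  simp only [map_sum, map_smul, idm, smul_eq_mul]
  have e : ∀ g, LinearMap.trace ℂ W (σ g) = σ.character g := fun g => rfl
  simp only [e, mul_assoc, ← Finset.mul_sum, this]
  field_simp

theorem irr_fin_pos {G V : Type} [Group G] [AddCommGroup V] [Module ℂ V]
    [FiniteDimensional ℂ V] {ρ : Representation ℂ G V} (h : ρ.IsIrreducible) :
    0 < Module.finrank ℂ V := by
  have := ((irr_iff ρ).1 h).1
  exact Module.finrank_pos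

theorem idm_irr {G V W : Type} [Group G] [Fintype G] [AddCommGroup V] [Module ℂ V]
    [FiniteDimensional ℂ V] [AddCommGroup W] [Module ℂ W] [FiniteDimensional ℂ W]
    (ρ : Representation ℂ G V) (σ : Representation ℂ G W) (hρ : ρ.IsIrreducible)
    (hσ : σ.IsIrreducible) :
    (∑ g, idm ρ g • σ g) = if Nonempty (ρ.Equiv σ) then (1 : Module.End ℂ W) else 0 := by
  obtain ⟨c, hc⟩ := schur σ hσ (∑ g, idm ρ g • σ g)
    (fun x => class_comm σ _ x (fun g => idm_conj ρ x g))
  have ht := trace_idm ρ σ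
  have hW : (Module.finrank ℂ W : ℂ) ≠ 0 := by exact_mod_cast (irr_fin_pos hσ).ne'
  rw [hc] at ht ⊢
  simp only [map_smul, LinearMap.trace_one, smul_eq_mul] at ht
  split_ifs with h
  · obtain ⟨e⟩ := h
    have h1 : Module.finrank ℂ (IntertwiningMap ρ σ) = 1 := by
      have hx := orth ρ σ
      rw [← char_iso e, orth ρ ρ] at hx
      have h : (Nat.card G : ℂ) ≠ 0 := by exact_mod_cast Nat.card_pos.ne'
      have hx := mul_left_cancel₀ h hx
      simp at hx
      exact_mod_cast hx.symm
    rw [h1, e.toLinearEquiv.finrank_eq] at ht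
    have : c = 1 := by
      apply mul_right_cancel₀ hW; rw [ht]; push_cast; ring
    rw [this, one_smul]
  · have h1 : Module.finrank ℂ (IntertwiningMap ρ σ) = 0 := by
      have : IsEmpty (ρ.Equiv σ) := not_nonempty_iff.1 h
      exact Module.finrank_zero_of_subsingleton
    rw [h1] at ht
    have : c = 0 := by
      apply mul_right_cancel₀ hW; rw [ht]; push_cast; ring
    rw [this, zero_smul]

/-- action of the idempotent -/
def eop {G V W : Type} [Group G] [Fintype G] [AddCommGroup V] [Module ℂ V]
    [AddCommGroup W] [Module ℂ W] (ρ : Representation ℂ G V) (σ : Representation ℂ G W) :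
    Module.End ℂ W := ∑ g, idm ρ g • σ g

theorem eop_mul {G V V' W : Type} [Group G] [Fintype G] [AddCommGroup V] [Module ℂ V]
    [FiniteDimensional ℂ V] [AddCommGroup V'] [Module ℂ V']
    [FiniteDimensional ℂ V'] [AddCommGroup W] [Module ℂ W] [FiniteDimensional ℂ W]
    (ρ : Representation ℂ G V) (ρ' : Representation ℂ G V')
    (σ : Representation ℂ G W) (hρ : ρ.IsIrreducible)
    (hρ' : ρ'.IsIrreducible) :
    eop ρ σ * eop ρ' σ = if Nonempty (ρ.Equiv ρ') then eop ρ σ else 0 := by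
  have key := killed_rep (el (idm ρ) * el (idm ρ') -
    if Nonempty (ρ.Equiv ρ') then el (idm ρ) else 0) (by
      intro U _ _ _ τ hτ
      rw [map_sub, map_mul]
      have h1 := idm_irr ρ τ hρ hτ
      have h2 := idm_irr ρ' τ hρ' hτ
      rw [apply_ite (τ.asAlgebraHom), asAlg_el, asAlg_el, h1, h2, map_zero, sub_eq_zero]
      by_cases a : Nonempty (ρ.Equiv τ)
      · by_cases b : Nonempty (ρ'.Equiv τ)
        · have : Nonempty (ρ.Equiv ρ') := ⟨a.some.trans b.some.symm⟩
          simp [a, b, this]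
        · have : ¬ Nonempty (ρ.Equiv ρ') := fun ⟨c⟩ => b ⟨c.symm.trans a.some⟩
          simp [b, this]
      · simp [a]) _ W σ rfl
  rw [map_sub, map_mul, sub_eq_zero, apply_ite (σ.asAlgebraHom), asAlg_el, asAlg_el, map_zero] at key
  exact key

theorem equiv_of_char {G V W : Type} [Group G] [Fintype G] [AddCommGroup V] [Module ℂ V]
    [FiniteDimensional ℂ V] [AddCommGroup W] [Module ℂ W] [FiniteDimensional ℂ W]
    (ρ : Representation ℂ G V) (σ : Representation ℂ G W) (hρ : ρ.IsIrreducible)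
    (hσ : σ.IsIrreducible) (h : ρ.character = σ.character) : Nonempty (ρ.Equiv σ) := by
  by_contra hc
  have : IsEmpty (ρ.Equiv σ) := not_nonempty_iff.1 hc
  have h1 := orth ρ σ
  rw [← h, orth ρ ρ, Module.finrank_zero_of_subsingleton (M := IntertwiningMap ρ σ)] at h1
  simp at h1

theorem exists_irr_of_ne {G : Type} [Group G] [Finite G] (a : MonoidAlgebra ℂ G) (ha : a ≠ 0) :
    ∃ (V : Type) (_ : AddCommGroup V) (_ : Module ℂ V) (_ : FiniteDimensional ℂ V)
      (ρ : Representation ℂ G V), ρ.IsIrreducible ∧ ρ.asAlgebraHom a ≠ 0 := by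
  by_contra hc
  push Not at hc
  exact ha (killed a fun V _ _ _ ρ hρ => hc V _ _ ‹_› ρ hρ)

theorem irr_of_end {G V : Type} [Group G] [Finite G] [AddCommGroup V] [Module ℂ V]
    [FiniteDimensional ℂ V] (ρ : Representation ℂ G V)
    (h : Module.finrank ℂ (IntertwiningMap ρ ρ) = 1) : ρ.IsIrreducible := by
  rw [irr_iff]
  constructor
  · by_contra hc
    rw [not_nontrivial_iff_subsingleton] at hc
    have : Subsingleton (IntertwiningMap ρ ρ) := ⟨fun f g => by ext v; exact Subsingleton.elim _ _⟩
    rw [Module.finrank_zero_of_subsingleton] at h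
    exact zero_ne_one h
  · intro U hU
    obtain ⟨C, hC⟩ := exists_isCompl (⟨U, fun g v hv => hU g v hv⟩ : Subrepresentation ρ)
    have hc : IsCompl U C.toSubmodule := IsCompl.of_eq
      (congrArg Subrepresentation.toSubmodule hC.inf_eq_bot)
      (congrArg Subrepresentation.toSubmodule hC.sup_eq_top)
    let P : IntertwiningMap ρ ρ := ⟨U.projection C.toSubmodule hc, fun g => by
      ext v
      obtain ⟨x, hx, y, hy, rfl⟩ := Submodule.mem_sup.1
        (show v ∈ U ⊔ C.toSubmodule by rw [hc.sup_eq_top]; trivial)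
      have h1 := (Submodule.projection_apply_eq_zero_iff hc).2 hy
      have h2 := (Submodule.projection_apply_eq_zero_iff hc).2 (C.apply_mem_toSubmodule g hy)
      have h3 := (Submodule.projection_eq_self_iff hc _).2 hx
      have h4 := (Submodule.projection_eq_self_iff hc _).2 (hU g x hx)
      simp [map_add, h1, h2, h3, h4]⟩
    obtain ⟨c, hcP⟩ := (finrank_eq_one_iff_of_nonzero' (IntertwiningMap.id ρ) (by
      intro h0
      have : Subsingleton (IntertwiningMap ρ ρ) := ⟨fun f g => by
        ext v
        have hv : v = 0 := by
          have := congrArg (fun k : IntertwiningMap ρ ρ => k v) h0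
          simpa using this
        rw [hv]; simp⟩
      rw [Module.finrank_zero_of_subsingleton] at h
      exact zero_ne_one h)).1 h P
    have hP : ∀ v, U.projection C.toSubmodule hc v = c • v := fun v => by
      have := congrArg (fun k : IntertwiningMap ρ ρ => k v) hcP
      exact this.symm
    by_cases h0 : c = 0
    · left
      rw [eq_bot_iff]
      intro u hu
      have := (Submodule.projection_eq_self_iff hc u).2 hu
      rw [hP, h0, zero_smul] at this
      exact this.symm
    · right
      rw [eq_top_iff]
      intro v _
      have := Submodule.projection_apply_mem hc v
      rw [hP] at this
      exact (Submodule.smul_mem_iff _ h0).1 this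

theorem end_of_irr {G V : Type} [Group G] [Finite G] [AddCommGroup V] [Module ℂ V]
    [FiniteDimensional ℂ V] (ρ : Representation ℂ G V) (h : ρ.IsIrreducible) :
    Module.finrank ℂ (IntertwiningMap ρ ρ) = 1 := by simp

theorem simple_iff_irr {G : Type} [Group G] [Finite G] (V : FDRep ℂ G) :
    Simple V ↔ Representation.IsIrreducible (V.ρ : Representation ℂ G V) := by
  have := Fintype.ofFinite G
  rw [FDRep.simple_iff_char_is_norm_one]
  have h := orth V.ρ V.ρ
  have hG : (Nat.card G : ℂ) ≠ 0 := by exact_mod_cast Nat.card_pos.ne'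
  have e : ∑ g : G, V.character g * V.character g⁻¹ =
      Nat.card G * Module.finrank ℂ (IntertwiningMap V.ρ V.ρ) := by
    rw [← h]
    exact Finset.sum_congr rfl fun g _ => mul_comm _ _
  rw [e]
  constructor
  · intro h1
    apply irr_of_end
    have := mul_left_cancel₀ hG (h1.trans (mul_one _).symm)
    exact_mod_cast this
  · intro h1
    rw [end_of_irr _ h1]; simp

theorem mem_cd {G : Type} [Group G] [Finite G] {n : ℕ} : n ∈ charDegrees G ↔
    ∃ (V : Type) (_ : AddCommGroup V) (_ : Module ℂ V) (_ : FiniteDimensional ℂ V)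
      (ρ : Representation ℂ G V), ρ.IsIrreducible ∧ Module.finrank ℂ V = n := by
  constructor
  · rintro ⟨V, hV, hn⟩
    exact ⟨V, inferInstance, inferInstance, inferInstance, V.ρ, (simple_iff_irr V).1 hV, hn⟩
  · rintro ⟨V, _, _, _, ρ, hρ, hn⟩
    exact ⟨FDRep.of ρ, (simple_iff_irr _).2 hρ, hn⟩

theorem irr_comp {G H V : Type} [Group G] [Group H] [AddCommGroup V] [Module ℂ V]
    (ρ : Representation ℂ G V) (φ : H →* G) (hφ : Function.Surjective φ) :
    (ρ.IsIrreducible ↔ Representation.IsIrreducible (ρ.comp φ)) := by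
  rw [irr_iff, irr_iff]
  refine and_congr_right fun _ => forall_congr' fun U => ?_
  have : (∀ g, ∀ u ∈ U, ρ g u ∈ U) ↔ (∀ g, ∀ u ∈ U, (ρ.comp φ) g u ∈ U) :=
    ⟨fun h g => h (φ g), fun h g => by obtain ⟨k, rfl⟩ := hφ g; exact h k⟩
  rw [this]

theorem cd_of_surj {G H : Type} [Group G] [Group H] [Finite G] [Finite H] (φ : H →* G)
    (hφ : Function.Surjective φ) {n : ℕ} (hn : n ∈ charDegrees G) : n ∈ charDegrees H := by
  rw [mem_cd] at hn ⊢
  obtain ⟨V, _, _, _, ρ, hρ, hn⟩ := hn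
  exact ⟨V, _, _, ‹_›, ρ.comp φ, (irr_comp ρ φ hφ).1 hρ, hn⟩
end CD
end

noncomputable section
namespace CD
open scoped Classical
open Representation

abbrev res {G V : Type} [Group G] [AddCommGroup V] [Module ℂ V] (ρ : Representation ℂ G V)
    (N : Subgroup G) : Representation ℂ N V := MonoidHom.comp ρ N.subtype

theorem trace_idem_zero {V : Type} [AddCommGroup V] [Module ℂ V] [FiniteDimensional ℂ V]
    (P : Module.End ℂ V) (hP : P * P = P) : LinearMap.trace ℂ V P =
      Module.finrank ℂ (LinearMap.range P) := by
  have : LinearMap.IsProj (LinearMap.range P) P :=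
    ⟨fun x => ⟨x, rfl⟩, by rintro _ ⟨y, rfl⟩; exact LinearMap.congr_fun hP y⟩
  exact this.trace

section cliff
variable {G W V : Type} [Group G] [Fintype G] [AddCommGroup W] [Module ℂ W]
  [FiniteDimensional ℂ W] [AddCommGroup V] [Module ℂ V] [FiniteDimensional ℂ V]

theorem eop_self (lam : Representation ℂ G W) (h : lam.IsIrreducible) : eop lam lam = 1 := by
  have := idm_irr lam lam h h
  rw [if_pos ⟨Representation.Equiv.refl lam⟩] at this
  exact this

/-- intertwiners commute with eop -/
theorem eop_nat {W' : Type} [AddCommGroup W'] [Module ℂ W'] (lam : Representation ℂ G W)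
    (σ : Representation ℂ G W') (ρ : Representation ℂ G V)
    (φ : W' →ₗ[ℂ] V) (hφ : ∀ g w, φ (σ g w) = ρ g (φ w)) (w : W') :
    eop lam ρ (φ w) = φ (eop lam σ w) := by
  simp [eop, LinearMap.sum_apply, hφ]

theorem exists_over (K : Subgroup G) (σ : Representation ℂ K W) (hσ : σ.IsIrreducible) :
    ∃ (V : Type) (_ : AddCommGroup V) (_ : Module ℂ V) (_ : FiniteDimensional ℂ V)
      (ρ : Representation ℂ G V), ρ.IsIrreducible ∧ ∃ φ : W →ₗ[ℂ] V, Function.Injective φ ∧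
        ∀ (k : K) w, φ (σ k w) = ρ k (φ w) := by
  let f : G → ℂ := fun g => if h : g ∈ K then idm σ ⟨g, h⟩ else 0
  have hf : el f ≠ 0 := by
    intro h0
    have h1 := el_inj h0 1
    have h2 : (Nat.card K : ℂ) ≠ 0 := by exact_mod_cast Nat.card_pos.ne'
    have h3 : (Module.finrank ℂ W : ℂ) ≠ 0 := by exact_mod_cast (irr_fin_pos hσ).ne'
    simp only [f, K.one_mem, dif_pos, idm] at h1
    have h4 : σ.character (⟨1, K.one_mem⟩ : K)⁻¹ = Module.finrank ℂ W := by
      rw [← char_one σ]; congr 1; exact inv_one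
    rw [h4] at h1
    field_simp at h1
    exact h3 (by simpa using h1)
  obtain ⟨V, _, _, _, ρ, hρ, h⟩ := exists_irr_of_ne _ hf
  refine ⟨V, _, _, ‹_›, ρ, hρ, ?_⟩
  have he : ρ.asAlgebraHom (el f) = eop σ (res ρ K) := by
    rw [asAlg_el, eop]
    rw [← Finset.sum_subset (Finset.subset_univ (Finset.univ.filter (· ∈ K)))]
    · rw [← Finset.sum_subtype_eq_sum_filter, Finset.subtype_univ]
      refine Finset.sum_congr rfl fun k _ => ?_
      simp [f]
    · intro x _ hx
      have : x ∉ K := by simpa using hx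
      simp [f, this]
  rw [he] at h
  have hid : eop σ (res ρ K) * eop σ (res ρ K) = eop σ (res ρ K) := by
    rw [eop_mul σ σ _ hσ hσ, if_pos ⟨Representation.Equiv.refl σ⟩]
  have ht := trace_idem_zero _ hid
  rw [eop, trace_idm] at ht
  have hne : Module.finrank ℂ (IntertwiningMap σ (res ρ K)) ≠ 0 := by
    intro h0
    rw [h0] at ht
    have h1 : Module.finrank ℂ (LinearMap.range (eop σ (res ρ K))) = 0 := by
      simp only [Nat.cast_zero, mul_zero] at ht
      exact_mod_cast ht.symm
    rw [Submodule.finrank_eq_zero, LinearMap.range_eq_bot] at h1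
    exact h h1
  have := Module.finrank_pos_iff.1 (Nat.pos_of_ne_zero hne)
  obtain ⟨φ, hφ⟩ := exists_ne (0 : IntertwiningMap σ (res ρ K))
  refine ⟨φ.toLinearMap, ?_, fun k w => IntertwiningMap.isIntertwining σ (res ρ K) φ k w⟩
  rcases hσ.injective_or_eq_zero φ with h | h
  · exact h
  · exact absurd h hφ

variable (N : Subgroup G) [hN : N.Normal] (lam : Representation ℂ N W)

/-- inertia group -/
def stab : Subgroup G where
  carrier := {g | ∀ n : N, lam.character (MulAut.conjNormal g n) = lam.character n}
  one_mem' := fun n => by simp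
  mul_mem' := fun {a b} ha hb n => by
    rw [map_mul, MulAut.mul_apply, ha, hb]
  inv_mem' := fun {a} ha n => by
    rw [← ha, ← MulAut.mul_apply, ← map_mul]; simp

theorem le_stab : N ≤ stab N lam := by
  intro g hg n
  have : MulAut.conjNormal g n = (⟨g, hg⟩ : N) * n * (⟨g, hg⟩ : N)⁻¹ := by
    ext; simp
  rw [this, char_conj]

theorem tw_irr (hl : lam.IsIrreducible) (g : G) :
    Representation.IsIrreducible (lam.comp (MulAut.conjNormal g : MulAut N).toMonoidHom) :=
  (irr_comp lam _ (MulAut.conjNormal g : MulAut N).surjective).1 hl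

theorem eop_tw (ρ : Representation ℂ G V) (g : G) :
    eop lam (res ρ N) * ρ g =
      ρ g * eop (lam.comp (MulAut.conjNormal g : MulAut N).toMonoidHom) (res ρ N) := by
  unfold eop
  rw [Finset.sum_mul, Finset.mul_sum, ← Equiv.sum_comp (MulAut.conjNormal g : MulAut N).toEquiv]
  refine Finset.sum_congr rfl fun n _ => ?_
  have h2 : idm lam (MulAut.conjNormal g n) =
      idm (lam.comp (MulAut.conjNormal g : MulAut N).toMonoidHom) n := by
    unfold idm character
    rw [← map_inv]; rfl
  simp only [MulEquiv.toEquiv_eq_coe, EquivLike.coe_coe, h2, smul_mul_assoc, mul_smul_comm]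
  congr 1
  simp only [MonoidHom.comp_apply, ← map_mul, Subgroup.coe_subtype, MulAut.conjNormal_apply]
  congr 1; group

theorem eop_comm (ρ : Representation ℂ G V) {g : G} (hg : g ∈ stab N lam) :
    eop lam (res ρ N) * ρ g = ρ g * eop lam (res ρ N) := by
  rw [eop_tw]
  congr 1
  unfold eop
  refine Finset.sum_congr rfl fun n _ => ?_
  congr 1
  unfold idm
  have := hg n⁻¹
  rw [← this]; rfl

theorem eop_orth (hl : lam.IsIrreducible) (ρ : Representation ℂ G V) {g : G}
    (hg : g ∉ stab N lam) :
    eop lam (res ρ N) * ρ g * eop lam (res ρ N) = 0 := by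
  rw [eop_tw, mul_assoc, eop_mul _ _ _ (tw_irr N lam hl g) hl, if_neg, mul_zero]
  rintro ⟨e⟩
  apply hg
  intro n
  exact congrFun (char_iso e) n

theorem eop_idem (hl : lam.IsIrreducible) (ρ : Representation ℂ N V) :
    eop lam ρ * eop lam ρ = eop lam ρ := by
  rw [eop_mul lam lam _ hl hl, if_pos ⟨Representation.Equiv.refl lam⟩]

theorem cliff_dim (hl : lam.IsIrreducible) (ρ : Representation ℂ G V) (hρ : ρ.IsIrreducible)
    (hE : eop lam (res ρ N) ≠ 0) : Module.finrank ℂ V = (stab N lam).index *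
      (Module.finrank ℂ (LinearMap.range (eop lam (res ρ N)))) := by
  set E := eop lam (res ρ N) with hEdef
  have hid : E * E = E := eop_idem N lam hl _
  let T : Module.End ℂ V := ∑ g : G, ρ g * E * ρ g⁻¹
  obtain ⟨c, hc⟩ := schur ρ hρ T (fun x => by
    simp only [T]
    rw [Finset.sum_mul, Finset.mul_sum, ← Equiv.sum_comp (Equiv.mulLeft x)]
    refine Finset.sum_congr rfl fun g _ => ?_
    simp only [Equiv.coe_mulLeft, mul_inv_rev, map_mul, mul_assoc]
    rw [← map_mul ρ x⁻¹ x]; simp)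
  have hTE : T * E = (Nat.card (stab N lam) : ℂ) • E := by
    simp only [T]
    rw [Finset.sum_mul]
    have : ∀ g : G, ρ g * E * ρ g⁻¹ * E = if g ∈ stab N lam then E else 0 := by
      intro g
      split_ifs with h
      · rw [← eop_comm N lam ρ h, mul_assoc E, ← map_mul]; simp [hid, ← hEdef]
      · have := eop_orth N lam hl ρ (g := g⁻¹) (fun h' => h (by simpa using inv_mem h'))
        rw [mul_assoc, mul_assoc, ← mul_assoc E, ← hEdef] at *
        rw [this, mul_zero]
    simp only [this, Finset.sum_ite, Finset.sum_const_zero, add_zero, Finset.sum_const,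
      Nat.card_eq_fintype_card, Fintype.card_subtype]
    rw [← Nat.cast_smul_eq_nsmul ℂ]
  have hcE : c = Nat.card (stab N lam) := by
    rw [hc, smul_mul_assoc, one_mul] at hTE
    exact smul_left_injective ℂ hE hTE
  have htr : LinearMap.trace ℂ V T = Nat.card G * LinearMap.trace ℂ V E := by
    simp only [T, map_sum]
    have : ∀ g : G, LinearMap.trace ℂ V (ρ g * E * ρ g⁻¹) = LinearMap.trace ℂ V E := by
      intro g
      rw [LinearMap.trace_mul_comm, ← mul_assoc, ← map_mul]; simp
    simp [this]
  rw [hc, map_smul, LinearMap.trace_one, trace_idem_zero E hid, hcE, smul_eq_mul,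
    ← (stab N lam).card_mul_index] at htr
  have h0 : Nat.card (stab N lam) ≠ 0 := Nat.card_pos.ne'
  have h1 : Nat.card (stab N lam) * Module.finrank ℂ V =
    Nat.card (stab N lam) * (stab N lam).index * Module.finrank ℂ (LinearMap.range E) := by
    exact_mod_cast htr
  rw [mul_assoc] at h1
  exact Nat.eq_of_mul_eq_mul_left (Nat.pos_of_ne_zero h0) h1

theorem cliff_irr (hl : lam.IsIrreducible) (ρ : Representation ℂ G V) (hρ : ρ.IsIrreducible)
    (U : Submodule ℂ V) (hU : ∀ g ∈ stab N lam, ∀ u ∈ U, ρ g u ∈ U)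
    (hUE : U ≤ LinearMap.range (eop lam (res ρ N))) (hU0 : U ≠ ⊥) :
    U = LinearMap.range (eop lam (res ρ N)) := by
  refine le_antisymm hUE ?_
  have hid := eop_idem N lam hl (res ρ N)
  have hfix : ∀ u ∈ U, eop lam (res ρ N) u = u := by
    intro u hu
    obtain ⟨v, rfl⟩ := hUE hu
    exact LinearMap.congr_fun hid v
  let X : Submodule ℂ V := ⨆ g : G, U.map (ρ g)
  have hX : X = ⊤ := by
    rcases ((irr_iff ρ).1 hρ).2 X (by
      intro g x hx
      refine Submodule.iSup_induction _ (motive := fun x => ρ g x ∈ X) hx ?_ (by simp) ?_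
      · rintro h _ ⟨u, hu, rfl⟩
        exact Submodule.mem_iSup_of_mem (g * h) ⟨u, hu, by simp⟩
      · intro x y hx hy
        rw [map_add]; exact X.add_mem hx hy) with h | h
    · exfalso
      apply hU0
      rw [eq_bot_iff, ← h]
      intro u hu
      exact Submodule.mem_iSup_of_mem 1 ⟨u, hu, by simp⟩
    · exact h
  rintro _ ⟨v, rfl⟩
  have hv : v ∈ X := by rw [hX]; trivial
  refine Submodule.iSup_induction _ (motive := fun x => eop lam (res ρ N) x ∈ U) hv ?_ (by simp) ?_
  · rintro g _ ⟨u, hu, rfl⟩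
    by_cases hg : g ∈ stab N lam
    · have := LinearMap.congr_fun (eop_comm N lam ρ hg) u
      simp only [Module.End.mul_apply] at this
      rw [this, hfix u hu]
      exact hU g hg u hu
    · have := LinearMap.congr_fun (eop_orth N lam hl ρ hg) u
      simp only [Module.End.mul_apply] at this
      rw [hfix u hu] at this
      rw [this]; simp
  · intro x y hx hy
    rw [map_add]; exact U.add_mem hx hy

theorem rank_eop (hl : lam.IsIrreducible) (ρ : Representation ℂ G V) :
    Module.finrank ℂ (LinearMap.range (eop lam (res ρ N))) =
      Module.finrank ℂ W * Module.finrank ℂ (IntertwiningMap lam (res ρ N)) := by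
  have h := trace_idem_zero _ (eop_idem N lam hl (res ρ N))
  rw [eop, trace_idm] at h
  exact_mod_cast h.symm

/-- S1 -/
theorem cliff_S1 (hl : lam.IsIrreducible) : ∃ n ∈ charDegrees G,
    (stab N lam).index * Module.finrank ℂ W ∣ n := by
  obtain ⟨V, _, _, _, ρ, hρ, φ, hφ, hi⟩ := exists_over N lam hl
  have hE : eop lam (res ρ N) ≠ 0 := by
    intro h0
    have := ((irr_iff lam).1 hl).1
    obtain ⟨w, hw⟩ := exists_ne (0 : W)
    have h1 := eop_nat lam lam (res ρ N) φ hi w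
    rw [h0, eop_self lam hl] at h1
    exact hw (hφ (by simpa using h1.symm))
  refine ⟨_, mem_cd.2 ⟨V, _, _, ‹_›, ρ, hρ, rfl⟩, ?_⟩
  rw [cliff_dim N lam hl ρ hρ hE, rank_eop N lam hl ρ, ← mul_assoc]
  exact dvd_mul_right _ _

theorem cliff_S2a (hl : lam.IsIrreducible) {U : Type} [AddCommGroup U] [Module ℂ U]
    [FiniteDimensional ℂ U] (τ : Representation ℂ (stab N lam) U) (hτ : τ.IsIrreducible)
    (h1 : eop lam (MonoidHom.comp τ (Subgroup.inclusion (le_stab N lam)) :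
      Representation ℂ N U) = 1) :
    (stab N lam).index * Module.finrank ℂ U ∈ charDegrees G := by
  obtain ⟨V, _, _, _, ρ, hρ, φ, hφ, hi⟩ := exists_over (stab N lam) τ hτ
  have hfix : ∀ u, eop lam (res ρ N) (φ u) = φ u := by
    intro u
    rw [eop_nat lam (MonoidHom.comp τ (Subgroup.inclusion (le_stab N lam)) :
      Representation ℂ N U) (res ρ N) φ (fun n w => hi (Subgroup.inclusion (le_stab N lam) n) w) u, h1]
    rfl
  have hnt := ((irr_iff τ).1 hτ).1
  obtain ⟨w, hw⟩ := exists_ne (0 : U)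
  have hw' : φ w ≠ 0 := fun h => hw (hφ (by simpa using h))
  have hE : eop lam (res ρ N) ≠ 0 := by
    intro h0
    have := hfix w
    rw [h0] at this
    exact hw' (by simpa using this.symm)
  have hr := cliff_irr N lam hl ρ hρ (LinearMap.range φ) (by
    rintro g hg _ ⟨u, rfl⟩
    exact ⟨τ ⟨g, hg⟩ u, hi ⟨g, hg⟩ u⟩) (by
    rintro _ ⟨u, rfl⟩
    exact ⟨φ u, hfix u⟩) (by
    intro h0
    have : φ w ∈ LinearMap.range φ := ⟨w, rfl⟩
    rw [h0] at this
    exact hw' this)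
  refine mem_cd.2 ⟨V, _, _, ‹_›, ρ, hρ, ?_⟩
  rw [cliff_dim N lam hl ρ hρ hE, ← hr, LinearMap.finrank_range_of_inj hφ]

end cliff
end CD
end

noncomputable section
namespace CD
open scoped Classical
open Representation

theorem trace_cyc {V : Type} [AddCommGroup V] [Module ℂ V] [FiniteDimensional ℂ V]
    (T : Module.End ℂ V) {n : ℕ} (hn : n ≠ 0) (hT : T ^ n = 1) {ζ : ℂ} (hζ : IsPrimitiveRoot ζ n) :
    ∃ m : ℕ → ℕ, ∀ k : ℕ, LinearMap.trace ℂ V (T ^ k) =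
      ∑ j ∈ Finset.range n, (m j : ℂ) * (ζ ^ j) ^ k := by
  have hn' : (n : ℂ) ≠ 0 := by exact_mod_cast hn
  have hz : ζ ≠ 0 := hζ.ne_zero hn
  let A : ℕ → Module.End ℂ V := fun j => (ζ ^ j)⁻¹ • T
  let P : ℕ → Module.End ℂ V := fun j => (n : ℂ)⁻¹ • ∑ i ∈ Finset.range n, A j ^ i
  have hA : ∀ j, A j ^ n = 1 := fun j => by
    simp only [A, smul_pow, hT]
    rw [inv_pow, ← pow_mul, mul_comm, pow_mul, hζ.pow_eq_one]; simp
  have hAP : ∀ j, A j * P j = P j := fun j => by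
    have := mul_geom_sum (A j) n
    rw [hA, sub_self, sub_mul, one_mul, sub_eq_zero] at this
    simp only [P, mul_smul_comm, this]
  have hTP : ∀ j, T * P j = ζ ^ j • P j := fun j => by
    have : T = ζ ^ j • A j := by simp [A, smul_smul, pow_ne_zero j hz]
    conv_lhs => rw [this]
    rw [smul_mul_assoc, hAP]
  have hAiP : ∀ j i, A j ^ i * P j = P j := fun j i => by
    induction i with
    | zero => simp
    | succ i ih => rw [pow_succ, mul_assoc, hAP, ih]
  have hid : ∀ j, P j * P j = P j := fun j => by
    conv_lhs => enter [1]; simp only [P]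
    rw [smul_mul_assoc, Finset.sum_mul, Finset.sum_congr rfl fun i _ => hAiP j i]
    rw [Finset.sum_const, Finset.card_range, ← Nat.cast_smul_eq_nsmul ℂ, smul_smul,
      inv_mul_cancel₀ hn', one_smul]
  have hsum : ∑ j ∈ Finset.range n, P j = 1 := by
    simp only [P]
    rw [← Finset.smul_sum, Finset.sum_comm]
    have : ∀ i ∈ Finset.range n, ∑ j ∈ Finset.range n, A j ^ i = if i = 0 then (n : ℂ) • 1 else 0 := by
      intro i hi
      have h1 : ∀ j, A j ^ i = ((ζ ^ i)⁻¹) ^ j • T ^ i := fun j => by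
        simp only [A, smul_pow, inv_pow]
        rw [← pow_mul, ← pow_mul, mul_comm]
      simp only [h1]
      rw [← Finset.sum_smul]
      split_ifs with h0
      · subst h0; simp
      · have hne : (ζ ^ i)⁻¹ ≠ 1 := by
          rw [Ne, inv_eq_one]
          exact hζ.pow_ne_one_of_pos_of_lt h0 (Finset.mem_range.1 hi)
        rw [geom_sum_eq hne, inv_pow, ← pow_mul, mul_comm, pow_mul, hζ.pow_eq_one]; simp
    rw [Finset.sum_congr rfl this, Finset.sum_ite_eq' ]
    simp [hn, smul_smul, hn']
  have hTk : ∀ k j, T ^ k * P j = (ζ ^ j) ^ k • P j := fun k j => by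
    induction k with
    | zero => simp
    | succ k ih => rw [pow_succ, mul_assoc, hTP, mul_smul_comm, ih, smul_smul, pow_succ, mul_comm]
  refine ⟨fun j => Module.finrank ℂ (LinearMap.range (P j)), fun k => ?_⟩
  have : T ^ k = ∑ j ∈ Finset.range n, (ζ ^ j) ^ k • P j := by
    rw [← Finset.sum_congr rfl fun j _ => hTk k j, ← Finset.mul_sum, hsum, mul_one]
  rw [this, map_sum]
  refine Finset.sum_congr rfl fun j _ => ?_
  rw [map_smul, trace_idem_zero _ (hid j), smul_eq_mul, mul_comm]

theorem char_pow {G V : Type} [Group G] [Finite G] [AddCommGroup V] [Module ℂ V]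
    [FiniteDimensional ℂ V] (ρ : Representation ℂ G V) (g : G) :
    ∃ (n : ℕ) (ζ : ℂ) (m : ℕ → ℕ), n ≠ 0 ∧ IsPrimitiveRoot ζ n ∧ n = orderOf g ∧
      ∀ k : ℕ, ρ.character (g ^ k) = ∑ j ∈ Finset.range n, (m j : ℂ) * (ζ ^ j) ^ k := by
  have hn : orderOf g ≠ 0 := (orderOf_pos g).ne'
  have hz := Complex.isPrimitiveRoot_exp (orderOf g) hn
  obtain ⟨m, hm⟩ := trace_cyc (ρ g) hn (by rw [← map_pow, pow_orderOf_eq_one, map_one]) hz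
  exact ⟨_, _, m, hn, hz, rfl, fun k => by rw [← hm, ← map_pow]; rfl⟩

theorem char_int {G V : Type} [Group G] [Finite G] [AddCommGroup V] [Module ℂ V]
    [FiniteDimensional ℂ V] (ρ : Representation ℂ G V) (g : G) : IsIntegral ℤ (ρ.character g) := by
  obtain ⟨n, ζ, m, hn, hz, -, h⟩ := char_pow ρ g
  have := h 1
  rw [pow_one] at this
  rw [this]
  refine IsIntegral.sum _ fun j _ => IsIntegral.mul (by
    simpa using (isIntegral_algebraMap (R := ℤ) (A := ℂ) (x := ((m j : ℕ) : ℤ)))) ?_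
  exact ((hz.isIntegral (Nat.pos_of_ne_zero hn)).pow _).pow _

theorem char_conj' {G V : Type} [Group G] [Finite G] [AddCommGroup V] [Module ℂ V]
    [FiniteDimensional ℂ V] (ρ : Representation ℂ G V) (g : G) :
    ρ.character g⁻¹ = (starRingEnd ℂ) (ρ.character g) := by
  obtain ⟨n, ζ, m, hn, hz, hno, h⟩ := char_pow ρ g
  have h1 := h 1
  have h2 := h (n - 1)
  have h3 : g ^ (n - 1) = g⁻¹ := by
    rw [eq_inv_iff_mul_eq_one, ← pow_succ, Nat.sub_add_cancel (Nat.pos_of_ne_zero hn), hno,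
      pow_orderOf_eq_one]
  rw [h3] at h2
  rw [pow_one] at h1
  rw [h1, h2, map_sum]
  refine Finset.sum_congr rfl fun j _ => ?_
  have hz1 : ‖ζ‖ = 1 := hz.norm'_eq_one hn
  have hz0 : ζ ≠ 0 := hz.ne_zero hn
  have h5 : (ζ ^ j) ^ (n - 1) = (ζ ^ j)⁻¹ := by
    refine eq_inv_of_mul_eq_one_left ?_
    rw [← pow_succ,
      Nat.sub_add_cancel (Nat.pos_of_ne_zero hn), ← pow_mul, mul_comm, pow_mul, hz.pow_eq_one,
      one_pow]
  rw [h5, map_mul, pow_one, map_pow, ← Complex.inv_eq_conj hz1, inv_pow]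
  simp

theorem int_of_rat {a b : ℕ} (hb : b ≠ 0) (h : IsIntegral ℤ ((a : ℂ) / b)) : b ∣ a := by
  have h1 : ((a : ℂ) / b) = algebraMap ℚ ℂ ((a : ℚ) / b) := by simp
  rw [h1, isIntegral_algebraMap_iff (algebraMap ℚ ℂ).injective] at h
  obtain ⟨z, hz⟩ := IsIntegrallyClosed.isIntegral_iff.1 h
  have hb' : (b : ℚ) ≠ 0 := by exact_mod_cast hb
  rw [eq_div_iff hb', eq_intCast] at hz
  have : z * (b : ℤ) = a := by exact_mod_cast hz
  exact Int.natCast_dvd_natCast.1 ⟨z, by rw [mul_comm]; exact this.symm⟩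

theorem lemZ {Γ Q D : Type} [Group Γ] [Finite Γ] [Group Q] [AddCommGroup D] [Module ℂ D]
    [FiniteDimensional ℂ D] (ρ : Representation ℂ Γ D) (hρ : ρ.IsIrreducible) (ψ : Γ →* Q)
    (hk : ∀ k ∈ ψ.ker, ∃ c : ℂ, ρ k = c • (1 : Module.End ℂ D)) :
    Module.finrank ℂ D ∣ Nat.card ψ.range := by
  have := Fintype.ofFinite Γ
  have hnt := ((irr_iff ρ).1 hρ).1
  have hd := irr_fin_pos hρ
  have hd' : (Module.finrank ℂ D : ℂ) ≠ 0 := by exact_mod_cast hd.ne'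
  have hG : (Nat.card Γ : ℂ) ≠ 0 := by exact_mod_cast Nat.card_pos.ne'
  have hK : (Nat.card ψ.ker : ℂ) ≠ 0 := by exact_mod_cast Nat.card_pos.ne'
  let F : Γ → Module.End ℂ D := fun g => ρ.character g⁻¹ • ρ g
  have hF : ∀ g k, k ∈ ψ.ker → F (g * k) = F g := by
    intro g k hkk
    obtain ⟨c, hc⟩ := hk k hkk
    obtain ⟨c', hc'⟩ := hk k⁻¹ (inv_mem hkk)
    have hcc : c * c' = 1 := by
      have : ρ k * ρ k⁻¹ = 1 := by rw [← map_mul]; simp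
      rw [hc, hc', smul_mul_smul_comm, mul_one] at this
      have h1 : (c * c') • (1 : Module.End ℂ D) = (1 : ℂ) • 1 := by rw [this, one_smul]
      exact smul_left_injective ℂ one_ne_zero h1
    simp only [F, mul_inv_rev, character, map_mul, hc, hc', smul_mul_assoc, one_mul, mul_smul_comm,
      mul_one, map_smul, smul_smul, smul_eq_mul]
    congr 1
    rw [mul_comm, ← mul_assoc, hcc, one_mul]
  have h1 : ∑ g, F g = ((Nat.card Γ : ℂ) / Module.finrank ℂ D) • (1 : Module.End ℂ D) := by
    rw [← eop_self ρ hρ, eop, Finset.smul_sum]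
    refine Finset.sum_congr rfl fun g _ => ?_
    simp only [F, idm, smul_smul]
    congr 1
    field_simp
  have hq : ∀ a b : Γ, QuotientGroup.leftRel ψ.ker a b → F a = F b := by
    intro a b hab
    rw [QuotientGroup.leftRel_apply] at hab
    have := hF a _ hab
    rw [← this]; congr 1; group
  let F' : Γ ⧸ ψ.ker → Module.End ℂ D := fun x => F x.out
  have hF' : ∀ g : Γ, F' (QuotientGroup.mk g) = F g := fun g => by
    obtain ⟨k, hk⟩ := QuotientGroup.mk_out_eq_mul ψ.ker g
    simp only [F']
    rw [hk, hF _ _ k.2]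
  have h2 : ∑ g, F g = (Nat.card ψ.ker : ℂ) • ∑ x, F' x := by
    rw [← Finset.sum_fiberwise (s := Finset.univ) (g := fun g : Γ => (QuotientGroup.mk g : Γ ⧸ ψ.ker)),
      Finset.smul_sum]
    refine Finset.sum_congr rfl fun x _ => ?_
    rw [Finset.sum_congr rfl (g := fun _ => F' x), Finset.sum_const, Nat.cast_smul_eq_nsmul ℂ]
    · congr 1
      obtain ⟨y, rfl⟩ := QuotientGroup.mk_surjective x
      rw [← Fintype.card_subtype, ← Nat.card_eq_fintype_card]
      refine Nat.card_congr ?_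
      exact {
        toFun := fun z => ⟨y⁻¹ * z.1, QuotientGroup.eq.1 z.2.symm⟩
        invFun := fun k => ⟨y * k.1, by
          rw [QuotientGroup.eq]; simp [mul_assoc] ⟩
        left_inv := fun z => by ext; simp
        right_inv := fun z => by ext; simp }
    · intro g hg
      rw [Finset.mem_filter] at hg
      rw [← hg.2, hF']
  let s : ℂ := (Nat.card ψ.range : ℂ) / Module.finrank ℂ D
  have hcard : Nat.card Γ = Nat.card ψ.range * Nat.card ψ.ker := by
    rw [← Nat.card_congr (QuotientGroup.quotientKerEquivRange ψ).toEquiv]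
    exact ψ.ker.card_eq_card_quotient_mul_card_subgroup
  have h3 : ∑ x, F' x = s • (1 : Module.End ℂ D) := by
    have := h2.symm.trans h1
    rw [hcard] at this
    have h5 : ∑ x, F' x = (Nat.card ψ.ker : ℂ)⁻¹ • (Nat.card ψ.ker : ℂ) • ∑ x, F' x := by
      rw [smul_smul, inv_mul_cancel₀ hK, one_smul]
    rw [h5, this, smul_smul]
    congr 1
    simp only [s]; push_cast
    field_simp
  let O := integralClosure ℤ ℂ
  let L : Submodule O (Module.End ℂ D) := Submodule.span O (Set.range ρ)
  have hL0 : L ≠ ⊥ := by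
    intro h0
    have : (1 : Module.End ℂ D) ∈ L := Submodule.subset_span ⟨1, map_one ρ⟩
    rw [h0] at this
    exact one_ne_zero this
  have hs : IsIntegral O s := by
    refine isIntegral_of_smul_mem_submodule L hL0 (Submodule.fg_span (Set.finite_range ρ)) s ?_
    intro x hx
    have : s • x = ∑ y, F' y * x := by
      rw [← Finset.sum_mul, h3, smul_mul_assoc, one_mul]
    rw [this]
    refine L.sum_mem fun y _ => ?_
    simp only [F', F, smul_mul_assoc]
    have hmul : ∀ g, ρ g * x ∈ L := by
      intro g
      clear this
      induction hx using Submodule.span_induction with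
      | mem x hx =>
        obtain ⟨h, rfl⟩ := hx
        exact Submodule.subset_span ⟨g * h, map_mul _ _ _⟩
      | zero => simp
      | add x y _ _ hx hy => rw [mul_add]; exact L.add_mem hx hy
      | smul a x _ hx => rw [mul_smul_comm]; exact L.smul_mem _ hx
    exact L.smul_mem (⟨_, char_int ρ _⟩ : O) (hmul _)
  exact int_of_rat hd.ne' (isIntegral_trans (R := ℤ) (A := O) s hs)

end CD
end

noncomputable section
namespace CD
open scoped Classical
open Representation

theorem exists_irr_sub {H : Type} [Group H] (n : ℕ) : ∀ (V : Type) [AddCommGroup V] [Module ℂ V]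
    [FiniteDimensional ℂ V] [Nontrivial V] (ρ : Representation ℂ H V), Module.finrank ℂ V = n →
    ∃ (W : Type) (_ : AddCommGroup W) (_ : Module ℂ W) (_ : FiniteDimensional ℂ W)
      (lam : Representation ℂ H W) (φ : W →ₗ[ℂ] V), lam.IsIrreducible ∧ Function.Injective φ ∧
        ∀ h w, φ (lam h w) = ρ h (φ w) := by
  induction n using Nat.strong_induction_on with
  | _ n ih =>
  intro V _ _ _ hs ρ hn
  by_cases hi : ρ.IsIrreducible
  · exact ⟨V, _, _, ‹_›, ρ, LinearMap.id, hi, fun _ _ h => h, fun _ _ => rfl⟩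
  rw [irr_iff] at hi
  push Not at hi
  obtain ⟨U, hU, hb, ht⟩ := hi hs
  let U' : Subrepresentation ρ := ⟨U, fun g v hv => hU g v hv⟩
  have : Nontrivial U := Submodule.nontrivial_iff_ne_bot.2 hb
  obtain ⟨W, _, _, _, lam, φ, h1, h2, h3⟩ := ih _ (hn ▸ Submodule.finrank_lt ht) U
    U'.toRepresentation rfl
  refine ⟨W, _, _, ‹_›, lam, U.subtype.comp φ, h1, ?_, ?_⟩
  · intro a b hab
    exact h2 (Subtype.ext hab)
  · intro h w
    simp only [LinearMap.comp_apply, h3]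
    rfl

section gam
variable {G W V : Type} [Group G] [Fintype G] [AddCommGroup W] [Module ℂ W]
  [FiniteDimensional ℂ W] [AddCommGroup V] [Module ℂ V] [FiniteDimensional ℂ V]
variable (N : Subgroup G) [hN : N.Normal] (lam : Representation ℂ N W)

/-- the projective cover group -/
def Gam : Subgroup (G × (Module.End ℂ W)ˣ) where
  carrier := {x | (∀ n : N, x.2.val * lam n = lam (MulAut.conjNormal x.1 n) * x.2.val) ∧
    LinearMap.det x.2.val ^ Nat.card N = 1}
  one_mem' := by simp
  mul_mem' := by
    rintro a b ⟨ha, ha'⟩ ⟨hb, hb'⟩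
    refine ⟨fun n => ?_, ?_⟩
    · simp only [Prod.snd_mul, Units.val_mul, Prod.fst_mul, map_mul, MulAut.mul_apply]
      rw [mul_assoc, hb, ← mul_assoc, ha, mul_assoc]
    · simp only [Prod.snd_mul, Units.val_mul, map_mul, mul_pow, ha', hb', mul_one]
  inv_mem' := by
    rintro a ⟨ha, ha'⟩
    refine ⟨fun n => ?_, ?_⟩
    · have h := ha (MulAut.conjNormal a.1⁻¹ n)
      rw [← MulAut.mul_apply, ← map_mul, mul_inv_cancel, map_one, MulAut.one_apply] at h
      simp only [Prod.snd_inv, Prod.fst_inv]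
      rw [Units.inv_mul_eq_iff_eq_mul, ← mul_assoc, h, mul_assoc, Units.mul_inv, mul_one]
    · have h : LinearMap.det a.2.val * LinearMap.det a⁻¹.2.val = 1 := by
        rw [← map_mul, Prod.snd_inv, Units.mul_inv, map_one]
      have h2 := congrArg (· ^ Nat.card N) h
      simp only [mul_pow, ha', one_mul, one_pow] at h2
      exact h2

theorem schurI (hl : lam.IsIrreducible) {g : G} (A B : Module.End ℂ W) (hB : IsUnit B)
    (h1 : ∀ n : N, A * lam n = lam (MulAut.conjNormal g n) * A)
    (h2 : ∀ n : N, B * lam n = lam (MulAut.conjNormal g n) * B) : ∃ c : ℂ, A = c • B := by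
  obtain ⟨u, rfl⟩ := hB
  obtain ⟨c, hc⟩ := schur lam hl (u⁻¹.val * A) (fun n => by
    rw [mul_assoc, h1, Units.inv_mul_eq_iff_eq_mul, ← mul_assoc, ← mul_assoc, h2,
      mul_assoc, mul_assoc, ← mul_assoc u.val, Units.mul_inv, one_mul])
  refine ⟨c, ?_⟩
  rw [Units.inv_mul_eq_iff_eq_mul] at hc
  rw [hc, mul_smul_comm, mul_one]

theorem lam_conj (n m : N) : lam n * lam m = lam (MulAut.conjNormal (n : G) m) * lam n := by
  rw [← map_mul, ← map_mul]
  congr 1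
  ext; simp

theorem gam_finite (hl : lam.IsIrreducible) : Finite (Gam N lam) := by
  let π : Gam N lam →* G := (MonoidHom.fst _ _).comp (Gam N lam).subtype
  have hw := irr_fin_pos hl
  have : Finite π.ker := by
    let R : Finset ℂ := Polynomial.nthRootsFinset (Module.finrank ℂ W * Nat.card N) (1 : ℂ)
    let S : Set (Module.End ℂ W) := (fun c : ℂ => c • (1 : Module.End ℂ W)) '' (R : Set ℂ)
    have hS : S.Finite := (Finset.finite_toSet R).image _
    have := hS.to_subtype
    refine Finite.of_injective (β := S) (fun k => ⟨k.1.1.2.val, ?_⟩) ?_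
    · have hk : k.1.1.1 = 1 := k.2
      have hg := k.1.2
      obtain ⟨c, hc⟩ := schurI N lam hl (g := 1) k.1.1.2.val 1 isUnit_one (fun n => by
        rw [← hk]; exact hg.1 n) (fun n => by simp)
      refine ⟨c, ?_, hc.symm⟩
      have h2 := hg.2
      rw [hc, LinearMap.det_smul, map_one, mul_one, ← pow_mul] at h2
      exact (Polynomial.mem_nthRootsFinset (Nat.mul_pos hw Nat.card_pos) 1).2 h2
    · intro a b hab
      have ha : a.1.1.1 = 1 := a.2
      have hb : b.1.1.1 = 1 := b.2
      apply Subtype.ext; apply Subtype.ext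
      refine Prod.ext (ha.trans hb.symm) (Units.ext ?_)
      exact congrArg Subtype.val hab
  have : Finite (Gam N lam ⧸ π.ker) :=
    Finite.of_injective _ (QuotientGroup.kerLift_injective π)
  exact Finite.of_subgroup_quotient π.ker

theorem exists_Gam (hl : lam.IsIrreducible) :
    ∃ (Γ : Type) (_ : Group Γ) (_ : Finite Γ) (π : Γ →* G) (A : Representation ℂ Γ W),
      (∀ γ (n : N), A γ * lam n = lam (MulAut.conjNormal (π γ) n) * A γ) ∧
      π.range = stab N lam ∧
      (∀ n : N, ∃ γ, π γ = n ∧ A γ = lam n) ∧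
      (∀ γ (n : N), π γ = n → ∃ c : ℂ, c ≠ 0 ∧ A γ = c • lam n) := by
  refine ⟨Gam N lam, inferInstance, gam_finite N lam hl,
    (MonoidHom.fst _ _).comp (Gam N lam).subtype,
    (Units.coeHom _).comp ((MonoidHom.snd _ _).comp (Gam N lam).subtype), ?_, ?_, ?_, ?_⟩
  · intro γ n
    exact γ.2.1 n
  · ext g
    constructor
    · rintro ⟨γ, rfl⟩ n
      have h := γ.2.1 n
      have h2 : lam (MulAut.conjNormal γ.1.1 n) = γ.1.2.val * lam n * γ.1.2⁻¹.val := by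
        rw [h, mul_assoc, Units.mul_inv, mul_one]
      change LinearMap.trace ℂ W (lam (MulAut.conjNormal γ.1.1 n)) = LinearMap.trace ℂ W (lam n)
      rw [h2, LinearMap.trace_mul_comm, ← mul_assoc, Units.inv_mul, one_mul]
    · intro hg
      obtain ⟨e⟩ := equiv_of_char lam
        (lam.comp (MulAut.conjNormal g : MulAut N).toMonoidHom : Representation ℂ N W) hl
        (tw_irr N lam hl g) (funext fun n => (hg n).symm)
      let A0 : Module.End ℂ W := e.toIntertwiningMap.toLinearMap
      have hA0 : ∀ n : N, A0 * lam n = lam (MulAut.conjNormal g n) * A0 := fun n => by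
        ext w
        exact IntertwiningMap.isIntertwining lam _ e.toIntertwiningMap n w
      have hu : IsUnit A0 := by
        rw [Module.End.isUnit_iff]
        exact e.toLinearEquiv.bijective
      have hdet : LinearMap.det A0 ≠ 0 := by
        have := hu.map (LinearMap.det : Module.End ℂ W →* ℂ)
        exact this.ne_zero
      obtain ⟨c, hc⟩ := IsAlgClosed.exists_pow_nat_eq (LinearMap.det A0)⁻¹ (irr_fin_pos hl)
      have hc0 : c ≠ 0 := by
        rintro rfl
        rw [zero_pow (irr_fin_pos hl).ne'] at hc
        exact inv_ne_zero hdet hc.symm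
      have hu2 : IsUnit (c • A0) := by
        obtain ⟨u, hu⟩ := hu
        exact ⟨⟨c • u.val, c⁻¹ • u⁻¹.val, by simp [smul_smul, hc0], by simp [smul_smul, hc0]⟩, by
          simp [hu]⟩
      obtain ⟨u, hu3⟩ := hu2
      refine ⟨⟨(g, u), fun n => ?_, ?_⟩, rfl⟩
      · simp only [hu3]
        rw [smul_mul_assoc, hA0, mul_smul_comm]
      · simp only [hu3]
        rw [LinearMap.det_smul, hc, inv_mul_cancel₀ hdet, one_pow]
  · intro n
    refine ⟨⟨((n : G), ⟨lam n, lam n⁻¹, by rw [← map_mul]; simp, by rw [← map_mul]; simp⟩),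
      fun m => lam_conj N lam n m, ?_⟩, rfl, rfl⟩
    change LinearMap.det (lam n) ^ Nat.card N = 1
    rw [← map_pow, ← map_pow, pow_card_eq_one', map_one, map_one]
  · intro γ n hn
    have hn' : γ.1.1 = n := hn
    obtain ⟨c, hc⟩ := schurI N lam hl (g := γ.1.1) γ.1.2.val (lam n)
      ⟨⟨lam n, lam n⁻¹, by rw [← map_mul]; simp, by rw [← map_mul]; simp⟩, rfl⟩ γ.2.1 (by
        intro m
        rw [hn']; exact lam_conj N lam n m)
    refine ⟨c, ?_, hc⟩
    rintro rfl
    have hnt := ((irr_iff lam).1 hl).1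
    rw [zero_smul] at hc
    exact γ.1.2.ne_zero hc

/-- S3 -/
theorem cliff_S3 (ρ : Representation ℂ G V) (hρ : ρ.IsIrreducible) (N : Subgroup G) [N.Normal]
    (p : ℕ) (hp : p.Prime)
    (hpV : p ∣ Module.finrank ℂ V) (hpN : ¬ p ∣ N.index) :
    ∃ (W : Type) (_ : AddCommGroup W) (_ : Module ℂ W) (_ : FiniteDimensional ℂ W)
      (lam : Representation ℂ N W), lam.IsIrreducible ∧ p ∣ Module.finrank ℂ W := by
  have hnt := ((irr_iff ρ).1 hρ).1
  obtain ⟨W, _, _, _, lam, φ, hl, hφ, hi⟩ := exists_irr_sub _ V (res ρ N) rfl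
  refine ⟨W, _, _, ‹_›, lam, hl, ?_⟩
  have hE : eop lam (res ρ N) ≠ 0 := by
    intro h0
    have := ((irr_iff lam).1 hl).1
    obtain ⟨w, hw⟩ := exists_ne (0 : W)
    have h1 := eop_nat lam lam (res ρ N) φ hi w
    rw [h0, eop_self lam hl] at h1
    exact hw (hφ (by simpa using h1.symm))
  have hdim := cliff_dim N lam hl ρ hρ hE
  have hr := rank_eop N lam hl ρ
  obtain ⟨Γ, _, _, π, A, hA1, hA2, hA3, hA4⟩ := exists_Gam N lam hl
  have hAinv : ∀ γ, A γ * A γ⁻¹ = 1 := fun γ => by rw [← map_mul]; simp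
  have hAinv' : ∀ γ, A γ⁻¹ * A γ = 1 := fun γ => by rw [← map_mul]; simp
  let D := IntertwiningMap lam (res ρ N)
  have hDi : ∀ (φ : D) (n : N) w, φ (lam n w) = ρ n (φ w) := fun φ n w =>
    IntertwiningMap.isIntertwining lam (res ρ N) φ n w
  let act : Γ → D → D := fun γ φ => ⟨ρ (π γ) ∘ₗ φ.toLinearMap ∘ₗ A γ⁻¹, fun n => by
    ext w
    have h1 := LinearMap.congr_fun (hA1 γ⁻¹ n) w
    simp only [Module.End.mul_apply] at h1
    simp only [LinearMap.comp_apply, h1]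
    change ρ (π γ) (φ _) = ρ n (ρ (π γ) (φ _))
    rw [hDi, ← Module.End.mul_apply, ← Module.End.mul_apply, ← map_mul, ← map_mul]
    congr 2
    simp [← mul_assoc]⟩
  have hact : ∀ γ φ w, (act γ φ) w = ρ (π γ) (φ (A γ⁻¹ w)) := fun _ _ _ => rfl
  let δ : Representation ℂ Γ D :=
    { toFun := fun γ =>
        { toFun := act γ
          map_add' := fun a b => by ext w; exact (congrArg (ρ (π γ)) rfl).trans (map_add (ρ (π γ)) _ _)
          map_smul' := fun a b => by ext w; exact (congrArg (ρ (π γ)) rfl).trans (map_smul (ρ (π γ)) _ _) }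
      map_one' := by
        ext φ w
        simp [hact]
      map_mul' := fun a b => by
        ext φ w
        simp [hact] }
  have hδ : ∀ γ φ w, (δ γ φ) w = ρ (π γ) (φ (A γ⁻¹ w)) := fun _ _ _ => rfl
  have hw := irr_fin_pos hl
  have hEpos : 0 < Module.finrank ℂ (LinearMap.range (eop lam (res ρ N))) := by
    rw [Nat.pos_iff_ne_zero, Ne, Submodule.finrank_eq_zero, LinearMap.range_eq_bot]
    exact hE
  have hDfin : FiniteDimensional ℂ D := by
    apply FiniteDimensional.of_finrank_pos
    by_contra hc
    rw [hr] at hEpos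
    exact hc (Nat.pos_of_mul_pos_left hEpos)
  have hDnt : Nontrivial D := by
    apply (Module.finrank_pos_iff (R := ℂ)).1
    rw [hr] at hEpos
    exact Nat.pos_of_mul_pos_left hEpos
  have hirr : δ.IsIrreducible := by
    rw [irr_iff]
    refine ⟨hDnt, fun D₁ hD₁ => ?_⟩
    by_cases hb : D₁ = ⊥
    · exact Or.inl hb
    right
    let ev : D →ₗ[ℂ] W →ₗ[ℂ] V :=
      { toFun := fun φ => φ.toLinearMap
        map_add' := fun _ _ => rfl
        map_smul' := fun _ _ => rfl }
    let m : TensorProduct ℂ D₁ W →ₗ[ℂ] V := TensorProduct.lift (ev.comp D₁.subtype)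
    have hm : ∀ (φ : D₁) w, m (φ ⊗ₜ w) = φ.1 w := fun φ w => rfl
    have hU : LinearMap.range m = LinearMap.range (eop lam (res ρ N)) := by
      refine cliff_irr N lam hl ρ hρ _ ?_ ?_ ?_
      · rintro g hg _ ⟨t, rfl⟩
        rw [← hA2] at hg
        obtain ⟨γ, rfl⟩ := hg
        induction t using TensorProduct.induction_on with
        | zero => simp
        | tmul φ w =>
          refine ⟨⟨δ γ φ.1, hD₁ γ _ φ.2⟩ ⊗ₜ (A γ w), ?_⟩
          rw [hm, hm]
          simp only [hδ]
          rw [← Module.End.mul_apply, hAinv', Module.End.one_apply]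
        | add x y hx hy => rw [map_add, map_add]; exact Submodule.add_mem _ hx hy
      · rintro _ ⟨t, rfl⟩
        induction t using TensorProduct.induction_on with
        | zero => simp
        | tmul φ w =>
          refine ⟨φ.1 w, ?_⟩
          rw [hm]
          have := eop_nat lam lam (res ρ N) φ.1.toLinearMap (hDi φ.1) w
          rw [eop_self lam hl] at this
          exact this
        | add x y hx hy => rw [map_add]; exact Submodule.add_mem _ hx hy
      · intro h0
        obtain ⟨φ, hφ, hφ0⟩ := Submodule.exists_mem_ne_zero_of_ne_bot hb
        apply hφ0
        ext w
        have : m ((⟨φ, hφ⟩ : D₁) ⊗ₜ w) ∈ LinearMap.range m := ⟨_, rfl⟩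
        rw [h0, hm] at this
        simpa using this
    have h1 : Module.finrank ℂ (LinearMap.range m) ≤ Module.finrank ℂ D₁ * Module.finrank ℂ W := by
      rw [← Module.finrank_tensorProduct]
      exact LinearMap.finrank_range_le m
    rw [hU, hr, mul_comm] at h1
    exact Submodule.eq_top_of_finrank_eq (le_antisymm (Submodule.finrank_le _)
      (Nat.le_of_mul_le_mul_right h1 hw))
  have hz := lemZ δ hirr ((QuotientGroup.mk' N).comp π) (by
    intro γ hγ
    have hγ' : π γ ∈ N := by simpa using hγ
    obtain ⟨c, hc, hAc⟩ := hA4 γ⁻¹ (⟨π γ, hγ'⟩⁻¹) (by simp)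
    refine ⟨c, ?_⟩
    ext φ w
    change ρ (π γ) (φ (A γ⁻¹ w)) = c • φ w
    rw [hAc]
    simp only [LinearMap.smul_apply, Module.End.one_apply, map_smul, hDi]
    rw [← Module.End.mul_apply, ← map_mul]
    simp)
  have hz2 : Module.finrank ℂ D ∣ N.index :=
    hz.trans (Subgroup.card_subgroup_dvd_card _)
  have hst : (stab N lam).index ∣ N.index := Subgroup.index_dvd_of_le (le_stab N lam)
  rw [hdim, hr] at hpV
  rcases hp.dvd_mul.1 hpV with h | h
  · exact absurd (h.trans hst) hpN
  · rcases hp.dvd_mul.1 h with h | h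
    · exact h
    · exact absurd (h.trans hz2) hpN

end gam
end CD
end

noncomputable section
namespace CD
open scoped Classical
open Representation

section s2
variable {G W : Type} [Group G] [Fintype G] [AddCommGroup W] [Module ℂ W]
  [FiniteDimensional ℂ W] 
variable (N : Subgroup G) [hN : N.Normal] (lam : Representation ℂ N W)

theorem density (hl : lam.IsIrreducible) (f : Module.Dual ℂ W) (x : W) :
    ∑ n : N, f (lam n⁻¹ x) • lam n =
      ((Nat.card N : ℂ) / Module.finrank ℂ W) • f.smulRight x := by
  have hw : (Module.finrank ℂ W : ℂ) ≠ 0 := by exact_mod_cast (irr_fin_pos hl).ne'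
  ext y
  obtain ⟨c, hc⟩ := schur lam hl (∑ n : N, lam n * f.smulRight y * lam n⁻¹) (fun m => by
    rw [Finset.sum_mul, Finset.mul_sum, ← Equiv.sum_comp (Equiv.mulLeft m)]
    refine Finset.sum_congr rfl fun g _ => ?_
    simp only [Equiv.coe_mulLeft, mul_inv_rev, map_mul, mul_assoc]
    rw [← map_mul lam m⁻¹ m]; simp)
  have ht := congrArg (LinearMap.trace ℂ W) hc
  rw [map_sum, map_smul, LinearMap.trace_one, smul_eq_mul] at ht
  have h1 : ∀ n : N, LinearMap.trace ℂ W (lam n * f.smulRight y * lam n⁻¹) = f y := fun n => by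
    rw [LinearMap.trace_mul_comm, ← mul_assoc, ← map_mul, inv_mul_cancel, map_one, one_mul,
      LinearMap.trace_smulRight]
  simp only [h1, Finset.sum_const, Finset.card_univ, ← Nat.card_eq_fintype_card, nsmul_eq_mul] at ht
  have h2 := LinearMap.congr_fun hc x
  simp only [LinearMap.sum_apply, Module.End.mul_apply, LinearMap.smulRight_apply, map_smul,
    LinearMap.smul_apply, Module.End.one_apply] at h2
  simp only [LinearMap.sum_apply, LinearMap.smul_apply, LinearMap.smulRight_apply]
  rw [h2, smul_smul]
  congr 1
  field_simp
  rw [← ht]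

/-- S2 -/
theorem cliff_S2 (hl : lam.IsIrreducible) {Γ : Type} [Group Γ] (π : Γ →* G)
    (A : Representation ℂ Γ W) (hA2 : π.range = stab N lam)
    (hA3 : ∀ n : N, ∃ γ, π γ = n ∧ A γ = lam n)
    (hA4 : ∀ γ (n : N), π γ = n → ∃ c : ℂ, c ≠ 0 ∧ A γ = c • lam n)
    {D : Type} [AddCommGroup D] [Module ℂ D] [FiniteDimensional ℂ D]
    (δ : Representation ℂ Γ D) (hδ : δ.IsIrreducible)
    (hk : ∀ γ (n : N) (c : ℂ), π γ = n → c ≠ 0 → A γ = c • lam n → δ γ = c⁻¹ • 1) :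
    (stab N lam).index * (Module.finrank ℂ W * Module.finrank ℂ D) ∈ charDegrees G := by
  have hAinv : ∀ γ, A γ * A γ⁻¹ = 1 := fun γ => by rw [← map_mul]; simp
  have hntD := ((irr_iff δ).1 hδ).1
  have hntW := ((irr_iff lam).1 hl).1
  let Θ : Representation ℂ Γ (Module.Dual ℂ W →ₗ[ℂ] D) :=
    { toFun := fun γ =>
        { toFun := fun u => δ γ ∘ₗ u ∘ₗ (A γ).dualMap
          map_add' := fun a b => LinearMap.ext fun w => map_add (δ γ) _ _
          map_smul' := fun a b => LinearMap.ext fun w => map_smul (δ γ) _ _ }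
      map_one' := by
        ext u f
        simp only [map_one]
        rfl
      map_mul' := fun a b => by
        ext u f
        simp only [map_mul]
        rfl }
  have hΘ : ∀ γ u f, Θ γ u f = δ γ (u (f ∘ₗ A γ)) := fun _ _ _ => rfl
  have hΘn : ∀ γ (n : N), π γ = n → ∀ u f, Θ γ u f = u (f ∘ₗ lam n) := by
    intro γ n hn u f
    obtain ⟨c, hc, hAc⟩ := hA4 γ n hn
    rw [hΘ, hk γ n c hn hc hAc, hAc, LinearMap.comp_smul, map_smul]
    simp [smul_smul, hc]
  have hΘk : ∀ γ, π γ = 1 → Θ γ = 1 := by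
    intro γ h1
    ext u f
    rw [hΘn γ 1 (by simpa using h1), map_one]; rfl
  have hirr : Θ.IsIrreducible := by
    rw [irr_iff]
    refine ⟨inferInstance, fun U₁ hU₁ => ?_⟩
    by_cases hb : U₁ = ⊥
    · exact Or.inl hb
    right
    let ro : W → D → (Module.Dual ℂ W →ₗ[ℂ] D) := fun x d => (Module.Dual.eval ℂ W x).smulRight d
    have hro : ∀ x d f, ro x d f = f x • d := fun x d f => rfl
    have h1 : ∀ u ∈ U₁, ∀ f x, ro x (u f) ∈ U₁ := by
      intro u hu f x
      have hs : ∑ n : N, f (lam n⁻¹ x) • Θ (hA3 n).choose u ∈ U₁ :=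
        U₁.sum_mem fun n _ => U₁.smul_mem _ (hU₁ _ u hu)
      have he : ∑ n : N, f (lam n⁻¹ x) • Θ (hA3 n).choose u =
          ((Nat.card N : ℂ) / Module.finrank ℂ W) • ro x (u f) := by
        ext f'
        have h2 := density N lam hl f x
        simp only [LinearMap.sum_apply, LinearMap.smul_apply]
        have h3 : ∀ n : N, (Θ (hA3 n).choose u) f' = u (f' ∘ₗ lam n) := fun n =>
          hΘn _ n (hA3 n).choose_spec.1 u f'
        simp only [h3]
        simp only [← map_smul, ← map_sum]
        have h4 : ∑ n : N, f (lam n⁻¹ x) • f' ∘ₗ lam n =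
          f' ∘ₗ (∑ n : N, f (lam n⁻¹ x) • lam n) := by
          ext y; simp
        rw [h4, h2, map_smul, hro, ← map_smul u, LinearMap.comp_smul, map_smul]
        congr 2
        ext y
        simp [mul_comm]
      rw [he] at hs
      refine (Submodule.smul_mem_iff _ ?_).1 hs
      have := irr_fin_pos hl
      have : (Nat.card N : ℂ) ≠ 0 := by exact_mod_cast Nat.card_pos.ne'
      have : (Module.finrank ℂ W : ℂ) ≠ 0 := by exact_mod_cast (irr_fin_pos hl).ne'
      positivity
    let D₁ : Submodule ℂ D :=
      { carrier := {d | ∀ x, ro x d ∈ U₁}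
        add_mem' := fun {a b} ha hb x => by
          have : ro x (a + b) = ro x a + ro x b := LinearMap.ext fun f => smul_add _ _ _
          rw [this]; exact U₁.add_mem (ha x) (hb x)
        zero_mem' := fun x => by
          have : ro x 0 = 0 := LinearMap.ext fun f => smul_zero _
          rw [this]; exact U₁.zero_mem
        smul_mem' := fun c a ha x => by
          have : ro x (c • a) = c • ro x a := LinearMap.ext fun f => smul_comm _ _ _
          rw [this]; exact U₁.smul_mem _ (ha x) }
    have hD₁ : D₁ = ⊤ := by
      rcases ((irr_iff δ).1 hδ).2 D₁ (by
        intro γ d hd x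
        have h2 := hU₁ γ _ (hd (A γ⁻¹ x))
        convert h2 using 1
        ext f
        rw [hro, hΘ, hro, map_smul]
        congr 1
        rw [LinearMap.comp_apply, ← Module.End.mul_apply, hAinv, Module.End.one_apply]) with h | h
      · exfalso
        obtain ⟨u, hu, hu0⟩ := Submodule.exists_mem_ne_zero_of_ne_bot hb
        apply hu0
        ext f
        have : u f ∈ D₁ := h1 u hu f
        rw [h] at this
        simpa using this
      · exact h
    rw [eq_top_iff]
    intro u _
    let b := Module.finBasis ℂ W
    have hu : u = ∑ i, ro (b i) (u (b.coord i)) := by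
      ext f
      simp only [LinearMap.sum_apply, hro]
      rw [← Finset.sum_congr rfl fun i _ => map_smul u (f (b i)) (b.coord i), ← map_sum]
      congr 1
      refine b.ext fun j => ?_
      simp [Finsupp.single_apply]
    rw [hu]
    refine U₁.sum_mem fun i _ => ?_
    have : u (b.coord i) ∈ D₁ := by rw [hD₁]; trivial
    exact this _
  -- descend
  let π' : Γ →* stab N lam := π.codRestrict (stab N lam) (fun γ => by rw [← hA2]; exact ⟨γ, rfl⟩)
  have hπ' : Function.Surjective π' := by
    rintro ⟨g, hg⟩
    rw [← hA2] at hg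
    obtain ⟨γ, rfl⟩ := hg
    exact ⟨γ, rfl⟩
  let τ : Representation ℂ (stab N lam) (Module.Dual ℂ W →ₗ[ℂ] D) := (QuotientGroup.lift π'.ker Θ (by
    intro γ hγ
    exact hΘk γ (congrArg Subtype.val (show π' γ = 1 from hγ)))).comp
      (QuotientGroup.quotientKerEquivOfSurjective π' hπ').symm.toMonoidHom
  have hτ : ∀ γ, τ (π' γ) = Θ γ := by
    intro γ
    have : (QuotientGroup.quotientKerEquivOfSurjective π' hπ').symm (π' γ) =
      QuotientGroup.mk γ := by
      rw [MulEquiv.symm_apply_eq]; rfl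
    simp only [τ, MonoidHom.comp_apply, MulEquiv.coe_toMonoidHom, this]
    rfl
  have hτi : τ.IsIrreducible := by
    rw [irr_comp τ π' hπ']
    have : τ.comp π' = Θ := MonoidHom.ext hτ
    rw [this]; exact hirr
  have hfin : Module.finrank ℂ (Module.Dual ℂ W →ₗ[ℂ] D) = Module.finrank ℂ W * Module.finrank ℂ D := by
    rw [Module.finrank_linearMap, Subspace.dual_finrank_eq]
  rw [← hfin]
  refine cliff_S2a N lam hl τ hτi ?_
  ext u f
  have h5 := eop_self lam hl
  unfold eop at h5 ⊢
  have h3 : ∀ n : N, (MonoidHom.comp τ (Subgroup.inclusion (le_stab N lam)) :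
      Representation ℂ N (Module.Dual ℂ W →ₗ[ℂ] D)) n u f = u (f ∘ₗ lam n) := fun n => by
    obtain ⟨γ, hγ, -⟩ := hA3 n
    have : Subgroup.inclusion (le_stab N lam) n = π' γ := Subtype.ext hγ.symm
    rw [MonoidHom.comp_apply, this, hτ]
    exact hΘn γ n hγ u f
  simp only [LinearMap.sum_apply, LinearMap.smul_apply, h3]
  rw [← Finset.sum_congr rfl fun n _ => map_smul u (idm lam n) (f ∘ₗ lam n), ← map_sum]
  have h4 : ∑ n : N, idm lam n • f ∘ₗ lam n = f ∘ₗ (∑ n : N, idm lam n • lam n) := by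
    ext y; simp
  rw [h4, h5]
  rfl

theorem exists_eta (hl : lam.IsIrreducible) {Γ Q : Type} [Group Γ] [Group Q] (π : Γ →* G)
    (A : Representation ℂ Γ W)
    (hA1 : ∀ γ (n : N), A γ * lam n = lam (MulAut.conjNormal (π γ) n) * A γ)
    (hA4 : ∀ γ (n : N), π γ = n → ∃ c : ℂ, c ≠ 0 ∧ A γ = c • lam n)
    (ψ : Γ →* Q) (hψ : ∀ γ, ψ γ = 1 ↔ π γ ∈ N) :
    ∃ η : ψ.ker →* ℂˣ, (∀ γ k, η (MulAut.conjNormal γ k) = η k) ∧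
      ∀ (k : ψ.ker) (n : N) (c : ℂ), π k = n → c ≠ 0 → A k = c • lam n → (η k : ℂ) = c⁻¹ := by
  have hntW := ((irr_iff lam).1 hl).1
  have hl0 : ∀ n : N, lam n ≠ 0 := fun n h0 => by
    have : lam n * lam n⁻¹ = 1 := by rw [← map_mul]; simp
    rw [h0, zero_mul] at this
    exact zero_ne_one this
  have hex : ∀ k : ψ.ker, ∃ c : ℂ, c ≠ 0 ∧ A k = c • lam ⟨π k, (hψ _).1 k.2⟩ := fun k =>
    hA4 k ⟨π k, (hψ _).1 k.2⟩ rfl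
  choose c hc0 hc using hex
  have huniq : ∀ (k : ψ.ker) (n : N) (d : ℂ), π k = n → A k = d • lam n → d = c k := by
    intro k n d hn hd
    have : n = ⟨π k, (hψ _).1 k.2⟩ := Subtype.ext hn.symm
    subst this
    rw [hc k] at hd
    exact (smul_left_injective ℂ (hl0 _) hd).symm
  refine ⟨⟨⟨fun k => (Units.mk0 (c k) (hc0 k))⁻¹, ?_⟩, ?_⟩, ?_, ?_⟩
  · rw [inv_eq_one]
    ext
    exact (huniq 1 1 1 (by simp) (by simp)).symm
  · intro a b
    change (Units.mk0 (c (a*b)) _)⁻¹ = (Units.mk0 (c a) _)⁻¹ * (Units.mk0 (c b) _)⁻¹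
    rw [← mul_inv]
    congr 1
    ext
    refine (huniq (a * b) (⟨π a, (hψ _).1 a.2⟩ * ⟨π b, (hψ _).1 b.2⟩) (c a * c b) (by simp) ?_).symm
    rw [map_mul lam, Subgroup.coe_mul, map_mul, hc a, hc b, smul_mul_smul_comm]
  · intro γ k
    change (Units.mk0 (c _) _)⁻¹ = (Units.mk0 (c _) _)⁻¹
    congr 1
    ext
    refine (huniq (MulAut.conjNormal γ k) (MulAut.conjNormal (π γ) ⟨π k, (hψ _).1 k.2⟩)
      (c k) (by simp) ?_).symm
    rw [MulAut.conjNormal_apply, map_mul, map_mul, hc k, mul_smul_comm, hA1, smul_mul_assoc,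
      mul_assoc, ← map_mul]
    simp
  · intro k n d hn hd hA
    have := huniq k n d hn hA
    subst this
    simp

end s2

theorem nonabelian {Γ Q : Type} [Group Γ] [Finite Γ] [Group Q] (ψ : Γ →* Q) (η : ψ.ker →* ℂˣ)
    (hη : ∀ γ k, η (MulAut.conjNormal γ k) = η k) (a b : Γ) (hab : ψ (a * b) ≠ ψ (b * a)) :
    ∃ (D : Type) (_ : AddCommGroup D) (_ : Module ℂ D) (_ : FiniteDimensional ℂ D)
      (δ : Representation ℂ Γ D), δ.IsIrreducible ∧ 1 < Module.finrank ℂ D ∧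
      ∀ k : ψ.ker, δ k = (η k : ℂ) • 1 := by
  have := Fintype.ofFinite Γ
  let f : Γ → ℂ := fun g => if h : g ∈ ψ.ker then ((η (⟨g, h⟩⁻¹) : ℂˣ) : ℂ) else 0
  let f' : Γ → ℂ := fun g => f (g * (a * b)⁻¹ * (b * a))
  have hne : el (fun g => f g - f' g) ≠ 0 := by
    intro h0
    have h1 := el_inj h0 1
    have h2 : f 1 = 1 := by
      simp only [f, dif_pos ψ.ker.one_mem]
      have : (⟨1, ψ.ker.one_mem⟩ : ψ.ker) = 1 := rfl
      rw [this]; simp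
    have h3 : f' 1 = 0 := by
      simp only [f', f]
      rw [dif_neg]
      intro h
      apply hab
      rw [MonoidHom.mem_ker, one_mul, map_mul, map_inv, inv_mul_eq_one] at h
      exact h
    simp only [h2, h3] at h1
    norm_num at h1
  obtain ⟨D, _, _, _, δ, hδ, hd⟩ := exists_irr_of_ne _ hne
  refine ⟨D, _, _, ‹_›, δ, hδ, ?_⟩
  have hnt := ((irr_iff δ).1 hδ).1
  rw [asAlg_el] at hd
  have hs : ∑ g, (f g - f' g) • δ g = (∑ g, f g • δ g) * (1 - δ ((b * a)⁻¹ * (a * b))) := by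
    simp only [sub_smul, Finset.sum_sub_distrib, mul_sub, mul_one]
    congr 1
    rw [Finset.sum_mul, ← Equiv.sum_comp (Equiv.mulRight ((a * b)⁻¹ * (b * a)))
      (fun g => f g • δ g * δ ((b * a)⁻¹ * (a * b)))]
    refine Finset.sum_congr rfl fun g _ => ?_
    simp only [Equiv.coe_mulRight, smul_mul_assoc, ← map_mul, f']
    congr 2 <;> group
  rw [hs] at hd
  have hfc : ∀ x g, f (x * g * x⁻¹) = f g := by
    intro x g
    simp only [f]
    by_cases h : g ∈ ψ.ker
    · have h' : x * g * x⁻¹ ∈ ψ.ker := (inferInstance : ψ.ker.Normal).conj_mem g h x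
      rw [dif_pos h, dif_pos h', map_inv, map_inv, ← hη x ⟨g, h⟩]
      rfl
    · have h' : x * g * x⁻¹ ∉ ψ.ker := fun hh => h (by
        have := (inferInstance : ψ.ker.Normal).conj_mem _ hh x⁻¹
        simpa [mul_assoc] using this)
      rw [dif_neg h, dif_neg h']
  obtain ⟨c, hc⟩ := schur δ hδ (∑ g, f g • δ g) (fun x => class_comm δ f x (hfc x))
  have hc0 : c ≠ 0 := by
    rintro rfl
    rw [hc] at hd; simp at hd
  have hk : ∀ k : ψ.ker, δ k = (η k : ℂ) • 1 := by
    intro k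
    have h1 : δ k * (∑ g, f g • δ g) = (η k : ℂ) • (∑ g, f g • δ g) := by
      rw [Finset.mul_sum, Finset.smul_sum, ← Equiv.sum_comp (Equiv.mulLeft (k : Γ))
        (fun g => (η k : ℂ) • f g • δ g)]
      refine Finset.sum_congr rfl fun g _ => ?_
      simp only [Equiv.coe_mulLeft, mul_smul_comm, ← map_mul, smul_smul]
      congr 1
      simp only [f]
      by_cases h : g ∈ ψ.ker
      · have h' : k * g ∈ ψ.ker := mul_mem k.2 h
        rw [dif_pos h, dif_pos h', ← Units.val_mul, ← map_mul]
        have e : (⟨k * g, h'⟩ : ψ.ker) = k * ⟨g, h⟩ := rfl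
        rw [e, map_mul, map_inv, map_inv, map_mul, mul_inv, mul_inv_cancel_left]
      · have h' : ↑k * g ∉ ψ.ker := fun hh => h (by
          have := mul_mem (inv_mem k.2) hh
          simpa using this)
        rw [dif_neg h, dif_neg h', mul_zero]
    rw [hc, mul_smul_comm, mul_one, smul_comm] at h1
    exact smul_right_injective _ hc0 h1
  refine ⟨?_, hk⟩
  by_contra hlt
  have h1 : Module.finrank ℂ D = 1 := le_antisymm (not_lt.1 hlt) (irr_fin_pos hδ)
  apply hd
  have hall : ∀ T : Module.End ℂ D, ∃ c : ℂ, T = c • 1 := by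
    intro T
    obtain ⟨v, hv, hv'⟩ := finrank_eq_one_iff'.1 h1
    obtain ⟨c, hc⟩ := hv' (T v)
    refine ⟨c, ?_⟩
    ext w
    obtain ⟨e, rfl⟩ := hv' w
    simp only [map_smul, ← hc, LinearMap.smul_apply, Module.End.one_apply]
  have hcomm : δ (b * a) = δ (a * b) := by
    obtain ⟨x, hx⟩ := hall (δ a)
    rw [map_mul, map_mul, hx]; simp
  rw [map_mul δ (b * a)⁻¹, ← hcomm, ← map_mul]
  simp

section schur
variable {P S : Type} [Group P] [Finite P] [Group S]

theorem ext_pow (ψ : P →* S) (hψ : Function.Surjective ψ) (hc : ψ.ker ≤ Subgroup.center P)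
    (η : ψ.ker →* ℂˣ) (C : Subgroup S)
    (hC : ∀ a b : P, ψ a ∈ C → ψ b ∈ C → a * b = b * a) :
    ∃ μ : P →* ℂˣ, ∀ z : ψ.ker, μ z = η z ^ C.index := by
  let L : Subgroup P := C.comap ψ
  let _ : CommGroup L := { (inferInstance : Group L) with
    mul_comm := fun a b => Subtype.ext (hC a b a.2 b.2) }
  have hKL : ψ.ker ≤ L := fun z hz => by
    change ψ z ∈ C
    rw [hz]; exact C.one_mem
  let K' : Subgroup L := ψ.ker.subgroupOf L
  obtain ⟨χ, hχ⟩ := MonoidHom.domRestrict_surjective ℂ K'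
    (η.comp (Subgroup.subgroupOfEquivOfLe hKL).toMonoidHom)
  refine ⟨MonoidHom.transfer χ, fun z => ?_⟩
  have hz : ∀ g, (z : P) * g = g * z := fun g => ((Subgroup.mem_center_iff.1 (hc z.2)) g).symm
  rw [MonoidHom.transfer_eq_pow χ (z : P) (by
    intro k g₀ _
    have : (z : P) ^ k * g₀ = g₀ * (z : P) ^ k := (show Commute (z : P) g₀ from hz g₀).pow_left k
    rw [mul_assoc, this]; simp)]
  have hi : L.index = C.index := Subgroup.index_comap_of_surjective C hψ
  have h2 := DFunLike.congr_fun hχ (⟨⟨z, hKL z.2⟩, z.2⟩ : K')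
  have h3 : χ ⟨z, hKL z.2⟩ = η z := h2
  rw [← h3, ← map_pow, ← hi]
  congr 1

theorem ext_gcd (ψ : P →* S) (η : ψ.ker →* ℂˣ) {m n : ℕ}
    (hm : ∃ μ : P →* ℂˣ, ∀ z : ψ.ker, μ z = η z ^ m)
    (hn : ∃ μ : P →* ℂˣ, ∀ z : ψ.ker, μ z = η z ^ n) :
    ∃ μ : P →* ℂˣ, ∀ z : ψ.ker, μ z = η z ^ (Nat.gcd m n) := by
  obtain ⟨μ, hμ⟩ := hm
  obtain ⟨ν, hν⟩ := hn
  refine ⟨(zpowGroupHom (Nat.gcdA m n)).comp μ * (zpowGroupHom (Nat.gcdB m n)).comp ν, fun z => ?_⟩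
  rw [MonoidHom.mul_apply]
  simp only [MonoidHom.comp_apply, zpowGroupHom_apply]
  rw [hμ, hν, ← zpow_natCast, ← zpow_natCast, ← zpow_mul, ← zpow_mul, ← zpow_add,
    ← Nat.gcd_eq_gcd_ab, zpow_natCast]

/-- reduction of the extension problem to the central case -/
theorem ext_red {Γ : Type} [Group Γ] [Finite Γ] (ψ : Γ →* S) (hψ : Function.Surjective ψ)
    (η : ψ.ker →* ℂˣ) (hη : ∀ γ k, η (MulAut.conjNormal γ k) = η k)
    (hS : ∀ (P : Type) [Group P] [Finite P] (ψ : P →* S), Function.Surjective ψ →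
      ψ.ker ≤ Subgroup.center P → ∀ η : ψ.ker →* ℂˣ, ∃ μ : P →* ℂˣ, ∀ z : ψ.ker, μ z = η z) :
    ∃ μ : Γ →* ℂˣ, ∀ k : ψ.ker, μ k = η k := by
  let K0 : Subgroup Γ := η.ker.map ψ.ker.subtype
  have hK0 : ∀ k : ψ.ker, (k : Γ) ∈ K0 ↔ η k = 1 := by
    intro k
    constructor
    · rintro ⟨k', hk', h⟩
      rw [← Subtype.ext h]; exact hk'
    · intro h
      exact ⟨k, h, rfl⟩
  have hle : K0 ≤ ψ.ker := by
    rintro _ ⟨k, -, rfl⟩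
    exact k.2
  have hn : K0.Normal := ⟨by
    rintro _ ⟨k, hk, rfl⟩ g
    exact (hK0 (MulAut.conjNormal g k)).2 (by rw [hη]; exact hk)⟩
  let ψ' : Γ ⧸ K0 →* S := QuotientGroup.lift K0 ψ (fun k hk => hle hk)
  have hψ' : ∀ γ : Γ, ψ' (QuotientGroup.mk γ) = ψ γ := fun _ => rfl
  have hs' : Function.Surjective ψ' := fun s => by
    obtain ⟨γ, rfl⟩ := hψ s
    exact ⟨QuotientGroup.mk γ, rfl⟩
  have hcen : ψ'.ker ≤ Subgroup.center (Γ ⧸ K0) := by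
    intro z hz
    obtain ⟨k, rfl⟩ := QuotientGroup.mk_surjective z
    rw [Subgroup.mem_center_iff]
    intro g
    obtain ⟨γ, rfl⟩ := QuotientGroup.mk_surjective g
    rw [← QuotientGroup.mk_mul, ← QuotientGroup.mk_mul, eq_comm, QuotientGroup.eq]
    have hk : k ∈ ψ.ker := hz
    let kk : ψ.ker := ⟨k, hk⟩
    have h1 : η (MulAut.conjNormal (γ⁻¹) kk⁻¹ * kk) = 1 := by
      rw [map_mul, hη]; simp
    have h2 := (hK0 _).2 h1
    have h3 : ((MulAut.conjNormal (γ⁻¹) kk⁻¹ * kk : ψ.ker) : Γ) = γ⁻¹ * k⁻¹ * γ * k := by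
      simp [kk, mul_assoc]
    rw [h3] at h2
    have h4 := hn.conj_mem _ h2 k⁻¹
    have h5 := hn.conj_mem _ h2 1
    simp only [one_mul, inv_one, mul_one] at h5
    have : (k * γ)⁻¹ * (γ * k) = γ⁻¹ * k⁻¹ * γ * k := by group
    rw [this]; exact h5
  have hker : ∀ γ, γ ∈ ψ.ker → (QuotientGroup.mk γ : Γ ⧸ K0) ∈ ψ'.ker := fun γ h => h
  let j : ψ.ker →* ψ'.ker := ((QuotientGroup.mk' K0).comp ψ.ker.subtype).codRestrict ψ'.ker
    (fun k => hker k k.2)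
  have hj : Function.Surjective j := by
    rintro ⟨z, hz⟩
    obtain ⟨k, rfl⟩ := QuotientGroup.mk_surjective z
    exact ⟨⟨k, hz⟩, rfl⟩
  let η' : ψ'.ker →* ℂˣ := (QuotientGroup.lift j.ker η (by
    intro k hk
    have h1 : (QuotientGroup.mk (k : Γ) : Γ ⧸ K0) = 1 := congrArg Subtype.val (show j k = 1 from hk)
    rw [QuotientGroup.eq_one_iff] at h1
    exact (hK0 k).1 h1)).comp (QuotientGroup.quotientKerEquivOfSurjective j hj).symm.toMonoidHom
  have hη' : ∀ k, η' (j k) = η k := by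
    intro k
    have : (QuotientGroup.quotientKerEquivOfSurjective j hj).symm (j k) =
      QuotientGroup.mk k := by
      rw [MulEquiv.symm_apply_eq]; rfl
    simp only [η', MonoidHom.comp_apply, MulEquiv.coe_toMonoidHom, this]
    rfl
  obtain ⟨μ, hμ⟩ := hS (Γ ⧸ K0) ψ' hs' hcen η'
  exact ⟨μ.comp (QuotientGroup.mk' K0), fun k => by rw [← hη', ← hμ]; rfl⟩

end schur
end CD
end

noncomputable section
namespace CD
open scoped Classical
open Representation

abbrev SL (F : Type) [Field F] := Matrix.SpecialLinearGroup (Fin 2) F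

section sl
variable {F : Type} [Field F] [Fintype F] [CharP F 2]

theorem two0 : (2 : F) = 0 := CharTwo.two_eq_zero

theorem sl_det (g : SL F) : g 0 0 * g 1 1 + g 0 1 * g 1 0 = 1 := by
  have := g.2
  rw [Matrix.det_fin_two, CharTwo.sub_eq_add] at this
  exact this

theorem sl_ext {g h : SL F} (h1 : g 0 0 = h 0 0) (h2 : g 0 1 = h 0 1) (h3 : g 1 0 = h 1 0)
    (h4 : g 1 1 = h 1 1) : g = h := by
  ext i j
  fin_cases i <;> fin_cases j <;> assumption

theorem sl_mul (g h : SL F) (i j : Fin 2) : (g * h) i j = g i 0 * h 0 j + g i 1 * h 1 j := by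
  rw [Matrix.SpecialLinearGroup.coe_mul, Matrix.mul_apply, Fin.sum_univ_two]

theorem inv00 (g : SL F) : g⁻¹ 0 0 = g 1 1 := by
  rw [Matrix.SpecialLinearGroup.SL2_inv_expl]; rfl
theorem inv11 (g : SL F) : g⁻¹ 1 1 = g 0 0 := by
  rw [Matrix.SpecialLinearGroup.SL2_inv_expl]; rfl
theorem inv01 (g : SL F) : g⁻¹ 0 1 = g 0 1 := by
  rw [Matrix.SpecialLinearGroup.SL2_inv_expl]
  change - (g 0 1) = _
  rw [CharTwo.neg_eq]
theorem inv10 (g : SL F) : g⁻¹ 1 0 = g 1 0 := by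
  rw [Matrix.SpecialLinearGroup.SL2_inv_expl]
  change - (g 1 0) = _
  rw [CharTwo.neg_eq]

def mk4 (a b c d : F) (h : a * d + b * c = 1) : SL F :=
  ⟨!![a, b; c, d], by rw [Matrix.det_fin_two_of, CharTwo.sub_eq_add, h]⟩

section
variable (a b c d : F) (h : a * d + b * c = 1)
theorem mk00 : mk4 a b c d h 0 0 = a := rfl
theorem mk01 : mk4 a b c d h 0 1 = b := rfl
theorem mk10 : mk4 a b c d h 1 0 = c := rfl
theorem mk11 : mk4 a b c d h 1 1 = d := rfl
end
theorem one00 : (1 : SL F) 0 0 = 1 := rfl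
theorem one01 : (1 : SL F) 0 1 = 0 := rfl
theorem one10 : (1 : SL F) 1 0 = 0 := rfl
theorem one11 : (1 : SL F) 1 1 = 1 := rfl

def uu (b : F) : SL F := mk4 1 b 0 1 (by simp)
def ww : SL F := mk4 0 1 1 0 (by simp)
def tt (a : Fˣ) : SL F := mk4 a 0 0 (a⁻¹ : Fˣ) (by simp)

theorem uu_add (a b : F) : uu (a + b) = uu a * uu b := by
  apply sl_ext <;> simp [uu, sl_mul, mk00, mk01, mk10, mk11, add_comm]
theorem tt_mul (a b : Fˣ) : tt (a * b) = tt a * tt b := by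
  apply sl_ext <;> simp [tt, sl_mul, mk00, mk01, mk10, mk11, mul_comm]
theorem uu_zero : uu (0 : F) = 1 := by
  apply sl_ext <;> simp [uu, mk00, mk01, mk10, mk11]
theorem tt_one : tt (1 : Fˣ) = 1 := by
  apply sl_ext <;> simp [tt, mk00, mk01, mk10, mk11]

def uH : Multiplicative F →* SL F where
  toFun b := uu b.toAdd
  map_one' := uu_zero
  map_mul' a b := uu_add _ _
def tH : Fˣ →* SL F where
  toFun := tt
  map_one' := tt_one
  map_mul' := tt_mul

theorem uH_inj : Function.Injective (uH : Multiplicative F →* SL F) := fun a b h =>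
  congrArg (fun g : SL F => g 0 1) h
theorem tH_inj : Function.Injective (tH : Fˣ →* SL F) := fun a b h =>
  Units.ext (congrArg (fun g : SL F => g 0 0) h)

variable (F) in
def UU : Subgroup (SL F) := uH.range
variable (F) in
def TT : Subgroup (SL F) := tH.range
variable (F) in
def BB : Subgroup (SL F) where
  carrier := {g | g 1 0 = 0}
  one_mem' := rfl
  mul_mem' := by
    intro a b (ha : a 1 0 = 0) (hb : b 1 0 = 0)
    change (a * b) 1 0 = 0
    rw [sl_mul, ha, hb]; simp
  inv_mem' := by
    intro a (ha : a 1 0 = 0)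
    change a⁻¹ 1 0 = 0
    rw [inv10, ha]

theorem mem_BB {g : SL F} : g ∈ BB F ↔ g 1 0 = 0 := Iff.rfl

theorem mem_UU {g : SL F} : g ∈ UU F ↔ g 1 0 = 0 ∧ g 0 0 = 1 := by
  constructor
  · rintro ⟨b, rfl⟩
    exact ⟨rfl, rfl⟩
  · rintro ⟨h1, h2⟩
    refine ⟨Multiplicative.ofAdd (g 0 1), ?_⟩
    have := sl_det g
    rw [h1, h2] at this
    apply sl_ext
    · exact h2.symm
    · rfl
    · exact h1.symm
    · simp at this; exact this.symm

theorem uu_mem (b : F) : uu b ∈ UU F := ⟨Multiplicative.ofAdd b, rfl⟩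
theorem tt_mem (a : Fˣ) : tt a ∈ TT F := ⟨a, rfl⟩

theorem mem_TT {g : SL F} : g ∈ TT F ↔ g 1 0 = 0 ∧ g 0 1 = 0 := by
  constructor
  · rintro ⟨b, rfl⟩
    exact ⟨rfl, rfl⟩
  · rintro ⟨h1, h2⟩
    have := sl_det g
    rw [h1, h2, mul_zero, add_zero] at this
    refine ⟨⟨g 0 0, g 1 1, this, by rw [mul_comm, this]⟩, ?_⟩
    apply sl_ext
    · rfl
    · exact h2.symm
    · exact h1.symm
    · rfl

theorem card_UU : Nat.card (UU F) = Fintype.card F := by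
  rw [UU, ← Nat.card_congr (MonoidHom.ofInjective uH_inj).toEquiv, Nat.card_congr Multiplicative.toAdd,
    Nat.card_eq_fintype_card]

theorem card_TT : Nat.card (TT F) = Fintype.card F - 1 := by
  rw [TT, ← Nat.card_congr (MonoidHom.ofInjective tH_inj).toEquiv, Nat.card_eq_fintype_card,
    Fintype.card_units]

theorem UU_le_BB : UU F ≤ BB F := fun g hg => (mem_UU.1 hg).1

/-- the diagonal entry -/
def dg : BB F →* Fˣ where
  toFun g := ⟨(g : SL F) 0 0, (g : SL F) 1 1,
    by have := sl_det (g : SL F); rw [mem_BB.1 g.2] at this; simpa using this,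
    by have := sl_det (g : SL F); rw [mem_BB.1 g.2, mul_comm] at this; simpa using this⟩
  map_one' := Units.ext rfl
  map_mul' a b := Units.ext (by
    change ((a : SL F) * (b : SL F)) 0 0 = _
    rw [sl_mul]
    have := mem_BB.1 b.2
    change _ = (a : SL F) 0 0 * (b : SL F) 0 0
    rw [this, mul_zero, add_zero])

theorem dg_apply (g : BB F) : (dg g : F) = (g : SL F) 0 0 := rfl

theorem dg_ker (g : BB F) : dg g = 1 ↔ (g : SL F) ∈ UU F := by
  rw [mem_UU, Units.ext_iff, dg_apply]
  exact ⟨fun h => ⟨g.2, h⟩, fun h => h.2⟩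

theorem dg_surj : Function.Surjective (dg : BB F →* Fˣ) := fun a =>
  ⟨⟨tt a, rfl⟩, Units.ext rfl⟩

theorem card_BB : Nat.card (BB F) = Fintype.card F * (Fintype.card F - 1) := by
  have h := Subgroup.card_mul_index (dg : BB F →* Fˣ).ker
  have h1 : Nat.card (dg : BB F →* Fˣ).ker = Fintype.card F := by
    rw [← card_UU]
    have : (dg : BB F →* Fˣ).ker = (UU F).subgroupOf (BB F) := by
      ext g
      rw [MonoidHom.mem_ker, dg_ker]; rfl
    rw [this]
    exact Nat.card_congr (Subgroup.subgroupOfEquivOfLe UU_le_BB).toEquiv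
  rw [h1, Subgroup.index_ker, MonoidHom.range_eq_top.2 dg_surj] at h
  rw [← h, Subgroup.card_top, Nat.card_eq_fintype_card, Fintype.card_units]

theorem card_SL : Nat.card (SL F) =
    Fintype.card F * (Fintype.card F - 1) * (Fintype.card F + 1) := by
  have h1 : Nat.card {g : SL F // ¬ g 1 0 = 0} = (Fintype.card F - 1) * Fintype.card F *
      Fintype.card F := by
    have e : {g : SL F // ¬ g 1 0 = 0} ≃ (Fˣ × F) × F :=
      { toFun := fun g => ((Units.mk0 _ g.2, (g : SL F) 0 0), (g : SL F) 1 1)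
        invFun := fun x => ⟨mk4 x.1.2 ((x.1.2 * x.2 + 1) / x.1.1) x.1.1 x.2 (by
          rw [div_mul_cancel₀ _ x.1.1.ne_zero, ← add_assoc, CharTwo.add_self_eq_zero, zero_add]),
          x.1.1.ne_zero⟩
        left_inv := by
          rintro ⟨g, hg⟩
          apply Subtype.ext
          apply sl_ext
          · rfl
          · change (g 0 0 * g 1 1 + 1) / g 1 0 = g 0 1
            rw [div_eq_iff hg]
            have := sl_det g
            linear_combination this - (g 0 1 * g 1 0 - 1) * two0 (F := F)
          · rfl
          · rfl
        right_inv := by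
          rintro ⟨⟨c, a⟩, d⟩
          refine Prod.ext (Prod.ext (Units.ext rfl) rfl) rfl }
    rw [Nat.card_congr e, Nat.card_prod, Nat.card_prod]
    simp only [Nat.card_eq_fintype_card, Fintype.card_units]
  have h2 : Nat.card {g : SL F // g 1 0 = 0} = _ := card_BB (F := F)
  rw [← Nat.card_congr (Equiv.sumCompl (fun g : SL F => g 1 0 = 0)), Nat.card_sum, h1, h2]
  ring

theorem card_F_pow : ∃ f, Fintype.card F = 2 ^ f ∧ 0 < f := by
  obtain ⟨n, -, h⟩ := FiniteField.card F 2
  exact ⟨n, h, n.pos⟩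

theorem fact_q : (Nat.card (SL F)).factorization 2 = (Fintype.card F).factorization 2 := by
  obtain ⟨f, hf, hf0⟩ := card_F_pow (F := F)
  have hq : 2 ≤ Fintype.card F := by rw [hf]; exact le_self_pow₀ (by norm_num) hf0.ne'
  have hev : 2 ∣ Fintype.card F := by rw [hf]; exact dvd_pow_self 2 hf0.ne'
  rw [card_SL, Nat.factorization_mul, Nat.factorization_mul]
  · rw [Finsupp.add_apply, Finsupp.add_apply,
      Nat.factorization_eq_zero_of_not_dvd (n := Fintype.card F - 1) (by omega),
      Nat.factorization_eq_zero_of_not_dvd (n := Fintype.card F + 1) (by omega)]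
    rfl
  all_goals first | omega | (apply mul_ne_zero <;> omega)

variable (F) in
abbrev Om := Sylow 2 (SL F)

variable (F) in
def pinf : Om F := Sylow.ofCard (UU F) (by
  rw [fact_q, card_UU]
  obtain ⟨f, hf, hf0⟩ := card_F_pow (F := F)
  rw [hf, Nat.Prime.factorization_pow Nat.prime_two]; simp)

theorem coe_pinf : ((pinf F : Om F) : Subgroup (SL F)) = UU F := Sylow.coe_ofCard _ _

theorem smul_pinf {g : SL F} : g • pinf F = pinf F ↔ g 1 0 = 0 := by
  have e : ((pinf F : Om F) : Set (SL F)) = (UU F : Set (SL F)) := congrArg SetLike.coe coe_pinf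
  rw [Sylow.smul_eq_iff_mem_normalizer, e]
  constructor
  · intro h
    rw [Subgroup.mem_normalizer_iff] at h
    have := (h (uu 1)).1 (uu_mem 1)
    rw [mem_UU] at this
    have h2 := this.1
    simp [sl_mul, inv00, inv10, uu, mk00, mk01, mk10, mk11] at h2
    have h3 := two0 (F := F)
    have : g 1 0 * g 1 0 = 0 := by linear_combination h2 - g 1 0 * g 1 1 * h3
    simpa using this
  · intro h
    have key : ∀ g : SL F, g 1 0 = 0 → ∀ x ∈ UU F, g * x * g⁻¹ ∈ UU F := by
      intro g hg x hx
      rw [mem_UU] at hx ⊢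
      have hd := sl_det g
      rw [hg] at hd
      simp [sl_mul, inv00, inv10, hg, hx.1, hx.2] at hd ⊢
      exact hd
    rw [Subgroup.mem_normalizer_iff]
    intro x
    refine ⟨key g h x, fun hx => ?_⟩
    have := key g⁻¹ (by rw [inv10, h]) _ hx
    simpa [mul_assoc] using this

theorem om_trans (x : Om F) : ∃ g : SL F, g • pinf F = x := MulAction.exists_smul_eq _ _ _

theorem smul_eq_smul_inf {g h : SL F} : g • pinf F = h • pinf F ↔ (h⁻¹ * g) 1 0 = 0 := by
  rw [← smul_pinf (F := F), mul_smul, inv_smul_eq_iff]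

variable (F) in
def p0 : Om F := (ww : SL F) • pinf F

theorem smul_p0 {g : SL F} : g • p0 F = p0 F ↔ g 0 1 = 0 := by
  rw [p0, ← mul_smul, smul_eq_smul_inf]
  simp [sl_mul, inv10, inv11, ww, mk00, mk01, mk10, mk11]

theorem p0_ne : p0 F ≠ pinf F := by
  rw [p0, Ne, smul_pinf]; simp [ww, mk10]

theorem bruhat {x : Om F} (hx : x ≠ pinf F) : ∃ b : F, uu b • p0 F = x := by
  obtain ⟨g, rfl⟩ := om_trans x
  rw [Ne, smul_pinf] at hx
  refine ⟨g 0 0 / g 1 0, ?_⟩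
  rw [p0, ← mul_smul, smul_eq_smul_inf]
  simp [sl_mul, inv10, inv11, ww, uu, mk00, mk01, mk10, mk11]
  field_simp
  linear_combination g 0 0 * two0 (F := F)

theorem uu_smul_inf (b : F) : uu b • pinf F = pinf F := smul_pinf.2 rfl
theorem tt_smul_inf (a : Fˣ) : tt a • pinf F = pinf F := smul_pinf.2 rfl
theorem tt_smul_p0 (a : Fˣ) : tt a • p0 F = p0 F := smul_p0.2 rfl

theorem tt_uu (a : Fˣ) (b : F) : tt a * uu b = uu (a ^ 2 * b) * tt a := by
  apply sl_ext <;> simp [tt, uu, sl_mul, mk00, mk01, mk10, mk11]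
  field_simp

/-- 2-transitivity -/
theorem two_trans {x y : Om F} (h : x ≠ y) : ∃ g : SL F, g • pinf F = x ∧ g • p0 F = y := by
  obtain ⟨g, rfl⟩ := om_trans x
  have h' : g⁻¹ • y ≠ pinf F := fun e => h (by rw [← e, smul_inv_smul])
  obtain ⟨b, hb⟩ := bruhat h'
  refine ⟨g * uu b, ?_, ?_⟩
  · rw [mul_smul, uu_smul_inf]
  · rw [mul_smul, hb, smul_inv_smul]

theorem exists_sqrt (b : F) : ∃ a : F, a ^ 2 = b := by
  have : Function.Bijective (fun a : F => a ^ 2) := by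
    have h1 : Function.Injective (fun a : F => a ^ 2) := fun a b h => CharTwo.sq_injective h
    exact Finite.injective_iff_bijective.1 h1
  exact this.2 b

theorem tt_trans {b : F} (hb : b ≠ 0) : ∃ a : Fˣ, tt a • uu (1 : F) • p0 F = uu b • p0 F := by
  obtain ⟨a, ha⟩ := exists_sqrt b
  have ha0 : a ≠ 0 := by rintro rfl; simp at ha; exact hb ha.symm
  refine ⟨Units.mk0 a ha0, ?_⟩
  rw [← mul_smul, tt_uu, mul_smul, tt_smul_p0]
  simp [ha]

/-- 3-transitivity -/
theorem three_trans {x y z : Om F} (h : x ≠ y) (h1 : x ≠ z) (h2 : y ≠ z) :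
    ∃ g : SL F, g • pinf F = x ∧ g • p0 F = y ∧ g • uu (1 : F) • p0 F = z := by
  obtain ⟨g, rfl, rfl⟩ := two_trans h
  have h' : g⁻¹ • z ≠ pinf F := fun e => h1 (by rw [← e, smul_inv_smul])
  obtain ⟨b, hb⟩ := bruhat h'
  have hb0 : b ≠ 0 := by
    rintro rfl
    rw [uu_zero, one_smul] at hb
    exact h2 (by rw [hb, smul_inv_smul])
  obtain ⟨a, ha⟩ := tt_trans hb0
  refine ⟨g * tt a, ?_, ?_, ?_⟩
  · rw [mul_smul, tt_smul_inf]
  · rw [mul_smul, tt_smul_p0]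
  · rw [mul_smul, ha, hb, smul_inv_smul]

theorem three_fix0 {g : SL F} (h : g • pinf F = pinf F) (h1 : g • p0 F = p0 F)
    (h2 : g • uu (1 : F) • p0 F = uu (1 : F) • p0 F) : g = 1 := by
  have ha := smul_pinf.1 h
  have hb := smul_p0.1 h1
  have h3 : ((uu 1)⁻¹ * g * uu 1) • p0 F = p0 F := by
    rw [mul_smul, mul_smul, h2, inv_smul_smul]
  rw [smul_p0] at h3
  have hd := sl_det g
  simp [sl_mul, inv00, inv01, uu, mk00, mk01, mk10, mk11, ha, hb] at h3 hd
  have h4 : g 0 0 = g 1 1 := by rw [← sub_eq_zero, CharTwo.sub_eq_add, h3]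
  rw [← h4, ← sq] at hd
  have h5 : g 0 0 = 1 := CharTwo.sq_injective (by simpa using hd)
  apply sl_ext
  · exact h5
  · exact hb
  · exact ha
  · rw [← h4]; exact h5

theorem three_fix {g : SL F} {x y z : Om F} (h : x ≠ y) (h1 : x ≠ z) (h2 : y ≠ z)
    (hx : g • x = x) (hy : g • y = y) (hz : g • z = z) : g = 1 := by
  obtain ⟨k, rfl, rfl, rfl⟩ := three_trans h h1 h2
  have : ∀ p : Om F, g • k • p = k • p → (k⁻¹ * g * k) • p = p := fun p hp => by
    rw [mul_smul, mul_smul, hp, inv_smul_smul]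
  have h3 := three_fix0 (this _ hx) (this _ hy) (this _ hz)
  have : g = k * (k⁻¹ * g * k) * k⁻¹ := by group
  rw [this, h3]; simp

theorem card_Om : Nat.card (Om F) = Fintype.card F + 1 := by
  have h1 := MulAction.index_stabilizer_of_transitive (SL F) (pinf F)
  have h2 : MulAction.stabilizer (SL F) (pinf F) = BB F := by
    ext g
    rw [MulAction.mem_stabilizer_iff, smul_pinf, mem_BB]
  rw [h2] at h1
  have h3 := Subgroup.card_mul_index (BB F)
  have h4 : 1 < Fintype.card F := Fintype.one_lt_card
  rw [h1, card_BB, card_SL] at h3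
  exact Nat.eq_of_mul_eq_mul_left (by apply Nat.mul_pos <;> omega) h3

end sl
end CD
end

noncomputable section
namespace CD
open scoped Classical
open Representation

section sl2
variable {F : Type} [Field F] [Fintype F] [CharP F 2]

theorem comm_form {g h : SL F} (hg : g ≠ 1) (hc : h * g = g * h) :
    ∃ x y : F, h 0 0 = x + y * g 0 0 ∧ h 0 1 = y * g 0 1 ∧ h 1 0 = y * g 1 0 ∧
      h 1 1 = x + y * g 1 1 := by
  have e00 : (h * g) 0 0 = (g * h) 0 0 := by rw [hc]
  have e01 : (h * g) 0 1 = (g * h) 0 1 := by rw [hc]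
  have e10 : (h * g) 1 0 = (g * h) 1 0 := by rw [hc]
  rw [sl_mul, sl_mul] at e00 e01 e10
  by_cases h1 : g 0 1 = 0
  · by_cases h2 : g 1 0 = 0
    · have h3 : g 0 0 - g 1 1 ≠ 0 := by
        intro h3
        apply hg
        have hd := sl_det g
        rw [h1, zero_mul, add_zero, ← sub_eq_zero.1 h3, ← sq] at hd
        have h5 : g 0 0 = 1 := CharTwo.sq_injective (by simpa using hd)
        exact sl_ext h5 h1 h2 (by rw [← sub_eq_zero.1 h3]; exact h5)
      refine ⟨h 0 0 - (h 0 0 - h 1 1) / (g 0 0 - g 1 1) * g 0 0,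
        (h 0 0 - h 1 1) / (g 0 0 - g 1 1), by ring, ?_, ?_, ?_⟩
      · rw [h1] at e01 ⊢
        have : h 0 1 * (g 0 0 - g 1 1) = 0 := by linear_combination -e01
        simpa [h3] using this
      · rw [h2] at e10 ⊢
        have : h 1 0 * (g 0 0 - g 1 1) = 0 := by linear_combination e10
        simpa [h3] using this
      · field_simp; ring
    · refine ⟨h 0 0 - h 1 0 / g 1 0 * g 0 0, h 1 0 / g 1 0, by ring, ?_, ?_, ?_⟩
      · field_simp; linear_combination e00
      · field_simp
      · field_simp; linear_combination e10
  · refine ⟨h 0 0 - h 0 1 / g 0 1 * g 0 0, h 0 1 / g 0 1, by ring, ?_, ?_, ?_⟩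
    · field_simp
    · field_simp; linear_combination -e00
    · field_simp; linear_combination -e01

theorem cent_comm {g h k : SL F} (hg : g ≠ 1) (hc : h * g = g * h) (kc : k * g = g * k) :
    h * k = k * h := by
  obtain ⟨x, y, h1, h2, h3, h4⟩ := comm_form hg hc
  obtain ⟨x', y', k1, k2, k3, k4⟩ := comm_form hg kc
  apply sl_ext <;> simp only [sl_mul, h1, h2, h3, h4, k1, k2, k3, k4] <;> ring

theorem fix_of_comm {g h : SL F} (hg : g ≠ 1) (hc : h * g = g * h) {x : Om F} (hx : g • x = x) :
    h • x = x := by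
  obtain ⟨k, rfl⟩ := om_trans x
  have key : ∀ s : SL F, s • k • pinf F = k • pinf F ↔ (k⁻¹ * s * k) 1 0 = 0 := fun s => by
    rw [← mul_smul, smul_eq_smul_inf, mul_assoc]
  rw [key] at hx ⊢
  have hg' : k⁻¹ * g * k ≠ 1 := fun h => hg (by
    have : g = k * (k⁻¹ * g * k) * k⁻¹ := by group
    rw [this, h]; simp)
  obtain ⟨a, b, -, -, h3, -⟩ := comm_form (g := k⁻¹ * g * k) (h := k⁻¹ * h * k) hg' (by
    have : k⁻¹ * h * k * (k⁻¹ * g * k) = k⁻¹ * (h * g) * k := by group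
    rw [this, hc]; group)
  rw [h3, hx, mul_zero]

def tr (g : SL F) : F := g 0 0 + g 1 1

theorem tr_comm (g h : SL F) : tr (g * h) = tr (h * g) := by
  simp only [tr, sl_mul]; ring
theorem tr_conj (g h : SL F) : tr (h * g * h⁻¹) = tr g := by
  rw [tr_comm, ← mul_assoc, inv_mul_cancel, one_mul]
theorem tr_sq (g : SL F) : tr (g * g) = tr g ^ 2 := by
  simp only [tr, sl_mul]
  linear_combination (g 0 1 * g 1 0 - g 0 0 * g 1 1) * two0 (F := F)
theorem tr_inv (g : SL F) : tr g⁻¹ = tr g := by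
  simp only [tr, inv00, inv11]; ring
theorem tr_one : tr (1 : SL F) = 0 := by
  change (1 : F) + 1 = 0
  rw [CharTwo.add_self_eq_zero]

theorem sq_one_iff (g : SL F) : g * g = 1 ↔ tr g = 0 := by
  constructor
  · intro h
    have := tr_sq g
    rw [h, tr_one] at this
    exact (pow_eq_zero_iff two_ne_zero).1 this.symm
  · intro h
    have h1 : g = g⁻¹ := by
      have h2 : g 0 0 = g 1 1 := by
        rw [← sub_eq_zero, CharTwo.sub_eq_add]; exact h
      apply sl_ext
      · rw [inv00, h2]
      · rw [inv01]
      · rw [inv10]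
      · rw [inv11, h2]
    nth_rewrite 2 [h1]
    simp

theorem cube_one {g : SL F} (h : tr g = 1) : g * g * g = 1 := by
  have h0 : g 1 1 = 1 + g 0 0 := by
    simp only [tr] at h; linear_combination h - (g 0 0) * two0 (F := F)
  have hd := sl_det g
  have h2 := two0 (F := F)
  have : g * g = g⁻¹ := by
    rw [h0] at hd
    apply sl_ext
    · rw [sl_mul, inv00, h0]; linear_combination hd - g 0 0 * h2
    · rw [sl_mul, inv01, h0]; linear_combination (g 0 0 * g 0 1) * h2
    · rw [sl_mul, inv10, h0]; linear_combination (g 0 0 * g 1 0) * h2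
    · rw [sl_mul, inv11, h0]; linear_combination hd + h2
  rw [this, inv_mul_cancel]

/-- fusion -/
theorem fusion {e e' : SL F} (hc : e' * e = e * e') (ht : tr e' = tr e) (h0 : tr e ≠ 0) :
    e' = e ∨ e' = e⁻¹ := by
  have he : e ≠ 1 := by rintro rfl; exact h0 tr_one
  obtain ⟨x, y, h1, h2, h3, h4⟩ := comm_form he hc
  have hy : y = 1 := by
    have : (y - 1) * tr e = 0 := by
      simp only [tr, h1, h4] at ht ⊢
      linear_combination ht - x * two0 (F := F)
    rcases mul_eq_zero.1 this with h | h
    · exact sub_eq_zero.1 h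
    · exact absurd h h0
  subst hy
  have hd := sl_det e
  have hd' := sl_det e'
  rw [h1, h2, h3, h4] at hd'
  have : x * (x + tr e) = 0 := by
    simp only [tr]; linear_combination hd' - hd
  rcases mul_eq_zero.1 this with h | h
  · left
    subst h
    apply sl_ext
    · rw [h1]; ring
    · rw [h2]; ring
    · rw [h3]; ring
    · rw [h4]; ring
  · right
    have hx : x = tr e := by rw [← sub_eq_zero, CharTwo.sub_eq_add]; exact h
    simp only [tr] at hx
    have h2' := two0 (F := F)
    apply sl_ext
    · rw [h1, inv00, hx]; linear_combination e 0 0 * h2'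
    · rw [h2, inv01]; ring
    · rw [h3, inv10]; ring
    · rw [h4, inv11, hx]; linear_combination e 1 1 * h2'

theorem tr_ne_of_comm {g e : SL F} (hg : tr g ≠ 0) (he : e ≠ 1) (hc : e * g = g * e) :
    tr e ≠ 0 := by
  intro h
  have hg1 : g ≠ 1 := by rintro rfl; exact hg tr_one
  obtain ⟨x, y, h1, h2, h3, h4⟩ := comm_form he hc.symm
  apply hg
  simp only [tr, h1, h4] at h ⊢
  linear_combination y * h + x * two0 (F := F)

theorem sl_conj_ne {g k : SL F} (hg : g ≠ 1) : k * g * k⁻¹ ≠ 1 := fun h => hg (by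
  rwa [mul_inv_eq_one, mul_eq_left] at h)

/-- nontrivial elements of `B` with nonzero trace are `U`-conjugate to the diagonal -/
theorem conj_diag (g : BB F) (hg : tr (g : SL F) ≠ 0) :
    ∃ y : F, (g : SL F) = uu y * tt (dg g) * (uu y)⁻¹ := by
  have h0 := mem_BB.1 g.2
  refine ⟨(g : SL F) 0 1 / tr (g : SL F), ?_⟩
  have hh : (((dg g)⁻¹ : Fˣ) : F) = (g : SL F) 1 1 := rfl
  apply sl_ext
  · simp [sl_mul, uu, tt, mk00, mk01, mk10, mk11, inv00, inv10, dg_apply]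
  · simp [sl_mul, uu, tt, mk00, mk01, mk10, mk11, inv01, inv11, dg_apply, hh]
    field_simp
    rw [tr]
  · simp [sl_mul, uu, tt, mk00, mk01, mk10, mk11, inv00, inv10, dg_apply, h0]
  · simp [sl_mul, uu, tt, mk00, mk01, mk10, mk11, inv01, inv11, dg_apply]
    exact hh.symm.trans (Units.val_inv_eq_inv_val _)

theorem tr_tt (a : Fˣ) : tr (tt a) = 0 ↔ a = 1 := by
  change (a : F) + (a⁻¹ : Fˣ) = 0 ↔ _
  constructor
  · intro h
    have h1 : (a : F) = (a⁻¹ : Fˣ) := by rw [← sub_eq_zero, CharTwo.sub_eq_add]; exact h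
    have h2 : a = a⁻¹ := Units.ext h1
    have h3 : (a : F) ^ 2 = 1 := by
      rw [sq]; nth_rewrite 2 [h1]; simp
    exact Units.ext (CharTwo.sq_injective (by simpa using h3))
  · rintro rfl
    simp [CharTwo.add_self_eq_zero]

theorem tr_BB (g : BB F) : tr (g : SL F) = 0 ↔ (g : SL F) ∈ UU F := by
  rw [← dg_ker, ← tr_tt]; rfl

theorem uu_fix {b : F} (hb : b ≠ 0) {x : Om F} (hx : uu b • x = x) : x = pinf F := by
  by_contra h
  obtain ⟨y, rfl⟩ := bruhat h
  have : ((uu y)⁻¹ * uu b * uu y) • p0 F = p0 F := by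
    rw [mul_smul, mul_smul, hx, inv_smul_smul]
  rw [mul_assoc, ← uu_add, add_comm, uu_add, inv_mul_cancel_left, smul_p0] at this
  exact hb this

theorem mem_UU' {g : SL F} (hg : g ∈ UU F) : ∃ b, g = uu b := by
  obtain ⟨b, rfl⟩ := hg
  exact ⟨b.toAdd, rfl⟩

theorem uu_conj {b : F} (hb : b ≠ 0) : ∃ k : SL F, uu b = k * uu 1 * k⁻¹ := by
  obtain ⟨a, ha⟩ := exists_sqrt b
  have ha0 : a ≠ 0 := by rintro rfl; simp at ha; exact hb ha.symm
  refine ⟨tt (Units.mk0 a ha0), ?_⟩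
  rw [tt_uu, mul_inv_cancel_right]; simp [ha]

/-- trace zero elements: exactly one fixed point -/
theorem tr_zero_fix {g : SL F} (h : tr g = 0) : ∃ x : Om F, g • x = x := by
  have hp : IsPGroup 2 (Subgroup.zpowers g) := by
    have h1 : g ^ 2 = 1 := by rw [sq, sq_one_iff, h]
    intro x
    obtain ⟨n, hn⟩ := Subgroup.mem_zpowers_iff.1 x.2
    refine ⟨1, Subtype.ext ?_⟩
    rw [pow_one, Subgroup.coe_pow, ← hn, ← zpow_natCast, zpow_comm g]
    simp only [Nat.cast_ofNat, zpow_ofNat, h1, one_zpow, Subgroup.coe_one]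
  obtain ⟨P, hP⟩ := hp.exists_le_sylow
  refine ⟨P, ?_⟩
  rw [Sylow.smul_eq_iff_mem_normalizer]
  exact Subgroup.le_normalizer (hP (Subgroup.mem_zpowers g))

/-- conjugation into `B` -/
theorem fix_conj {g : SL F} {x : Om F} (hx : g • x = x) : ∃ (k : SL F) (b : BB F),
    k • pinf F = x ∧ g = k * b * k⁻¹ := by
  obtain ⟨k, rfl⟩ := om_trans x
  refine ⟨k, ⟨k⁻¹ * g * k, ?_⟩, rfl, by group⟩
  rw [mem_BB, ← smul_pinf, mul_smul, mul_smul, hx, inv_smul_smul]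

theorem conj_fix {g k : SL F} {x : Om F} : (k * g * k⁻¹) • x = x ↔ g • (k⁻¹ • x) = k⁻¹ • x := by
  rw [mul_smul, mul_smul, ← eq_inv_smul_iff]

theorem tr_zero_unique {g : SL F} (h : tr g = 0) (h1 : g ≠ 1) {x y : Om F} (hx : g • x = x)
    (hy : g • y = y) : x = y := by
  obtain ⟨k, b, rfl, rfl⟩ := fix_conj hx
  rw [tr_conj, tr_BB] at h
  obtain ⟨c, hc⟩ := mem_UU' h
  have hc0 : c ≠ 0 := by
    rintro rfl
    rw [uu_zero] at hc
    rw [hc] at h1; simp at h1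
  rw [conj_fix, hc] at hy
  rw [← uu_fix hc0 hy, smul_inv_smul]

theorem invol_conj {g : SL F} (h : tr g = 0) (h1 : g ≠ 1) : ∃ k : SL F, g = k * uu 1 * k⁻¹ := by
  obtain ⟨x, hx⟩ := tr_zero_fix h
  obtain ⟨k, b, rfl, rfl⟩ := fix_conj hx
  rw [tr_conj, tr_BB] at h
  obtain ⟨c, hc⟩ := mem_UU' h
  have hc0 : c ≠ 0 := by
    rintro rfl
    rw [uu_zero] at hc
    rw [hc] at h1; simp at h1
  obtain ⟨l, hl⟩ := uu_conj hc0
  exact ⟨k * l, by rw [hc, hl]; group⟩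

theorem tr_ne_second {g : SL F} (h : tr g ≠ 0) {x : Om F} (hx : g • x = x) :
    ∃ y, y ≠ x ∧ g • y = y := by
  obtain ⟨k, b, rfl, rfl⟩ := fix_conj hx
  rw [tr_conj] at h
  obtain ⟨y, hy⟩ := conj_diag b h
  refine ⟨k • uu y • p0 F, ?_, ?_⟩
  · intro e
    rw [smul_left_cancel_iff, ← eq_inv_smul_iff] at e
    have : (uu y)⁻¹ • pinf F = pinf F := by rw [inv_smul_eq_iff, uu_smul_inf]
    rw [this] at e
    exact p0_ne e
  · rw [conj_fix, inv_smul_smul, hy, conj_fix, inv_smul_smul, tt_smul_p0]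

theorem split_conj {g : SL F} (h : tr g ≠ 0) {x : Om F} (hx : g • x = x) :
    ∃ (k : SL F) (a : Fˣ), g = k * tt a * k⁻¹ ∧ a ≠ 1 := by
  obtain ⟨k, b, rfl, rfl⟩ := fix_conj hx
  rw [tr_conj] at h
  obtain ⟨y, hy⟩ := conj_diag b h
  refine ⟨k * uu y, dg b, by nth_rewrite 1 [hy]; group, ?_⟩
  intro e
  rw [dg_ker, ← tr_BB] at e
  exact h e

theorem tt_inv_conj (a : Fˣ) : tt a⁻¹ = ww * tt a * ww⁻¹ := by
  apply sl_ext <;> simp [tt, ww, sl_mul, inv00, inv01, inv10, inv11, mk00, mk01, mk10, mk11]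

end sl2

section nonsplit
variable (F : Type) [Field F] [Fintype F] [CharP F 2]

theorem sq_sub1 (n : ℕ) : n ^ 2 - 1 = (n + 1) * (n - 1) := by
  simpa using Nat.sq_sub_sq n 1

theorem exists_ns : ∃ g : SL F, orderOf g = Fintype.card F + 1 := by
  let K := FiniteField.Extension F 2 2
  have hK : Nat.card K = Fintype.card F ^ 2 := by
    rw [FiniteField.natCard_extension, Nat.card_eq_fintype_card]
  have hq : 1 < Fintype.card F := Fintype.one_lt_card
  have := Fintype.ofFinite K
  obtain ⟨z, hz⟩ := IsCyclic.exists_generator (α := Kˣ)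
  have hoz : orderOf z = (Fintype.card F + 1) * (Fintype.card F - 1) := by
    rw [orderOf_eq_card_of_forall_mem_zpowers hz, Nat.card_units, hK, sq_sub1]
  let y := z ^ (Fintype.card F - 1)
  have hy : orderOf y = Fintype.card F + 1 := by
    rw [orderOf_pow_of_dvd (by omega) ⟨_, by rw [hoz, mul_comm]⟩, hoz,
      Nat.mul_div_cancel _ (by omega)]
  let b : Module.Basis (Fin 2) F K := Module.finBasisOfFinrankEq F K
    (FiniteField.finrank_extension F 2 2)
  have hn : ∀ x : Subgroup.zpowers y, (Algebra.leftMulMatrix b (x : Kˣ)).det = 1 := by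
    intro x
    rw [← Algebra.norm_eq_matrix_det b]
    apply (algebraMap F K).injective
    have e : (Fintype.card F ^ 2 - 1) / (Fintype.card F - 1) = Fintype.card F + 1 := by
      have : Fintype.card F ^ 2 - 1 = (Fintype.card F + 1) * (Fintype.card F - 1) :=
        sq_sub1 _
      rw [this, Nat.mul_div_cancel _ (by omega)]
    rw [FiniteField.algebraMap_norm_eq_pow, hK, Nat.card_eq_fintype_card, e, map_one,
      ← Units.val_pow_eq_pow_val, ← hy]
    obtain ⟨n, hn⟩ := Subgroup.mem_zpowers_iff.1 x.2
    rw [← hn, ← zpow_natCast, zpow_comm, zpow_natCast, pow_orderOf_eq_one, one_zpow]; rfl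
  let φ : Subgroup.zpowers y →* SL F :=
    { toFun := fun x => ⟨Algebra.leftMulMatrix b (x : Kˣ), hn x⟩
      map_one' := Subtype.ext (by simp)
      map_mul' := fun a c => Subtype.ext
        (map_mul (Algebra.leftMulMatrix b) ((a : Kˣ) : K) ((c : Kˣ) : K)) }
  have hφ : Function.Injective φ := fun a c h => Subtype.ext (Units.ext
    (Algebra.leftMulMatrix_injective b (congrArg Subtype.val h)))
  exact ⟨φ ⟨y, Subgroup.mem_zpowers y⟩, by
    rw [orderOf_injective φ hφ, Subgroup.orderOf_mk, hy]⟩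

theorem exists_sp : ∃ a : Fˣ, orderOf a = Fintype.card F - 1 := by
  obtain ⟨a, ha⟩ := IsCyclic.exists_generator (α := Fˣ)
  exact ⟨a, by rw [orderOf_eq_card_of_forall_mem_zpowers ha, Nat.card_eq_fintype_card, Fintype.card_units]⟩
end nonsplit
end CD
end

noncomputable section
namespace CD
open scoped Classical
open Representation

section schurSL
open scoped commutatorElement
variable {F : Type} [Field F] [Fintype F] [CharP F 2]

theorem exists_c (hq : 4 < Fintype.card F) : ∃ c : F, c ≠ 0 ∧ 1 + c ≠ 0 ∧ c ^ 2 + c + 1 ≠ 0 := by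
  obtain ⟨a, ha⟩ := exists_sp F
  have h3 : a ^ 3 ≠ 1 := fun h => by
    have := Nat.le_of_dvd (by norm_num) (orderOf_dvd_of_pow_eq_one h)
    omega
  have h3' : (a : F) ^ 3 ≠ 1 := fun h => h3 (Units.ext (by simpa using h))
  refine ⟨a, a.ne_zero, ?_, ?_⟩
  · intro h
    apply h3'
    have : (a : F) = 1 := by linear_combination h - two0 (F := F)
    rw [this]; simp
  · intro h
    apply h3'
    linear_combination ((a : F) - 1) * h

theorem cyc_comm {P S : Type} [Group P] [Group S] (ψ : P →* S) (hψ : Function.Surjective ψ)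
    (hc : ψ.ker ≤ Subgroup.center P) (s : S) (a b : P) (ha : ψ a ∈ Subgroup.zpowers s)
    (hb : ψ b ∈ Subgroup.zpowers s) : a * b = b * a := by
  obtain ⟨t, rfl⟩ := hψ s
  have key : ∀ a, ψ a ∈ Subgroup.zpowers (ψ t) → ∃ (i : ℤ) (z : P), z ∈ Subgroup.center P ∧
      a = t ^ i * z := by
    intro a ha
    obtain ⟨i, hi⟩ := Subgroup.mem_zpowers_iff.1 ha
    refine ⟨i, (t ^ i)⁻¹ * a, hc ?_, by group⟩
    rw [MonoidHom.mem_ker, map_mul, map_inv, map_zpow, hi, inv_mul_cancel]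
  obtain ⟨i, z, hz, rfl⟩ := key a ha
  obtain ⟨j, w, hw, rfl⟩ := key b hb
  have hz' := Subgroup.mem_center_iff.1 hz
  have hw' := Subgroup.mem_center_iff.1 hw
  calc t ^ i * z * (t ^ j * w) = t ^ i * (z * t ^ j) * w := by group
    _ = t ^ i * (t ^ j * z) * w := by rw [hz']
    _ = (t ^ (j + i) * z) * w := by rw [add_comm, zpow_add]; group
    _ = t ^ j * t ^ i * (z * w) := by rw [zpow_add]; group
    _ = t ^ j * t ^ i * (w * z) := by rw [hw']
    _ = t ^ j * (t ^ i * w) * z := by group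
    _ = t ^ j * w * (t ^ i * z) := by rw [hw']; group

theorem comm_central {P : Type} [Group P] (a b z w : P) (hz : z ∈ Subgroup.center P)
    (hw : w ∈ Subgroup.center P) : ⁅a * z, b * w⁆ = ⁅a, b⁆ := by
  have hz' := Subgroup.mem_center_iff.1 hz
  have hw' := Subgroup.mem_center_iff.1 hw
  simp only [commutatorElement_def, mul_inv_rev]
  calc a * z * (b * w) * (z⁻¹ * a⁻¹) * (w⁻¹ * b⁻¹)
      = a * (z * (b * w)) * z⁻¹ * a⁻¹ * w⁻¹ * b⁻¹ := by group
    _ = a * ((b * w) * z) * z⁻¹ * a⁻¹ * w⁻¹ * b⁻¹ := by rw [hz']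
    _ = a * b * (w * a⁻¹) * w⁻¹ * b⁻¹ := by group
    _ = a * b * (a⁻¹ * w) * w⁻¹ * b⁻¹ := by rw [hw']
    _ = a * b * a⁻¹ * b⁻¹ := by group

theorem U_comm (hq : 4 < Fintype.card F) {P : Type} [Group P] (ψ : P →* SL F)
    (hψ : Function.Surjective ψ) (hc : ψ.ker ≤ Subgroup.center P) (a b : P)
    (ha : ψ a ∈ UU F) (hb : ψ b ∈ UU F) : a * b = b * a := by
  choose v hv using fun x : F => hψ (uu x)
  have hlift : ∀ (a : P) (x : F), ψ a = uu x → ∃ z ∈ Subgroup.center P, a = v x * z := by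
    intro a x h
    refine ⟨(v x)⁻¹ * a, hc ?_, by group⟩
    rw [MonoidHom.mem_ker, map_mul, map_inv, hv, h, inv_mul_cancel]
  let κ : F → F → P := fun x y => ⁅v x, v y⁆
  have hκ : ∀ (a b : P) (x y : F), ψ a = uu x → ψ b = uu y → ⁅a, b⁆ = κ x y := by
    intro a b x y h1 h2
    obtain ⟨z, hz, rfl⟩ := hlift a x h1
    obtain ⟨w, hw, rfl⟩ := hlift b y h2
    exact comm_central _ _ _ _ hz hw
  have hκc : ∀ x y g, g * κ x y = κ x y * g := by
    intro x y
    have : κ x y ∈ Subgroup.center P := hc (by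
      rw [MonoidHom.mem_ker, map_commutatorElement, hv, hv, commutatorElement_eq_one_iff_mul_comm,
        ← uu_add, ← uu_add, add_comm])
    exact Subgroup.mem_center_iff.1 this
  have hadd1 : ∀ x x' y, κ (x + x') y = κ x y * κ x' y := by
    intro x x' y
    rw [← hκ (v x * v x') (v y) (x + x') y (by rw [map_mul, hv, hv, uu_add]) (hv y)]
    have : ⁅v x * v x', v y⁆ = v x * κ x' y * (v x)⁻¹ * κ x y := by
      simp only [κ, commutatorElement_def]; group
    rw [this, hκc x' y, mul_inv_cancel_right, hκc]
  have hadd2 : ∀ x y y', κ x (y + y') = κ x y * κ x y' := by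
    intro x y y'
    rw [← hκ (v x) (v y * v y') x (y + y') (hv x) (by rw [map_mul, hv, hv, uu_add])]
    have : ⁅v x, v y * v y'⁆ = κ x y * (v y * κ x y' * (v y)⁻¹) := by
      simp only [κ, commutatorElement_def]; group
    rw [this, hκc x y', mul_inv_cancel_right]
  have hinv : ∀ (d : Fˣ) x y, κ ((d : F) * x) (d * y) = κ x y := by
    intro d x y
    obtain ⟨c, hcd⟩ := exists_sqrt (d : F)
    have hc0 : c ≠ 0 := by rintro rfl; simp at hcd; exact d.ne_zero hcd.symm
    obtain ⟨s, hs⟩ := hψ (tt (Units.mk0 c hc0))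
    have h1 : ∀ x, ψ (s * v x * s⁻¹) = uu (d * x) := fun x => by
      rw [map_mul, map_mul, map_inv, hs, hv, tt_uu, mul_inv_cancel_right]; simp [hcd]
    rw [← hκ _ _ _ _ (h1 x) (h1 y)]
    have : ⁅s * v x * s⁻¹, s * v y * s⁻¹⁆ = s * κ x y * s⁻¹ := by
      simp only [κ, commutatorElement_def]; group
    rw [this, hκc, mul_inv_cancel_right]
  have hdiv : ∀ (x y : F), x ≠ 0 → κ x y = κ 1 (y / x) := by
    intro x y hx
    rw [← hinv (Units.mk0 x hx) 1 (y / x)]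
    simp only [Units.val_mk0, mul_one]
    rw [mul_div_cancel₀ _ hx]
  have hz : κ 1 0 = 1 := by
    have := hadd2 1 0 0
    rw [add_zero] at this
    exact (mul_eq_left.1 this.symm)
  obtain ⟨c, hc0, hc1, hc2⟩ := exists_c hq
  have hone : ∀ y, κ 1 y = 1 := by
    intro y
    let y' := y * (c * (1 + c)) / (c ^ 2 + c + 1)
    have h1 := hadd1 1 c y'
    rw [hdiv _ _ hc1, hdiv _ _ hc0, ← hadd2] at h1
    have h2 : y = y' / (1 + c) + (y' + y' / c) := by
      have hy : y' * (c ^ 2 + c + 1) = y * (c * (1 + c)) := div_mul_cancel₀ _ hc2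
      clear_value y'
      have e : y' / (1 + c) + (y' + y' / c) = y' * (c ^ 2 + 3 * c + 1) / (c * (1 + c)) := by
        field_simp; ring
      rw [e, eq_div_iff (mul_ne_zero hc0 hc1)]
      linear_combination - hy - c * y' * two0 (F := F)
    rw [h2, hadd2, h1, ← hadd2, CharTwo.add_self_eq_zero, hz]
  have hall : ∀ x y, κ x y = 1 := by
    intro x y
    by_cases hx : x = 0
    · have := hadd1 0 0 y
      rw [add_zero] at this
      rw [hx]; exact mul_eq_left.1 this.symm
    · rw [hdiv _ _ hx, hone]
  obtain ⟨x, hx⟩ := mem_UU' ha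
  obtain ⟨y, hy⟩ := mem_UU' hb
  rw [← commutatorElement_eq_one_iff_mul_comm, hκ a b x y hx hy, hall]

theorem index_of_card (C : Subgroup (SL F)) {m n : ℕ} (hm : Nat.card C = m) (hm0 : 0 < m)
    (h : m * n = Fintype.card F * (Fintype.card F - 1) * (Fintype.card F + 1)) :
    C.index = n := by
  have := Subgroup.card_mul_index C
  rw [card_SL, hm, ← h] at this
  exact Nat.eq_of_mul_eq_mul_left hm0 this

theorem schur_SL (hq : 4 < Fintype.card F) (P : Type) [Group P] [Finite P] (ψ : P →* SL F)
    (hψ : Function.Surjective ψ) (hc : ψ.ker ≤ Subgroup.center P) (η : ψ.ker →* ℂˣ) :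
    ∃ μ : P →* ℂˣ, ∀ z : ψ.ker, μ z = η z := by
  obtain ⟨g, hg⟩ := exists_ns F
  obtain ⟨a, ha⟩ := exists_sp F
  obtain ⟨f, hf, hf0⟩ := card_F_pow (F := F)
  have hev : 2 ∣ Fintype.card F := by rw [hf]; exact dvd_pow_self 2 hf0.ne'
  have h1 := ext_pow ψ hψ hc η _ (cyc_comm ψ hψ hc g)
  have h2 := ext_pow ψ hψ hc η _ (cyc_comm ψ hψ hc (tt a))
  have h3 := ext_pow ψ hψ hc η _ (U_comm hq ψ hψ hc)
  have hta : orderOf (tt a : SL F) = Fintype.card F - 1 := by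
    rw [← ha]; exact orderOf_injective tH tH_inj a
  rw [index_of_card (n := Fintype.card F * (Fintype.card F - 1)) (Subgroup.zpowers g)
    (Nat.card_zpowers g) (by omega) (by rw [hg]; ring)] at h1
  rw [index_of_card (n := Fintype.card F * (Fintype.card F + 1)) (Subgroup.zpowers (tt a))
    (Nat.card_zpowers _) (by omega) (by rw [hta]; ring)] at h2
  rw [index_of_card (n := (Fintype.card F - 1) * (Fintype.card F + 1)) (UU F)
    card_UU (by omega) (by ring)] at h3
  have h4 := ext_gcd ψ η (ext_gcd ψ η h1 h2) h3
  have : Nat.gcd (Nat.gcd (Fintype.card F * (Fintype.card F - 1))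
      (Fintype.card F * (Fintype.card F + 1)))
      ((Fintype.card F - 1) * (Fintype.card F + 1)) = 1 := by
    obtain ⟨k, hk⟩ := hev
    rw [hk] at hq ⊢
    rw [Nat.gcd_mul_left]
    have e1 : Nat.gcd (2 * k - 1) (2 * k + 1) = 1 := by
      rw [← Nat.coprime_iff_gcd_eq_one]
      have : 2 * k + 1 = (2 * k - 1) + 2 := by omega
      rw [this, Nat.coprime_self_add_right, Nat.coprime_two_right]
      exact ⟨k - 1, by omega⟩
    rw [e1, mul_one, ← Nat.coprime_iff_gcd_eq_one]
    refine Nat.Coprime.mul_right ?_ ?_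
    · have : (2 * k) = (2 * k - 1) + 1 := by omega
      nth_rewrite 1 [this]
      simp
    · simp
  simpa [this] using h4

end schurSL
end CD
end

noncomputable section
namespace CD
open scoped Classical
open Representation

theorem idem_rep {A V : Type} [Group A] [AddCommGroup V] [Module ℂ V] [FiniteDimensional ℂ V]
    (ρ : Representation ℂ A V) (e : Module.End ℂ V) (he : e * e = e)
    (hc : ∀ a, ρ a * e = e * ρ a) : ∃ σ : Representation ℂ A (LinearMap.range e),
      ∀ a, σ.character a = LinearMap.trace ℂ V (ρ a * e) := by
  let p : V →ₗ[ℂ] LinearMap.range e := e.rangeRestrict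
  let i : LinearMap.range e →ₗ[ℂ] V := (LinearMap.range e).subtype
  have hip : i ∘ₗ p = e := rfl
  have hpi : p ∘ₗ i = LinearMap.id := by
    ext ⟨v, w, rfl⟩
    exact LinearMap.congr_fun he w
  have hpe : p ∘ₗ e = p := by
    ext w
    exact LinearMap.congr_fun he w
  refine ⟨⟨⟨fun a => p ∘ₗ ρ a ∘ₗ i, ?_⟩, ?_⟩, ?_⟩
  · rw [map_one, Module.End.one_eq_id, LinearMap.id_comp, hpi]; rfl
  · intro a b
    change p ∘ₗ ρ (a * b) ∘ₗ i = (p ∘ₗ ρ a ∘ₗ i) ∘ₗ (p ∘ₗ ρ b ∘ₗ i)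
    have : (p ∘ₗ ρ a ∘ₗ i) ∘ₗ (p ∘ₗ ρ b ∘ₗ i) = p ∘ₗ (ρ a * e * ρ b) ∘ₗ i := rfl
    rw [this, hc, mul_assoc, ← map_mul]
    change _ = (p ∘ₗ e) ∘ₗ ρ (a * b) ∘ₗ i
    rw [hpe]
  · intro a
    change LinearMap.trace ℂ _ (p ∘ₗ (ρ a ∘ₗ i)) = _
    rw [LinearMap.trace_comp_comm']; rfl

section sums
variable {F : Type} [Field F] [Fintype F] [CharP F 2]

theorem tt_uu_conj {a : Fˣ} (ha : a ≠ 1) (b : F) : ∃ k : SL F, tt a * uu b = k * tt a * k⁻¹ := by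
  have hm : tt a * uu b ∈ BB F := (BB F).mul_mem rfl (UU_le_BB (uu_mem b))
  have hd : dg ⟨tt a * uu b, hm⟩ = a := by
    apply Units.ext; rw [dg_apply]; simp [sl_mul, tt, uu, mk00, mk01, mk10, mk11]
  obtain ⟨y, hy⟩ := conj_diag ⟨tt a * uu b, hm⟩ (by
    rw [Ne, tr_BB, ← dg_ker, hd]; exact ha)
  rw [hd] at hy
  exact ⟨_, hy⟩

theorem sum_BB (Φ : SL F → ℂ) : ∑ g with g • pinf F = pinf F, Φ g =
    ∑ a : Fˣ, ∑ b : F, Φ (tt a * uu b) := by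
  rw [← Fintype.sum_prod_type']
  symm
  refine Finset.sum_bij (fun x _ => tt x.1 * uu x.2) ?_ ?_ ?_ ?_
  · intro x _
    simp [mul_smul, uu_smul_inf, tt_smul_inf]
  · rintro ⟨a, b⟩ _ ⟨a', b'⟩ _ h
    have h1 := congrArg (fun g : SL F => g 0 0) h
    have h2 := congrArg (fun g : SL F => g 0 1) h
    simp [sl_mul, tt, uu, mk00, mk01, mk10, mk11] at h1 h2
    obtain rfl := Units.ext h1
    simp at h2
    rw [h2]
  · intro g hg
    rw [Finset.mem_filter, smul_pinf] at hg
    let g' : BB F := ⟨g, hg.2⟩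
    have h1 : dg (⟨tt (dg g'), rfl⟩⁻¹ * g') = 1 := by
      rw [map_mul, map_inv]
      rw [inv_mul_eq_one]; exact Units.ext rfl
    rw [dg_ker] at h1
    obtain ⟨b, hb⟩ := mem_UU' h1
    refine ⟨(dg g', b), Finset.mem_univ _, ?_⟩
    simp only [← hb, Subgroup.coe_mul, Subgroup.coe_inv]
    group; rfl
  · intro x _; rfl

/-- number of fixed points -/
def fx (g : SL F) : ℕ := (Finset.univ.filter fun x : Om F => g • x = x).card

theorem card_Om' : (Fintype.card (Om F) : ℂ) = Fintype.card F + 1 := by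
  rw [← Nat.card_eq_fintype_card, card_Om]; push_cast; rfl

theorem fix_sum (Φ : SL F → ℂ) (hΦ : ∀ g h, Φ (h * g * h⁻¹) = Φ g) :
    ∑ g, Φ g * fx g = (Fintype.card F + 1) * (Φ 1 + (Fintype.card F - 1) * Φ (uu 1) +
      Fintype.card F * ∑ a : Fˣ with a ≠ 1, Φ (tt a)) := by
  have h1 : ∀ g : SL F, Φ g * fx g = ∑ x : Om F, if g • x = x then Φ g else 0 := by
    intro g
    rw [← Finset.sum_filter, Finset.sum_const, fx, nsmul_eq_mul, mul_comm]
  have h2 : ∀ x : Om F, (∑ g : SL F, if g • x = x then Φ g else 0) =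
      ∑ g with g • pinf F = pinf F, Φ g := by
    intro x
    obtain ⟨k, rfl⟩ := om_trans x
    rw [Finset.sum_filter, ← Equiv.sum_comp (MulAut.conj k).toEquiv]
    refine Finset.sum_congr rfl fun g _ => ?_
    simp only [MulEquiv.toEquiv_eq_coe, EquivLike.coe_coe, MulAut.conj_apply, hΦ, conj_fix,
      inv_smul_smul]
  have h3 : ∀ a : Fˣ, a ≠ 1 → ∑ b : F, Φ (tt a * uu b) = Fintype.card F * Φ (tt a) := by
    intro a ha
    rw [← nsmul_eq_mul, ← Finset.card_univ, ← Finset.sum_const]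
    refine Finset.sum_congr rfl fun b _ => ?_
    obtain ⟨k, hk⟩ := tt_uu_conj ha b
    rw [hk, hΦ]
  have h4 : ∑ b : F, Φ (tt 1 * uu b) = Φ 1 + (Fintype.card F - 1) * Φ (uu 1) := by
    rw [← Finset.add_sum_erase _ _ (Finset.mem_univ (0 : F))]
    congr 1
    · rw [uu_zero, tt_one, mul_one]
    · rw [Finset.sum_congr rfl (g := fun _ => Φ (uu 1))]
      · rw [Finset.sum_const, Finset.card_erase_of_mem (Finset.mem_univ _), Finset.card_univ,
          nsmul_eq_mul, Nat.cast_sub Fintype.card_pos]; simp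
      · intro b hb
        obtain ⟨k, hk⟩ := uu_conj (Finset.ne_of_mem_erase hb)
        rw [tt_one, one_mul, hk, hΦ]
  simp only [h1]
  rw [Finset.sum_comm]
  simp only [h2, Finset.sum_const, Finset.card_univ, nsmul_eq_mul, card_Om', sum_BB]
  congr 1
  rw [← Finset.sum_filter_add_sum_filter_not _ (fun a : Fˣ => a = 1)]
  congr 1
  · rw [Finset.filter_eq', if_pos (Finset.mem_univ _), Finset.sum_singleton, h4]
  · rw [Finset.mul_sum]
    exact Finset.sum_congr rfl fun a ha => h3 a (Finset.mem_filter.1 ha).2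

theorem fx_one : (fx (1 : SL F) : ℂ) = Fintype.card F + 1 := by
  rw [fx, Finset.filter_true_of_mem (by simp), Finset.card_univ, card_Om']

theorem fx_inv {g : SL F} (h1 : g ≠ 1) (h : tr g = 0) : fx g = 1 := by
  obtain ⟨x, hx⟩ := tr_zero_fix h
  rw [fx, Finset.card_eq_one]
  refine ⟨x, ?_⟩
  ext y
  simp only [Finset.mem_filter, Finset.mem_univ, true_and, Finset.mem_singleton]
  exact ⟨fun hy => tr_zero_unique h h1 hy hx, fun hy => hy ▸ hx⟩

theorem fx_split {g : SL F} (h : tr g ≠ 0) {x : Om F} (hx : g • x = x) : fx g = 2 := by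
  obtain ⟨y, hy, hgy⟩ := tr_ne_second h hx
  rw [fx, Finset.card_eq_two]
  refine ⟨x, y, hy.symm, ?_⟩
  ext z
  simp only [Finset.mem_filter, Finset.mem_univ, true_and, Finset.mem_insert, Finset.mem_singleton]
  constructor
  · intro hz
    by_contra hc
    push Not at hc
    have := three_fix hy.symm (Ne.symm hc.1) (Ne.symm hc.2) hx hgy hz
    rw [this, tr_one] at h; exact h rfl
  · rintro (rfl | rfl) <;> assumption

/-- fixed point free -/
def NS (g : SL F) : Prop := ∀ x : Om F, g • x ≠ x

theorem fx_NS {g : SL F} (h : NS g) : fx g = 0 := by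
  rw [fx, Finset.card_eq_zero, Finset.filter_eq_empty_iff]
  exact fun x _ => h x

theorem NS_tr {g : SL F} (h : NS g) : tr g ≠ 0 := fun h0 => by
  obtain ⟨x, hx⟩ := tr_zero_fix h0
  exact h x hx

theorem card_inv : ((Finset.univ.filter fun g : SL F => g ≠ 1 ∧ tr g = 0).card : ℂ) =
    (Fintype.card F + 1) * (Fintype.card F - 1) := by
  have := fix_sum (F := F) (fun g => if g ≠ 1 ∧ tr g = 0 then 1 else 0) (fun g h => by
    simp only [tr_conj]
    congr 2
    simp)
  simp only [ne_eq, not_true_eq_false, false_and, if_false] at this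
  have hu : (uu (1 : F)) ≠ 1 := fun h => one_ne_zero (congrArg (fun g : SL F => g 0 1) h)
  have hu' : tr (uu (1 : F)) = 0 := by simp [tr, uu, mk00, mk11, CharTwo.add_self_eq_zero]
  rw [Finset.sum_eq_zero (s := Finset.univ.filter _) (by
    intro a ha
    rw [if_neg]
    rintro ⟨-, h⟩
    exact (Finset.mem_filter.1 ha).2 ((tr_tt a).1 h))] at this
  rw [if_pos ⟨hu, hu'⟩] at this
  rw [Finset.card_filter]
  push_cast
  have e : ∀ g : SL F, (if g ≠ 1 ∧ tr g = 0 then (1 : ℂ) else 0) =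
      (if ¬ g = 1 ∧ tr g = 0 then (1 : ℂ) else 0) * fx g := by
    intro g
    by_cases h : g ≠ 1 ∧ tr g = 0
    · rw [if_pos h, fx_inv h.1 h.2]; simp
    · rw [if_neg h, zero_mul]
  rw [Finset.sum_congr rfl fun g _ => e g, this]
  ring

theorem class_sum (Φ : SL F → ℂ) (hΦ : ∀ g h, Φ (h * g * h⁻¹) = Φ g) :
    2 * ∑ g, Φ g = 2 * Φ 1 + 2 * (Fintype.card F ^ 2 - 1) * Φ (uu 1) +
      Fintype.card F * (Fintype.card F + 1) * ∑ a : Fˣ with a ≠ 1, Φ (tt a) +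
      2 * ∑ g with NS g, Φ g := by
  have h1 := fix_sum Φ hΦ
  have h2 : ∀ g, Φ g * 2 = Φ g * fx g + ((if g = 1 then (1 - Fintype.card F : ℂ) * Φ 1 else 0) +
      (if g ≠ 1 ∧ tr g = 0 then Φ (uu 1) else 0) + 2 * (if NS g then Φ g else 0)) := by
    intro g
    by_cases hg : g = 1
    · subst hg
      rw [if_pos rfl, if_neg (by simp), if_neg (fun h => h (pinf F) (one_smul _ _)), fx_one]; ring
    rw [if_neg hg]
    by_cases ht : tr g = 0
    · rw [if_pos ⟨hg, ht⟩, if_neg (fun h => NS_tr h ht), fx_inv hg ht]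
      obtain ⟨k, hk⟩ := invol_conj ht hg
      rw [hk, hΦ]; push_cast; ring
    rw [if_neg (fun h => ht h.2)]
    by_cases hn : NS g
    · rw [if_pos hn, fx_NS hn]; push_cast; ring
    · rw [if_neg hn]
      simp only [NS, not_forall, not_not] at hn
      obtain ⟨x, hx⟩ := hn
      rw [fx_split ht hx]; push_cast; ring
  have h3 := Finset.sum_congr (rfl : (Finset.univ : Finset (SL F)) = _) fun g _ => h2 g
  simp only [Finset.sum_add_distrib, ← Finset.sum_mul, ← Finset.mul_sum] at h3
  rw [h1, Finset.sum_ite_eq' , if_pos (Finset.mem_univ _), ← Finset.sum_filter, ← Finset.sum_filter,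
    Finset.sum_const, nsmul_eq_mul, card_inv] at h3
  linear_combination h3
end sums
end CD
end

noncomputable section
namespace CD
open scoped Classical
open Representation

section sums
variable {F : Type} [Field F] [Fintype F] [CharP F 2]
variable {V : Type} [AddCommGroup V] [Module ℂ V] [FiniteDimensional ℂ V]

theorem torus_rep (ρ : Representation ℂ (SL F) V) :
    ∃ (W : Type) (_ : AddCommGroup W) (_ : Module ℂ W) (_ : FiniteDimensional ℂ W)
      (σ : Representation ℂ Fˣ W), (∀ a, a ≠ 1 → σ.character a = ρ.character (tt a)) ∧
      (Fintype.card F : ℂ) * Module.finrank ℂ W =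
        Module.finrank ℂ V + (Fintype.card F - 1) * ρ.character (uu 1) := by
  have hq : (Fintype.card F : ℂ) ≠ 0 := by exact_mod_cast Fintype.card_ne_zero
  let e : Module.End ℂ V := (Fintype.card F : ℂ)⁻¹ • ∑ b : F, ρ (uu b)
  have hu : ∀ b, ρ (uu b) * e = e := by
    intro b
    simp only [e, mul_smul_comm, Finset.mul_sum, ← map_mul, ← uu_add]
    congr 1
    exact Equiv.sum_comp (Equiv.addLeft b) (fun x => ρ (uu x))
  have he : e * e = e := by
    change ((Fintype.card F : ℂ)⁻¹ • ∑ b : F, ρ (uu b)) * e = e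
    rw [smul_mul_assoc, Finset.sum_mul, Finset.sum_congr rfl fun b _ => hu b, Finset.sum_const,
      Finset.card_univ, ← Nat.cast_smul_eq_nsmul ℂ, smul_smul, inv_mul_cancel₀ hq, one_smul]
  have hc : ∀ a : Fˣ, ρ (tt a) * e = e * ρ (tt a) := by
    intro a
    simp only [e, mul_smul_comm, smul_mul_assoc, Finset.mul_sum, Finset.sum_mul, ← map_mul, tt_uu]
    congr 1
    exact Equiv.sum_comp (Equiv.mulLeft₀ ((a : F) ^ 2) (by simp)) (fun x => ρ (uu x * tt a))
  obtain ⟨σ, hσ⟩ := idem_rep (A := Fˣ) (ρ.comp tH) e he hc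
  have ht : ∀ a, σ.character a = (Fintype.card F : ℂ)⁻¹ * ∑ b : F, ρ.character (tt a * uu b) := by
    intro a
    rw [hσ]
    change LinearMap.trace ℂ V (ρ (tt a) * e) = _
    simp only [e, mul_smul_comm, Finset.mul_sum, map_smul, map_sum, smul_eq_mul, ← map_mul]
    rfl
  refine ⟨_, _, _, inferInstance, σ, ?_, ?_⟩
  · intro a ha
    rw [ht, Finset.sum_congr rfl (g := fun _ => ρ.character (tt a)), Finset.sum_const,
      Finset.card_univ, nsmul_eq_mul, inv_mul_cancel_left₀ hq]
    intro b _
    obtain ⟨k, hk⟩ := tt_uu_conj ha b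
    rw [hk, char_conj]
  · rw [← char_one σ, ht, mul_inv_cancel_left₀ hq,
      ← Finset.add_sum_erase _ _ (Finset.mem_univ (0 : F))]
    congr 1
    · rw [uu_zero, tt_one, mul_one, char_one]
    · rw [Finset.sum_congr rfl (g := fun _ => ρ.character (uu 1))]
      · rw [Finset.sum_const, Finset.card_erase_of_mem (Finset.mem_univ _), Finset.card_univ,
          nsmul_eq_mul, Nat.cast_sub Fintype.card_pos]; simp
      · intro b hb
        obtain ⟨k, hk⟩ := uu_conj (Finset.ne_of_mem_erase hb)
        rw [tt_one, one_mul, hk, char_conj]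

theorem card_SL' : (Fintype.card (SL F) : ℂ) =
    Fintype.card F * (Fintype.card F - 1) * (Fintype.card F + 1) := by
  rw [← Nat.card_eq_fintype_card, card_SL]; push_cast
  rw [Nat.cast_sub Fintype.card_pos]; simp

theorem nsq {G : Type} [Group G] [Finite G] (ρ : Representation ℂ G V) (g : G) :
    ρ.character g⁻¹ * ρ.character g = (Complex.normSq (ρ.character g) : ℂ) := by
  rw [char_conj', Complex.normSq_eq_conj_mul_self]

theorem units_sum (Ψ : Fˣ → ℂ) : ∑ a, Ψ a = Ψ 1 + ∑ a with a ≠ 1, Ψ a := by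
  rw [← Finset.sum_filter_add_sum_filter_not _ (fun a : Fˣ => a = 1)]
  rw [Finset.filter_eq', if_pos (Finset.mem_univ _), Finset.sum_singleton]

theorem irr_SL (ρ : Representation ℂ (SL F) V) (hρ : ρ.IsIrreducible) :
    ((Fintype.card F - 1) ∣ Module.finrank ℂ V ∧ ∀ a, a ≠ 1 → ρ.character (tt a) = 0) ∨
    ((Fintype.card F + 1) ∣ Module.finrank ℂ V ∧ ∀ g, NS g → ρ.character g = 0) ∨
    ((∃ r, ∀ a, a ≠ 1 → ρ.character (tt a) = r) ∧ ∃ r, ∀ g, NS g → ρ.character g = r) := by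
  obtain ⟨W, _, _, _, σ, hσ, hm⟩ := torus_rep ρ
  have hq1 : 1 < Fintype.card F := Fintype.one_lt_card
  have hq1' : (1 : ℝ) < Fintype.card F := by exact_mod_cast hq1
  set q : ℕ := Fintype.card F with hqd
  set d := Module.finrank ℂ V with hd
  set m := Module.finrank ℂ W with hmd
  set Q := Module.finrank ℂ (IntertwiningMap σ σ) with hQ
  set c : ℝ := (q * m - d) / (q - 1) with hc
  have hqc : (q - 1 : ℝ) ≠ 0 := by linarith
  have hqc' : (q - 1 : ℂ) ≠ 0 := by exact_mod_cast hqc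
  have hcu : ρ.character (uu 1) = (c : ℂ) := by
    rw [hc]; push_cast; rw [eq_div_iff hqc']; linear_combination -hm
  have hmc : (q : ℝ) * m = d + (q - 1) * c := by rw [hc]; field_simp; ring
  have hu1 : (uu (1 : F))⁻¹ = uu 1 := by
    rw [inv_eq_iff_mul_eq_one, ← uu_add, CharTwo.add_self_eq_zero, uu_zero]
  have hQs := orth σ σ
  rw [units_sum, inv_one, char_one, Nat.card_eq_fintype_card, Fintype.card_units,
    Nat.cast_sub hq1.le, Finset.sum_congr rfl (g := fun a =>
      ρ.character (tt a)⁻¹ * ρ.character (tt a)) (by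
    intro a ha
    have ha' := (Finset.mem_filter.1 ha).2
    rw [hσ a ha', hσ a⁻¹ (by simpa using ha')]
    congr 2
    exact map_inv tH a)] at hQs
  have hnorm0 := class_sum (fun g => ρ.character g⁻¹ * ρ.character g) (fun g h => by
    change ρ.character (h * g * h⁻¹)⁻¹ * ρ.character (h * g * h⁻¹) = _
    rw [show (h * g * h⁻¹)⁻¹ = h * g⁻¹ * h⁻¹ by group, char_conj, char_conj])
  have hor := orth ρ ρ
  rw [end_of_irr ρ hρ, Nat.card_eq_fintype_card, card_SL'] at hor
  have hN0 : ∑ g with NS g, ρ.character g⁻¹ * ρ.character g =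
      ((∑ g with NS g, Complex.normSq (ρ.character g) : ℝ) : ℂ) := by
    push_cast; exact Finset.sum_congr rfl fun g _ => nsq ρ g
  simp only [inv_one, char_one] at hnorm0
  set N : ℝ := ∑ g with NS g, Complex.normSq (ρ.character g) with hNdef
  have hNnn : 0 ≤ N := Finset.sum_nonneg fun g _ => Complex.normSq_nonneg _
  rw [hor, hN0, hu1, hcu] at hnorm0
  have hnorm : (q : ℝ) * (q - 1) * (m - 2 * c) ^ 2 + q * (q ^ 2 - 1) * Q + 2 * N =
      2 * q * (q ^ 2 - 1) := by
    have hdm : (d : ℂ) = q * m - (q - 1) * c := by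
      have : ((q : ℝ) * m : ℂ) = d + (q - 1) * c := by exact_mod_cast hmc
      push_cast at this; linear_combination -this
    have : (q : ℂ) * (q - 1) * (m - 2 * c) ^ 2 + q * (q ^ 2 - 1) * Q + 2 * N =
      2 * q * (q ^ 2 - 1) := by
      push_cast at hQs hnorm0
      rw [hdm] at hnorm0
      linear_combination -hnorm0 - q * (q + 1) * hQs
    exact_mod_cast this
  have hqq : (0 : ℝ) < q * (q ^ 2 - 1) := by nlinarith
  have hQ2 : Q ≤ 2 := by
    by_contra hcon
    have : (3 : ℝ) ≤ Q := by exact_mod_cast (not_le.1 hcon)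
    nlinarith [sq_nonneg ((m : ℝ) - 2 * c), mul_nonneg (show (0:ℝ) ≤ q * (q - 1) by nlinarith) (sq_nonneg ((m : ℝ) - 2 * c)), mul_le_mul_of_nonneg_left this hqq.le]
  have hcint : IsIntegral ℤ (c : ℂ) := hcu ▸ char_int ρ (uu 1)
  have hQ012 : Q = 0 ∨ Q = 2 ∨ Q = 1 := by omega
  rcases hQ012 with h | h | h
  · left
    have hm0 : m = 0 := by
      by_contra hm0
      have hnt : Nontrivial W := Module.finrank_pos_iff.1 (Nat.pos_of_ne_zero hm0)
      rw [Module.finrank_eq_zero_iff_of_free] at h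
      have h1 : IntertwiningMap.id σ = 0 := Subsingleton.elim _ _
      obtain ⟨w, hw⟩ := exists_ne (0 : W)
      apply hw
      have := congrArg (fun k : IntertwiningMap σ σ => k w) h1
      simpa using this
    have hW : Subsingleton W := Module.finrank_zero_iff.1 hm0
    refine ⟨?_, fun a ha => ?_⟩
    · refine int_of_rat (by omega) ?_
      have : (d : ℂ) / ((q - 1 : ℕ) : ℂ) = -(c : ℂ) := by
        rw [Nat.cast_sub hq1.le, hc, hm0]; push_cast; ring
      rw [this]; exact hcint.neg
    · rw [← hσ a ha]
      change LinearMap.trace ℂ W (σ a) = 0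
      rw [show σ a = 0 from LinearMap.ext fun w => Subsingleton.elim _ _, map_zero]
  · right; left
    rw [h] at hnorm
    push_cast at hnorm
    have hA : 0 ≤ (q : ℝ) * (q - 1) * (m - 2 * c) ^ 2 :=
      mul_nonneg (by nlinarith) (sq_nonneg _)
    have hN1 : N = 0 := by linarith
    have hm2 : (m - 2 * c) ^ 2 = 0 := by
      have : (q : ℝ) * (q - 1) * (m - 2 * c) ^ 2 = 0 := by linarith
      rcases mul_eq_zero.1 this with h | h
      · exfalso; nlinarith
      · exact h
    have hm2' : (m : ℝ) = 2 * c := by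
      have := pow_eq_zero_iff (two_ne_zero) |>.1 hm2; linarith
    refine ⟨?_, fun g hg => ?_⟩
    · refine int_of_rat (by omega) ?_
      have : (d : ℂ) / ((q + 1 : ℕ) : ℂ) = (c : ℂ) := by
        have hz : ((q + 1 : ℕ) : ℂ) ≠ 0 := by exact_mod_cast (Nat.succ_ne_zero q)
        rw [div_eq_iff hz]
        have : (d : ℝ) = c * (q + 1) := by rw [hm2'] at hmc; linarith
        have : (d : ℂ) = c * (q + 1) := by exact_mod_cast this
        rw [this]; push_cast; ring
      rw [this]; exact hcint
    · have := (Finset.sum_eq_zero_iff_of_nonneg (fun g _ => Complex.normSq_nonneg _)).1 hN1 g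
        (Finset.mem_filter.2 ⟨Finset.mem_univ _, hg⟩)
      exact Complex.normSq_eq_zero.1 this
  · right; right
    have hirr := irr_of_end σ h
    have hsc : ∀ a, ∃ r : ℂ, σ a = r • (1 : Module.End ℂ W) := fun a =>
      schur σ hirr (σ a) (fun b => by rw [← map_mul, ← map_mul, mul_comm])
    have hm1 : m = 1 := by
      have hn := (irr_iff σ).1 hirr
      have := hn.1
      obtain ⟨w, hw⟩ := exists_ne (0 : W)
      rcases hn.2 (Submodule.span ℂ {w}) (by
        intro a u hu
        obtain ⟨r, hr⟩ := hsc a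
        rw [hr]; exact Submodule.smul_mem _ _ hu) with h | h
      · exact absurd (Submodule.span_singleton_eq_bot.1 h) hw
      · rw [hmd, ← finrank_top ℂ W, ← h, finrank_span_singleton hw]
    have hmul : ∀ a b, σ.character (a * b) = σ.character a * σ.character b := by
      intro a b
      obtain ⟨r, hr⟩ := hsc a
      obtain ⟨s, hs⟩ := hsc b
      change LinearMap.trace ℂ W (σ (a * b)) = LinearMap.trace ℂ W (σ a) * LinearMap.trace ℂ W (σ b)
      have ht1 : LinearMap.trace ℂ W 1 = 1 := by
        rw [LinearMap.trace_one, ← hmd, hm1, Nat.cast_one]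
      rw [map_mul, hr, hs, smul_mul_smul_comm, mul_one]
      simp only [map_smul, ht1, smul_eq_mul, mul_one]
    have hσ1 : σ.character 1 = 1 := by rw [char_one, ← hmd, hm1]; simp
    have hone : ∀ a, a ≠ 1 → ρ.character (tt a) = 1 := by
      intro a ha
      have h1 : σ.character a⁻¹ = σ.character a := by
        rw [hσ a ha, hσ a⁻¹ (by simpa using ha), tt_inv_conj, char_conj]
      have h2 : σ.character a ^ 2 = 1 := by
        have := hmul a⁻¹ a
        rw [inv_mul_cancel, h1, hσ1] at this
        rw [this]; ring
      have h3 : ∀ n, σ.character (a ^ n) = σ.character a ^ n := by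
        intro n
        induction n with
        | zero => simp [hσ1]
        | succ n ih => rw [pow_succ, hmul, ih, pow_succ]
      have h4 : σ.character a ^ (q - 1) = 1 := by
        rw [← h3, hqd, ← Fintype.card_units, pow_card_eq_one, hσ1]
      obtain ⟨f, hf, hf0⟩ := card_F_pow (F := F)
      obtain ⟨j, hj⟩ : 2 ∣ q := by rw [hqd, hf]; exact dvd_pow_self 2 hf0.ne'
      rw [← hσ a ha]
      have h5 : q - 1 = 2 * (j - 1) + 1 := by omega
      rw [h5, pow_succ, pow_mul, h2, one_pow, one_mul] at h4
      exact h4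
    refine ⟨⟨1, hone⟩, ?_⟩
    by_cases htriv : ∀ x, ρ x = 1
    · refine ⟨d, fun g _ => ?_⟩
      change LinearMap.trace ℂ V (ρ g) = _
      rw [htriv, LinearMap.trace_one]
    push Not at htriv
    obtain ⟨x, hx⟩ := htriv
    have hsum0 : ∑ g, ρ.character g = 0 := by
      obtain ⟨r, hr⟩ := schur ρ hρ (∑ g, (1 : ℂ) • ρ g) (fun y => class_comm ρ _ y fun g => rfl)
      have h1 : ρ x * ∑ g, (1 : ℂ) • ρ g = ∑ g, (1 : ℂ) • ρ g := by
        simp only [one_smul, Finset.mul_sum, ← map_mul]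
        exact Equiv.sum_comp (Equiv.mulLeft x) (fun g => ρ g)
      rw [hr] at h1
      have h2 : r = 0 := by
        by_contra h0
        apply hx
        rw [mul_smul_comm, mul_one] at h1
        exact smul_right_injective _ h0 h1
      have h3 := congrArg (LinearMap.trace ℂ V) hr
      rw [h2, zero_smul, map_zero, map_sum] at h3
      simp only [one_smul] at h3
      exact h3
    have hs1 := class_sum ρ.character (fun g h => char_conj ρ g h)
    have hs2 := class_sum (F := F) (fun _ => (1 : ℂ)) (fun _ _ => rfl)
    have hcu1 : ∑ a : Fˣ with a ≠ 1, (1 : ℂ) = q - 2 := by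
      have := units_sum (F := F) fun _ => (1 : ℂ)
      rw [Finset.sum_const, Finset.card_univ, Fintype.card_units, nsmul_eq_mul,
        Nat.cast_sub hq1.le] at this
      push_cast at this
      linear_combination -this
    rw [hcu1] at hs2
    rw [hsum0, hcu, char_one, Finset.sum_congr rfl (g := fun _ => (1 : ℂ)) (fun a ha =>
      hone a (Finset.mem_filter.1 ha).2), hcu1] at hs1
    rw [Finset.sum_const, Finset.card_univ, nsmul_eq_mul, card_SL'] at hs2
    set M1 : ℂ := ∑ g with NS g, ρ.character g with hM1
    set K : ℂ := ∑ g : SL F with NS g, (1 : ℂ) with hK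
    have hre : M1.re = ∑ g with NS g, (ρ.character g).re := Complex.re_sum _ _
    have hKre : K.re = ∑ g : SL F with NS g, (1 : ℝ) := by rw [hK, Complex.re_sum]; simp
    have hs1' : (0 : ℝ) = 2 * d + 2 * (q ^ 2 - 1) * c + q * (q + 1) * (q - 2) + 2 * M1.re := by
      have := congrArg Complex.re hs1
      have e : (2 * (d : ℂ) + 2 * ((q : ℂ) ^ 2 - 1) * c + q * (q + 1) * (q - 2) + 2 * M1) =
        ((2 * d + 2 * (q ^ 2 - 1) * c + q * (q + 1) * (q - 2) : ℝ) : ℂ) + 2 * M1 := by push_cast; ring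
      have e3 : (2 * M1).re = 2 * M1.re := by simp
      rw [e, Complex.add_re, Complex.ofReal_re, e3, mul_zero, Complex.zero_re] at this
      exact this
    have hs2' : 2 * ((q : ℝ) * (q - 1) * (q + 1)) = 2 + 2 * (q ^ 2 - 1) + q * (q + 1) * (q - 2)
        + 2 * K.re := by
      have := congrArg Complex.re hs2
      have e : (2 * (1 : ℂ) + 2 * ((q : ℂ) ^ 2 - 1) * 1 + q * (q + 1) * (q - 2) + 2 * K) =
        ((2 + 2 * (q ^ 2 - 1) + q * (q + 1) * (q - 2) : ℝ) : ℂ) + 2 * K := by push_cast; ring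
      have e2 : (2 * ((q : ℂ) * (q - 1) * (q + 1) * 1)) = ((2 * ((q : ℝ) * (q - 1) * (q + 1)) : ℝ) : ℂ) := by
        push_cast; ring
      have e3 : (2 * K).re = 2 * K.re := by simp
      rw [e, e2, Complex.add_re, Complex.ofReal_re, Complex.ofReal_re, e3] at this
      exact this
    have hfin : ∑ g with NS g, Complex.normSq (ρ.character g + 1) = -2 * q * (q - 1) * c ^ 2 := by
      have e : ∀ g, Complex.normSq (ρ.character g + 1) = Complex.normSq (ρ.character g) +
          2 * (ρ.character g).re + 1 := by
        intro g; simp only [Complex.normSq_apply, Complex.add_re, Complex.add_im, Complex.one_re,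
          Complex.one_im]; ring
      rw [Finset.sum_congr rfl fun g _ => e g, Finset.sum_add_distrib, Finset.sum_add_distrib,
        ← Finset.mul_sum, ← hre, ← hKre, ← hNdef]
      rw [h, hm1] at hnorm
      rw [hm1] at hmc
      push_cast at hnorm hmc
      linear_combination hnorm / 2 - hs1' - hs2' / 2 + 2 * hmc
    have hnn := Finset.sum_nonneg (s := Finset.univ.filter fun g : SL F => NS g)
      (fun g _ => Complex.normSq_nonneg (ρ.character g + 1))
    have hz : ∑ g with NS g, Complex.normSq (ρ.character g + 1) = 0 := by
      refine le_antisymm ?_ hnn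
      rw [hfin]
      have : 0 ≤ (q : ℝ) * (q - 1) * c ^ 2 := mul_nonneg (by nlinarith) (sq_nonneg _)
      linarith
    refine ⟨-1, fun g hg => ?_⟩
    have := (Finset.sum_eq_zero_iff_of_nonneg (fun g _ => Complex.normSq_nonneg _)).1 hz g
        (Finset.mem_filter.2 ⟨Finset.mem_univ _, hg⟩)
    exact eq_neg_of_add_eq_zero_left (Complex.normSq_eq_zero.1 this)
end sums
end CD
end

noncomputable section
namespace CD
open scoped Classical
open Representation

theorem sep {G : Type} [Group G] [Finite G] (g g' : G)
    (h : ∀ (V : Type) [AddCommGroup V] [Module ℂ V] [FiniteDimensional ℂ V]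
      (ρ : Representation ℂ G V), ρ.IsIrreducible → ρ.character g = ρ.character g') :
    ∃ s, s * g' * s⁻¹ = g := by
  have := Fintype.ofFinite G
  let n : G → G → ℂ := fun g x => ∑ s : G, if s * g * s⁻¹ = x then 1 else 0
  have hn : ∀ g x y, n g (y * x * y⁻¹) = n g x := by
    intro g x y
    simp only [n]
    rw [← Equiv.sum_comp (Equiv.mulLeft y)]
    refine Finset.sum_congr rfl fun s _ => ?_
    congr 1
    simp only [Equiv.coe_mulLeft, mul_inv_rev, eq_iff_iff]
    constructor
    · intro h
      have : y * (s * g * s⁻¹) * y⁻¹ = y * x * y⁻¹ := by rw [← h]; group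
      simpa using this
    · rintro rfl; group
  have ht : ∀ (V : Type) [AddCommGroup V] [Module ℂ V] [FiniteDimensional ℂ V]
      (ρ : Representation ℂ G V) (g : G),
      ∑ x, n g x * ρ.character x = Fintype.card G * ρ.character g := by
    intro V _ _ _ ρ g
    simp only [n, Finset.sum_mul, ite_mul, one_mul, zero_mul]
    rw [Finset.sum_comm]
    simp [char_conj]
  have h0 : el (fun x => n g x - n g' x) = 0 := by
    apply killed
    intro V _ _ _ ρ hρ
    rw [asAlg_el]
    obtain ⟨r, hr⟩ := schur ρ hρ (∑ x, (n g x - n g' x) • ρ x)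
      (fun y => class_comm ρ _ y fun x => by simp only [hn])
    have h1 := congrArg (LinearMap.trace ℂ V) hr
    simp only [map_sum, map_smul, LinearMap.trace_one, smul_eq_mul, sub_mul,
      Finset.sum_sub_distrib] at h1
    have h2 := ht V ρ g
    have h3 := ht V ρ g'
    simp only [Representation.character] at h2 h3
    have h4 := h V ρ hρ
    simp only [Representation.character] at h4
    rw [h2, h3, h4, sub_self] at h1
    have hd : (Module.finrank ℂ V : ℂ) ≠ 0 := by exact_mod_cast (irr_fin_pos hρ).ne'
    rw [hr, (mul_eq_zero.1 h1.symm).resolve_right hd, zero_smul]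
  have h1 := el_inj h0 g
  by_contra hc
  push Not at hc
  have h2 : n g' g = 0 := Finset.sum_eq_zero fun s _ => if_neg (hc s)
  have h3 : n g g ≠ 0 := by
    simp only [n, Finset.sum_boole]
    simp only [ne_eq, Nat.cast_eq_zero, Finset.card_eq_zero]
    exact Finset.ne_empty_of_mem (a := 1) (by simp)
  rw [h2, sub_zero] at h1
  exact h3 h1

section sums
variable {F : Type} [Field F] [Fintype F] [CharP F 2]

theorem sep_split {a b : Fˣ} (ha : a ≠ 1) (hb : b ≠ 1)
    (h : ∀ (V : Type) [AddCommGroup V] [Module ℂ V] [FiniteDimensional ℂ V]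
      (ρ : Representation ℂ (SL F) V), ρ.IsIrreducible → (Fintype.card F + 1) ∣ Module.finrank ℂ V →
      ρ.character (tt a) = ρ.character (tt b)) : ∃ s : SL F, s * tt b * s⁻¹ = tt a := by
  refine sep _ _ fun V _ _ _ ρ hρ => ?_
  rcases irr_SL ρ hρ with ⟨-, h1⟩ | ⟨h1, -⟩ | ⟨⟨r, h1⟩, -⟩
  · rw [h1 a ha, h1 b hb]
  · exact h V ρ hρ h1
  · rw [h1 a ha, h1 b hb]

theorem sep_ns {g g' : SL F} (ha : NS g) (hb : NS g')
    (h : ∀ (V : Type) [AddCommGroup V] [Module ℂ V] [FiniteDimensional ℂ V]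
      (ρ : Representation ℂ (SL F) V), ρ.IsIrreducible → (Fintype.card F - 1) ∣ Module.finrank ℂ V →
      ρ.character g = ρ.character g') : ∃ s : SL F, s * g' * s⁻¹ = g := by
  refine sep _ _ fun V _ _ _ ρ hρ => ?_
  rcases irr_SL ρ hρ with ⟨h1, -⟩ | ⟨-, h1⟩ | ⟨-, ⟨r, h1⟩⟩
  · exact h V ρ hρ h1
  · rw [h1 _ ha, h1 _ hb]
  · rw [h1 _ ha, h1 _ hb]

theorem coprime_pm : Nat.Coprime (Fintype.card F * (Fintype.card F - 1)) (Fintype.card F + 1) := by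
  obtain ⟨f, hf, hf0⟩ := card_F_pow (F := F)
  obtain ⟨k, hk⟩ : 2 ∣ Fintype.card F := by rw [hf]; exact dvd_pow_self 2 hf0.ne'
  have h1 : 1 < Fintype.card F := Fintype.one_lt_card
  refine Nat.Coprime.mul_left (by simp) ?_
  have : Fintype.card F + 1 = (Fintype.card F - 1) + 2 := by omega
  rw [this, Nat.coprime_self_add_right, Nat.coprime_two_right]
  exact ⟨k - 1, by omega⟩

theorem fix_order {g : SL F} {x : Om F} (hx : g • x = x) :
    orderOf g ∣ Fintype.card F * (Fintype.card F - 1) := by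
  obtain ⟨k, b, -, rfl⟩ := fix_conj hx
  have h1 := orderOf_dvd_natCard b
  rw [card_BB] at h1
  refine dvd_trans ?_ h1
  rw [← MulAut.conj_apply, ← Subgroup.orderOf_coe b]
  exact orderOf_map_dvd (MulAut.conj k).toMonoidHom _

theorem NS_of_order {g : SL F} (h1 : g ≠ 1) (hg : orderOf g ∣ Fintype.card F + 1) : NS g := by
  intro x hx
  have := Nat.dvd_gcd (fix_order hx) hg
  rw [Nat.coprime_iff_gcd_eq_one.1 coprime_pm] at this
  exact h1 (orderOf_eq_one_iff.1 (Nat.dvd_one.1 this))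

theorem not_conj_sq {g s : SL F} (h0 : tr g ≠ 0) (h3 : ¬ orderOf g ∣ 3) :
    s * (g * g) * s⁻¹ ≠ g := by
  intro h
  have h1 := congrArg tr h
  rw [tr_conj, tr_sq] at h1
  have h2 : tr g = 1 := by
    have : tr g * (tr g - 1) = 0 := by linear_combination h1
    rcases mul_eq_zero.1 this with h | h
    · exact absurd h h0
    · linear_combination h
  apply h3
  apply orderOf_dvd_of_pow_eq_one
  rw [← cube_one h2, pow_succ, pow_two]

theorem exists_V_minus (hq : 4 < Fintype.card F) :
    ∃ (V : Type) (_ : AddCommGroup V) (_ : Module ℂ V) (_ : FiniteDimensional ℂ V)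
      (ρ : Representation ℂ (SL F) V), ρ.IsIrreducible ∧
      (Fintype.card F - 1) ∣ Module.finrank ℂ V := by
  by_contra hc
  push Not at hc
  obtain ⟨g, hg⟩ := exists_ns F
  have h3 : ¬ orderOf g ∣ 3 := fun h => by
    have := Nat.le_of_dvd (by norm_num) h; omega
  have h1 : g ≠ 1 := fun h => by simp [h] at h3
  have hn : NS g := NS_of_order h1 (by rw [hg])
  obtain ⟨s, hs⟩ := sep_ns hn (g' := g * g) (NS_of_order
    (fun h => (NS_tr hn) ((sq_one_iff g).1 h))
    (by rw [← hg, ← pow_two]; exact orderOf_pow_dvd 2)) (fun V _ _ _ ρ hρ h => absurd h (hc V _ _ ‹_› ρ hρ))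
  exact not_conj_sq (NS_tr hn) h3 hs

theorem exists_V_plus (hq : 4 < Fintype.card F) :
    ∃ (V : Type) (_ : AddCommGroup V) (_ : Module ℂ V) (_ : FiniteDimensional ℂ V)
      (ρ : Representation ℂ (SL F) V), ρ.IsIrreducible ∧
      (Fintype.card F + 1) ∣ Module.finrank ℂ V := by
  by_contra hc
  push Not at hc
  obtain ⟨a, ha⟩ := exists_sp F
  have ho : orderOf (tt a : SL F) = orderOf a := orderOf_injective tH tH_inj a
  obtain ⟨f, hf, hf0⟩ := card_F_pow (F := F)
  obtain ⟨k, hk⟩ : 2 ∣ Fintype.card F := by rw [hf]; exact dvd_pow_self 2 hf0.ne'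
  have h3 : ¬ orderOf (tt a : SL F) ∣ 3 := fun h => by
    have := Nat.le_of_dvd (by norm_num) h; omega
  have h1 : a ≠ 1 := fun h => by simp [h, tt_one] at h3
  have htr : tr (tt a) ≠ 0 := fun h => h1 ((tr_tt a).1 h)
  obtain ⟨s, hs⟩ := sep_split h1 (b := a * a) (fun h => htr ((sq_one_iff _).1 (by
    rw [← tt_mul, h, tt_one]))) (fun V _ _ _ ρ hρ h => absurd h (hc V _ _ ‹_› ρ hρ))
  rw [tt_mul] at hs
  exact not_conj_sq htr h3 hs
end sums
end CD
end

noncomputable section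
namespace CD
open scoped Classical
open Representation

section dickson
variable {F : Type} [Field F] [Fintype F] [CharP F 2]

theorem gen_top (H : Subgroup (SL F)) (hU : UU F ≤ H) {h : SL F} (hh : h ∈ H)
    (hm : h • pinf F ≠ pinf F) : H = ⊤ := by
  obtain ⟨b, hb⟩ := bruhat hm
  let g := (uu b)⁻¹ * h
  have hg : g ∈ H := H.mul_mem (H.inv_mem (hU (uu_mem b))) hh
  have hgp : g • pinf F = p0 F := by rw [mul_smul, ← hb, inv_smul_smul]
  have h1 : ((ww : SL F)⁻¹ * g) 1 0 = 0 := by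
    rw [← smul_pinf, mul_smul, hgp, p0, inv_smul_smul]
  have hl : ∀ c : F, ww * uu c * ww⁻¹ ∈ H := by
    intro c
    have h2 : (ww⁻¹ * g)⁻¹ * uu c * (ww⁻¹ * g) ∈ UU F := by
      have hB : (ww⁻¹ * g)⁻¹ * uu c * (ww⁻¹ * g) ∈ BB F :=
        (BB F).mul_mem ((BB F).mul_mem ((BB F).inv_mem h1) (UU_le_BB (uu_mem c))) h1
      have := tr_BB ⟨_, hB⟩
      refine this.1 ?_
      change tr ((ww⁻¹ * g)⁻¹ * uu c * (ww⁻¹ * g)) = 0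
      rw [tr_comm, ← mul_assoc, mul_inv_cancel, one_mul]
      simp [tr, uu, mk00, mk11, CharTwo.add_self_eq_zero]
    have h3 : ww * uu c * ww⁻¹ = g * ((ww⁻¹ * g)⁻¹ * uu c * (ww⁻¹ * g)) * g⁻¹ := by group
    rw [h3]
    exact H.mul_mem (H.mul_mem hg (hU h2)) (H.inv_mem hg)
  have hn : ∀ k : SL F, k 1 0 ≠ 0 → k ∈ H := by
    intro k hk
    have : k = uu ((k 0 0 + 1) / k 1 0) * (ww * uu (k 1 0) * ww⁻¹) * uu ((k 1 1 + 1) / k 1 0) := by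
      have hd := sl_det k
      have h2 := two0 (F := F)
      apply sl_ext <;> simp [sl_mul, uu, ww, mk00, mk01, mk10, mk11, inv00, inv01, inv10, inv11] <;>
        field_simp
      · linear_combination (-1 : F) * h2
      · linear_combination hd - (k 0 0 + k 1 1 + 1 + k 0 0 * k 1 1) * h2
      · linear_combination (-1 : F) * h2
    rw [this]
    exact H.mul_mem (H.mul_mem (hU (uu_mem _)) (hl _)) (hU (uu_mem _))
  rw [eq_top_iff]
  intro k _
  by_cases hk : k 1 0 = 0
  · have hw : (ww : SL F) ∈ H := hn _ (by simp [ww, mk10])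
    have : k * ww ∈ H := hn _ (by
      have hd := sl_det k
      rw [hk] at hd
      simp only [sl_mul, ww, mk00, mk10, hk]
      intro h0
      simp at h0
      rw [h0] at hd; simp at hd)
    simpa using H.mul_mem this (H.inv_mem hw)
  · exact hn k hk

theorem gen_top' (H : Subgroup (SL F)) {x : Om F} (hx : (x : Subgroup (SL F)) ≤ H) {h : SL F}
    (hh : h ∈ H) (hm : h • x ≠ x) : H = ⊤ := by
  obtain ⟨k, rfl⟩ := om_trans x
  have := gen_top (H.comap (MulAut.conj k).toMonoidHom) (by
    intro u hu
    apply hx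
    rw [Sylow.coe_subgroup_smul, coe_pinf]
    exact ⟨u, hu, rfl⟩) (h := k⁻¹ * h * k) (by
      change k * (k⁻¹ * h * k) * k⁻¹ ∈ H
      simpa [mul_assoc] using hh) (by
      intro e
      apply hm
      rw [mul_smul, mul_smul, inv_smul_eq_iff] at e
      exact e)
  rw [eq_top_iff]
  intro g _
  have h2 : k⁻¹ * g * k ∈ H.comap (MulAut.conj k).toMonoidHom := by rw [this]; trivial
  change k * (k⁻¹ * g * k) * k⁻¹ ∈ H at h2
  simpa [mul_assoc] using h2

theorem sylow_of_odd (H : Subgroup (SL F)) (hn : ¬ 2 ∣ H.index) :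
    ∃ x : Om F, (x : Subgroup (SL F)) ≤ H := by
  have : Fact (Nat.Prime 2) := ⟨Nat.prime_two⟩
  let P : Sylow 2 H := default
  have hc : Nat.card ((P : Subgroup H).map H.subtype) = 2 ^ (Nat.card (SL F)).factorization 2 := by
    rw [← Subgroup.card_mul_index H, Nat.factorization_mul Nat.card_pos.ne' Subgroup.index_ne_zero_of_finite,
      Finsupp.add_apply, Nat.factorization_eq_zero_of_not_dvd hn, add_zero,
      Subgroup.card_map_of_injective H.subtype_injective, P.card_eq_multiplicity]
  refine ⟨Sylow.ofCard _ hc, ?_⟩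
  rw [Sylow.coe_ofCard]
  exact Subgroup.map_subtype_le _

/-- centralizer of g inside H -/
def CH (H : Subgroup (SL F)) (g : SL F) : Subgroup (SL F) := H ⊓ Subgroup.centralizer {g}

theorem mem_CH {H : Subgroup (SL F)} {g h : SL F} : h ∈ CH H g ↔ h ∈ H ∧ h * g = g * h := by
  rw [CH, Subgroup.mem_inf, Subgroup.mem_centralizer_singleton_iff]

theorem CH_eq {H : Subgroup (SL F)} {g e : SL F} (hg : g ≠ 1) (he : e ∈ CH H g) (h1 : e ≠ 1) :
    CH H e = CH H g := by
  have h2 := (mem_CH.1 he).2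
  ext h
  rw [mem_CH, mem_CH]
  refine and_congr_right fun _ => ⟨fun h => ?_, fun h => ?_⟩
  · exact cent_comm h1 h h2.symm
  · exact cent_comm hg h h2

theorem tr_ne_one {g : SL F} (h : tr g ≠ 0) : g ≠ 1 := fun h1 => h (by rw [h1, tr_one])

theorem CH_ge {H : Subgroup (SL F)} {g : SL F} (hg : g ∈ H) (h : tr g ≠ 0) :
    3 ≤ Nat.card (CH H g) := by
  have h1 := tr_ne_one h
  have h2 : g⁻¹ ≠ g := fun e => h ((sq_one_iff g).1 (by nth_rewrite 1 [← e]; simp))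
  have hs : ({1, g, g⁻¹} : Finset (SL F)) ⊆ (CH H g : Set (SL F)).toFinset := by
    intro x hx
    simp only [Finset.mem_insert, Finset.mem_singleton] at hx
    rw [Set.mem_toFinset, SetLike.mem_coe, mem_CH]
    rcases hx with rfl | rfl | rfl
    · exact ⟨H.one_mem, by simp⟩
    · exact ⟨hg, rfl⟩
    · exact ⟨H.inv_mem hg, by simp⟩
  have h3 := Finset.card_le_card hs
  rw [Finset.card_insert_of_notMem (by simp [h1.symm, Ne.symm (inv_ne_one.2 h1)]),
    Finset.card_pair h2.symm, Set.toFinset_card] at h3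
  rw [Nat.card_eq_fintype_card]; exact h3

/-- elements of H conjugate into the centralizer of g -/
def XX (H : Subgroup (SL F)) (g : SL F) : Finset (SL F) :=
  Finset.univ.filter fun k => ∃ h ∈ H, ∃ e ∈ CH H g, e ≠ 1 ∧ k = h * e * h⁻¹

theorem mem_XX {H : Subgroup (SL F)} {g k : SL F} : k ∈ XX H g ↔
    ∃ h ∈ H, ∃ e ∈ CH H g, e ≠ 1 ∧ k = h * e * h⁻¹ := by simp [XX]

theorem coset_card (H : Subgroup (SL F)) (e k : SL F) :
    (Finset.univ.filter fun h : SL F => h ∈ H ∧ h * e * h⁻¹ = k).card ≤ Nat.card (CH H e) := by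
  rcases Finset.eq_empty_or_nonempty (Finset.univ.filter fun h : SL F => h ∈ H ∧ h * e * h⁻¹ = k)
    with h0 | ⟨h0, hh0⟩
  · rw [h0]; simp
  · rw [Finset.mem_filter] at hh0
    obtain ⟨-, hH, hk⟩ := hh0
    have : Nat.card (CH H e) = (CH H e : Set (SL F)).toFinset.card := by
      rw [Set.toFinset_card, Nat.card_eq_fintype_card]; rfl
    rw [this]
    refine Finset.card_le_card_of_injOn (fun h => h0⁻¹ * h) ?_ (fun a _ b _ h => mul_left_cancel h)
    intro h hh
    rw [Finset.mem_coe, Finset.mem_filter] at hh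
    obtain ⟨-, hH', hk'⟩ := hh
    rw [Finset.mem_coe, Set.mem_toFinset, SetLike.mem_coe, mem_CH]
    refine ⟨H.mul_mem (H.inv_mem hH) hH', ?_⟩
    rw [← hk] at hk'
    have h5 : h * e = h0 * e * h0⁻¹ * h := mul_inv_eq_iff_eq_mul.1 hk'
    rw [mul_assoc, h5]; group

theorem XX_card {H : Subgroup (SL F)} {g : SL F} (hg : tr g ≠ 0) :
    Nat.card H * (Nat.card (CH H g) - 1) ≤ 2 * Nat.card (CH H g) * (XX H g).card := by
  have hc : ∀ K : Subgroup (SL F), Nat.card K = (K : Set (SL F)).toFinset.card := fun K => by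
      rw [Set.toFinset_card, Nat.card_eq_fintype_card]; rfl
  have h0 : Nat.card H * (Nat.card (CH H g) - 1) =
      ((H : Set (SL F)).toFinset ×ˢ ((CH H g : Set (SL F)).toFinset.erase 1)).card := by
    rw [Finset.card_product, Finset.card_erase_of_mem (by simp [(CH H g).one_mem]), ← hc, ← hc]
  rw [h0, mul_comm]
  rw [mul_comm (Finset.card _)]
  refine Finset.card_le_mul_card_image_of_maps_to (f := fun p : SL F × SL F => p.1 * p.2 * p.1⁻¹)
    (fun p hp => ?_) _ (fun k hk => ?_)
  · simp only [Finset.mem_product, Set.mem_toFinset, SetLike.mem_coe, Finset.mem_erase] at hp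
    exact mem_XX.2 ⟨_, hp.1, _, hp.2.2, hp.2.1, rfl⟩
  · obtain ⟨h, hh, e, he, e1, rfl⟩ := mem_XX.1 hk
    have key : ∀ e' : SL F, e' ∈ CH H g → e' ≠ 1 →
      (Finset.univ.filter fun h' : SL F => h' ∈ H ∧ h' * e' * h'⁻¹ = h * e * h⁻¹).card
        ≤ Nat.card (CH H g) := fun e' h1 h2 => by
      rw [← CH_eq (tr_ne_one hg) h1 h2]; exact coset_card _ _ _
    have k1 := key e he e1
    have k2 := key e⁻¹ ((CH H g).inv_mem he) (inv_ne_one.2 e1)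
    have et : tr e ≠ 0 := tr_ne_of_comm hg e1 (mem_CH.1 he).2
    refine le_trans (Finset.card_le_card (t := 
      ((Finset.univ.filter fun h' : SL F => h' ∈ H ∧ h' * e * h'⁻¹ = h * e * h⁻¹).image fun h' => (h', e))
      ∪ ((Finset.univ.filter fun h' : SL F => h' ∈ H ∧ h' * e⁻¹ * h'⁻¹ = h * e * h⁻¹).image
        fun h' => (h', e⁻¹))) ?_) ?_
    · rintro ⟨h', e'⟩ hp
      simp only [Finset.mem_filter, Finset.mem_product, Set.mem_toFinset, SetLike.mem_coe,
        Finset.mem_erase] at hp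
      obtain ⟨⟨hH, e1', he'⟩, hq⟩ := hp
      have ht : tr e' = tr e := by rw [← tr_conj e' h', hq, tr_conj]
      rcases fusion (cent_comm (tr_ne_one hg) (mem_CH.1 he').2 (mem_CH.1 he).2) ht et with rfl | rfl
      · simp [hH, hq]
      · simp only [Finset.mem_union, Finset.mem_image, Finset.mem_filter]
        exact Or.inr ⟨h', ⟨Finset.mem_univ _, hH, hq⟩, rfl⟩
    · refine (Finset.card_union_le _ _).trans ?_
      have := Finset.card_image_le (f := fun h' => (h', e)) (s :=
        Finset.univ.filter fun h' : SL F => h' ∈ H ∧ h' * e * h'⁻¹ = h * e * h⁻¹)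
      have := Finset.card_image_le (f := fun h' => (h', e⁻¹)) (s :=
        Finset.univ.filter fun h' : SL F => h' ∈ H ∧ h' * e⁻¹ * h'⁻¹ = h * e * h⁻¹)
      omega

theorem XX_card3 {H : Subgroup (SL F)} {g : SL F} (hH : g ∈ H) (hg : tr g ≠ 0) :
    Nat.card H ≤ 3 * (XX H g).card := by
  have h1 := XX_card (H := H) hg
  have h2 := CH_ge hH hg
  obtain ⟨c, hc⟩ := Nat.exists_eq_add_of_le h2
  rw [hc, show 3 + c - 1 = 2 + c by omega] at h1
  by_contra hlt
  push Not at hlt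
  nlinarith [Nat.zero_le (c * Nat.card H), Nat.zero_le (c * (XX H g).card)]

theorem XX_split {H : Subgroup (SL F)} {g k : SL F} (hg : g ≠ 1) (hk : k ∈ XX H g) :
    (NS g → NS k) ∧ ((∃ x : Om F, g • x = x) → ∃ x : Om F, k • x = x) := by
  obtain ⟨h, hh, e, he, e1, rfl⟩ := mem_XX.1 hk
  have hc := (mem_CH.1 he).2
  constructor
  · intro hn x hx
    rw [conj_fix] at hx
    exact hn _ (fix_of_comm e1 hc.symm hx)
  · rintro ⟨x, hx⟩
    exact ⟨h • x, by rw [conj_fix, inv_smul_smul]; exact fix_of_comm hg hc hx⟩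

theorem XX_meet {H : Subgroup (SL F)} {g g' : SL F} (hg : g ≠ 1) (hg' : g' ≠ 1)
    (h : ¬ Disjoint (XX H g) (XX H g')) : Nat.card (CH H g) = Nat.card (CH H g') := by
  rw [Finset.not_disjoint_iff] at h
  obtain ⟨k, h1, h2⟩ := h
  obtain ⟨h, hh, e, he, e1, rfl⟩ := mem_XX.1 h1
  obtain ⟨h', hh', e', he', e1', hk⟩ := mem_XX.1 h2
  rw [← CH_eq hg he e1, ← CH_eq hg' he' e1']
  have key : ∀ (a b c : SL F), a ∈ H → a * b * a⁻¹ = c → Nat.card (CH H b) ≤ Nat.card (CH H c) := by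
    intro a b c ha hb
    refine Nat.card_le_card_of_injective (fun x => (⟨a * x * a⁻¹, mem_CH.2 ⟨H.mul_mem (H.mul_mem ha
      (mem_CH.1 x.2).1) (H.inv_mem ha), ?_⟩⟩ : CH H c)) ?_
    · rw [← hb]
      have := (mem_CH.1 x.2).2
      calc a * x * a⁻¹ * (a * b * a⁻¹) = a * (x * b) * a⁻¹ := by group
        _ = a * (b * x) * a⁻¹ := by rw [this]
        _ = _ := by group
    · intro x y hxy
      have := congrArg Subtype.val hxy
      simpa using this
  have e3 : (h'⁻¹ * h) * e * (h'⁻¹ * h)⁻¹ = e' := by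
    calc _ = h'⁻¹ * (h * e * h⁻¹) * h' := by group
      _ = _ := by rw [hk]; group
  have hm : h'⁻¹ * h ∈ H := H.mul_mem (H.inv_mem hh') hh
  refine le_antisymm (key _ _ _ hm e3) (key (h'⁻¹ * h)⁻¹ _ _ (H.inv_mem hm) ?_)
  rw [← e3]; group

theorem EQ {H : Subgroup (SL F)} {g g' r : SL F} (hg : g ∈ H) (hg' : g' ∈ H) (hr : r ∈ H)
    (tg : tr g ≠ 0) (tg' : tr g' ≠ 0) (t : tr r ≠ 0)
    (h : (NS g ∧ NS g' ∧ ∃ x : Om F, r • x = x) ∨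
      ((∃ x : Om F, g • x = x) ∧ (∃ x : Om F, g' • x = x) ∧ NS r)) :
    Nat.card (CH H g) = Nat.card (CH H g') := by
  by_contra hne
  have d1 : Disjoint (XX H g) (XX H g') := by
    by_contra hd; exact hne (XX_meet (tr_ne_one tg) (tr_ne_one tg') hd)
  have d2 : Disjoint (XX H g ∪ XX H g') (XX H r) := by
    rw [Finset.disjoint_left]
    intro k hk hk'
    rw [Finset.mem_union] at hk
    have hr := XX_split (tr_ne_one t) hk'
    rcases h with ⟨h1, h2, h3⟩ | ⟨h1, h2, h3⟩ <;> rcases hk with hk | hk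
    · obtain ⟨x, hx⟩ := hr.2 h3; exact (XX_split (tr_ne_one tg) hk).1 h1 x hx
    · obtain ⟨x, hx⟩ := hr.2 h3; exact (XX_split (tr_ne_one tg') hk).1 h2 x hx
    · obtain ⟨x, hx⟩ := (XX_split (tr_ne_one tg) hk).2 h1; exact hr.1 h3 x hx
    · obtain ⟨x, hx⟩ := (XX_split (tr_ne_one tg') hk).2 h2; exact hr.1 h3 x hx
  have hs : XX H g ∪ XX H g' ∪ XX H r ⊆ (H : Set (SL F)).toFinset.erase 1 := by
    have : ∀ g, XX H g ⊆ (H : Set (SL F)).toFinset.erase 1 := by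
      intro g k hk
      obtain ⟨h, hh, e, he, e1, rfl⟩ := mem_XX.1 hk
      rw [Finset.mem_erase, Set.mem_toFinset]
      exact ⟨sl_conj_ne e1, H.mul_mem (H.mul_mem hh (mem_CH.1 he).1) (H.inv_mem hh)⟩
    exact Finset.union_subset (Finset.union_subset (this _) (this _)) (this _)
  have hc := Finset.card_le_card hs
  rw [Finset.card_union_of_disjoint d2, Finset.card_union_of_disjoint d1,
    Finset.card_erase_of_mem (by simp [H.one_mem])] at hc
  have h0 : Nat.card H = (H : Set (SL F)).toFinset.card := by
    rw [Set.toFinset_card, Nat.card_eq_fintype_card]; rfl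
  have := XX_card3 hg tg
  have := XX_card3 hg' tg'
  have := XX_card3 hr t
  have : 0 < Nat.card H := Nat.card_pos
  omega

end dickson
end CD
end

noncomputable section
namespace CD
open scoped Classical
open Representation

section dickson2
variable {F : Type} [Field F] [Fintype F] [CharP F 2]

theorem lemP (H : Subgroup (SL F)) {s k : ℕ} (hs : s.Prime) (hk : 0 < k) (hi : ¬ s ∣ H.index)
    (hd : s ^ k ∣ Nat.card (SL F)) : ∃ z ∈ H, z ≠ 1 ∧ orderOf z ∣ s ^ k ∧ s ^ k ∣ Nat.card (CH H z) := by
  have : Fact s.Prime := ⟨hs⟩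
  rw [← Subgroup.card_mul_index H] at hd
  have h1 := (Nat.Coprime.pow_left k ((Nat.Prime.coprime_iff_not_dvd hs).2 hi)).dvd_of_dvd_mul_right hd
  obtain ⟨Q, hQ⟩ := Sylow.exists_subgroup_card_pow_prime s h1
  have hp : IsPGroup s Q := IsPGroup.of_card hQ
  have : Nontrivial Q := Finite.one_lt_card_iff_nontrivial.1 (by
    rw [hQ]; exact Nat.one_lt_pow hk.ne' hs.one_lt)
  have := hp.center_nontrivial
  obtain ⟨⟨z, hz⟩, hz1⟩ := exists_ne (1 : Subgroup.center Q)
  refine ⟨((z : H) : SL F), (z : H).2, fun e => hz1 (Subtype.ext (Subtype.ext (Subtype.ext e))), ?_, ?_⟩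
  · rw [Subgroup.orderOf_coe, Subgroup.orderOf_coe, ← hQ]; exact orderOf_dvd_natCard z
  · rw [← hQ, ← Subgroup.card_map_of_injective H.subtype_injective]
    apply Subgroup.card_dvd_of_le
    rintro _ ⟨y, hy, rfl⟩
    refine mem_CH.2 ⟨y.2, ?_⟩
    have := Subgroup.mem_center_iff.1 hz ⟨y, hy⟩
    exact congrArg (fun a : Q => ((a : H) : SL F)) this

theorem card_NS_dvd {H : Subgroup (SL F)} {g : SL F} (hg : NS g) :
    Nat.card (CH H g) ∣ Fintype.card F + 1 := by
  have hst : ∀ x : Om F, MulAction.stabilizer (CH H g) x = ⊥ := by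
    intro x
    rw [eq_bot_iff]
    intro c hc
    by_contra h1
    have h1 : (c : SL F) ≠ 1 := fun e => h1 (Subtype.ext e)
    exact hg x (fix_of_comm h1 (mem_CH.1 c.2).2.symm hc)
  rw [← card_Om, Nat.card_congr (MulAction.selfEquivOrbitsQuotientProd hst), Nat.card_prod]
  exact dvd_mul_left _ _

theorem comm_tt {a : Fˣ} (ha : a ≠ 1) {h : SL F} (hc : h * tt a = tt a * h) : h ∈ TT F := by
  have h1 : tt a ≠ 1 := tr_ne_one (fun h => ha ((tr_tt a).1 h))
  exact mem_TT.2 ⟨smul_pinf.1 (fix_of_comm h1 hc (tt_smul_inf a)),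
    smul_p0.1 (fix_of_comm h1 hc (tt_smul_p0 a))⟩

theorem map_CH_le (H : Subgroup (SL F)) (k : SL F) {a : Fˣ} (ha : a ≠ 1) :
    (CH H (k * tt a * k⁻¹)).map (MulAut.conj k⁻¹).toMonoidHom ≤ TT F := by
  rintro _ ⟨h, hh, rfl⟩
  refine comm_tt ha ?_
  have := (mem_CH.1 hh).2
  change k⁻¹ * h * k⁻¹⁻¹ * tt a = tt a * (k⁻¹ * h * k⁻¹⁻¹)
  calc _ = k⁻¹ * (h * (k * tt a * k⁻¹)) * k := by group
    _ = _ := by rw [this]; group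

theorem card_split_dvd {H : Subgroup (SL F)} {g : SL F} (hg : tr g ≠ 0) {x : Om F} (hx : g • x = x) :
    Nat.card (CH H g) ∣ Fintype.card F - 1 := by
  obtain ⟨k, a, rfl, ha⟩ := split_conj hg hx
  rw [← card_TT, ← Subgroup.card_map_of_injective (f := (MulAut.conj k⁻¹).toMonoidHom)
    (MulAut.conj k⁻¹).injective]
  exact Subgroup.card_dvd_of_le (map_CH_le H k ha)

theorem cop1 {s : ℕ} (hs : s.Prime) (h1 : s ∣ Fintype.card F - 1) (h2 : s ∣ Fintype.card F + 1) :
    False :=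
  hs.one_lt.ne' (Nat.eq_one_of_dvd_coprimes coprime_pm (h1.mul_left _) h2)

theorem cop2 {s : ℕ} (hs : s.Prime) (h1 : s ∣ Fintype.card F - 1) : ¬ s ∣ Fintype.card F := by
  intro h2
  have h3 := (Nat.dvd_add_right h1).1 (show s ∣ Fintype.card F - 1 + 1 by
    rwa [Nat.sub_add_cancel Fintype.card_pos])
  exact hs.one_lt.ne' (Nat.dvd_one.1 h3)

theorem two_dvd_q : 2 ∣ Fintype.card F := by
  obtain ⟨f, hf, hf0⟩ := card_F_pow (F := F)
  rw [hf]; exact dvd_pow_self 2 hf0.ne'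

theorem lemP_ns (H : Subgroup (SL F)) {s k : ℕ} (hs : s.Prime) (hk : 0 < k) (hi : ¬ s ∣ H.index)
    (hd : s ^ k ∣ Fintype.card F + 1) : ∃ z ∈ H, NS z ∧ s ^ k ∣ Nat.card (CH H z) := by
  obtain ⟨z, h1, h2, h3, h4⟩ := lemP H hs hk hi (by rw [card_SL]; exact hd.mul_left _)
  exact ⟨z, h1, NS_of_order h2 (h3.trans hd), h4⟩

theorem lemP_sp (H : Subgroup (SL F)) {s k : ℕ} (hs : s.Prime) (hk : 0 < k) (hi : ¬ s ∣ H.index)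
    (hd : s ^ k ∣ Fintype.card F - 1) : ∃ z ∈ H, tr z ≠ 0 ∧ (∃ x : Om F, z • x = x) ∧
      s ^ k ∣ Nat.card (CH H z) := by
  obtain ⟨z, h1, h2, h3, h4⟩ := lemP H hs hk hi (by
    rw [card_SL]; exact (hd.mul_left _).mul_right _)
  have hsd : s ∣ Fintype.card F - 1 := (dvd_pow_self s hk.ne').trans hd
  refine ⟨z, h1, ?_, ?_, h4⟩
  · intro h0
    have h5 : orderOf z ∣ 2 := orderOf_dvd_of_pow_eq_one (by rw [pow_two]; exact (sq_one_iff z).2 h0)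
    have h6 : orderOf z = 1 := by
      rcases (Nat.dvd_prime Nat.prime_two).1 h5 with h | h
      · exact h
      · rw [h] at h3
        have := (Nat.prime_dvd_prime_iff_eq Nat.prime_two hs).1 (Nat.prime_two.dvd_of_dvd_pow h3)
        exact (cop2 hs hsd (this ▸ two_dvd_q)).elim
    exact h2 (orderOf_eq_one_iff.1 h6)
  · by_contra hn
    push Not at hn
    exact cop1 hs hsd (((dvd_pow_self s hk.ne').trans h4).trans (card_NS_dvd hn))

theorem CH_full_ns (H : Subgroup (SL F)) (hp : ∀ s : ℕ, s.Prime → s ∣ Fintype.card F + 1 → ¬ s ∣ H.index)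
    {r : SL F} (hr : r ∈ H) (tr0 : tr r ≠ 0) (hx : ∃ x : Om F, r • x = x) :
    ∃ z ∈ H, NS z ∧ Nat.card (CH H z) = Fintype.card F + 1 := by
  obtain ⟨s0, hs0, hd0⟩ := Nat.exists_prime_and_dvd (n := Fintype.card F + 1)
    (by have := Fintype.card_pos (α := F); omega)
  obtain ⟨z, hz, hn, -⟩ := lemP_ns H hs0 one_pos (hp _ hs0 hd0) (by simpa using hd0)
  refine ⟨z, hz, hn, Nat.dvd_antisymm (card_NS_dvd hn) ?_⟩
  rw [Nat.dvd_iff_prime_pow_dvd_dvd]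
  intro s k hs hd
  rcases Nat.eq_zero_or_pos k with rfl | hk
  · simp
  obtain ⟨z', hz', hn', h'⟩ := lemP_ns H hs hk (hp _ hs ((dvd_pow_self s hk.ne').trans hd)) hd
  rwa [EQ hz hz' hr (NS_tr hn) (NS_tr hn') tr0 (Or.inl ⟨hn, hn', hx⟩)]

theorem CH_full_sp (hq : 2 < Fintype.card F) (H : Subgroup (SL F))
    (hp : ∀ s : ℕ, s.Prime → s ∣ Fintype.card F - 1 → ¬ s ∣ H.index)
    {r : SL F} (hr : r ∈ H) (hn : NS r) :
    ∃ z ∈ H, tr z ≠ 0 ∧ (∃ x : Om F, z • x = x) ∧ Nat.card (CH H z) = Fintype.card F - 1 := by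
  obtain ⟨s0, hs0, hd0⟩ := Nat.exists_prime_and_dvd (n := Fintype.card F - 1) (by omega)
  obtain ⟨z, hz, ht, hx, -⟩ := lemP_sp H hs0 one_pos (hp _ hs0 hd0) (by simpa using hd0)
  refine ⟨z, hz, ht, hx, Nat.dvd_antisymm (card_split_dvd ht hx.choose_spec) ?_⟩
  rw [Nat.dvd_iff_prime_pow_dvd_dvd]
  intro s k hs hd
  rcases Nat.eq_zero_or_pos k with rfl | hk
  · simp
  obtain ⟨z', hz', ht', hx', h'⟩ := lemP_sp H hs hk (hp _ hs ((dvd_pow_self s hk.ne').trans hd)) hd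
  rwa [EQ hz hz' hr ht ht' (NS_tr hn) (Or.inr ⟨hx, hx', hn⟩)]

theorem fix_comm_tr {g h : SL F} {x : Om F} (hg : g • x = x) (hh : h • x = x) :
    tr (g * h * (h * g)⁻¹) = 0 := by
  obtain ⟨k, b, rfl, rfl⟩ := fix_conj hg
  obtain ⟨c, hc⟩ : ∃ c : BB F, h = k * c * k⁻¹ := by
    refine ⟨⟨k⁻¹ * h * k, ?_⟩, by group⟩
    rw [mem_BB, ← smul_pinf, mul_smul, mul_smul, hh, inv_smul_smul]
  have : k * b * k⁻¹ * h * (h * (k * b * k⁻¹))⁻¹ = k * ((b * c * (c * b)⁻¹ : BB F) : SL F) * k⁻¹ := by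
    rw [hc]; push_cast; group
  rw [this, tr_conj, tr_BB, ← dg_ker]
  simp [mul_comm (dg b)]

theorem swap {H : Subgroup (SL F)} (hT : ∀ x y : Om F, ∃ h ∈ H, h • x = y)
    (hno : ∀ h ∈ H, tr h = 0 → h = 1) {r : SL F} (hr : r ∈ H) (ht : tr r ≠ 0) {x : Om F}
    (hx : r • x = x) : False := by
  obtain ⟨y, hy, hry⟩ := tr_ne_second ht hx
  obtain ⟨h, hh, hxy⟩ := hT x y
  have hr1 := tr_ne_one ht
  have h1 : (h * r * h⁻¹) • y = y := by rw [conj_fix, ← hxy, inv_smul_smul]; exact hx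
  have hm : h * r * h⁻¹ ∈ H := H.mul_mem (H.mul_mem hh hr) (H.inv_mem hh)
  have h2 := hno _ (H.mul_mem (H.mul_mem hm hr) (H.inv_mem (H.mul_mem hr hm))) (fix_comm_tr h1 hry)
  rw [mul_inv_eq_one] at h2
  have h3 := fix_of_comm hr1 h2 hx
  rw [conj_fix] at h3
  have h4 : h⁻¹ • x = y := by
    by_contra h5
    have h6 : h⁻¹ • x ≠ x := fun e => by
      rw [inv_smul_eq_iff, hxy] at e; exact hy e.symm
    exact hr1 (three_fix hy.symm (Ne.symm h6) (Ne.symm h5) hx hry h3)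
  rw [inv_smul_eq_iff] at h4
  have h5 : (h ^ 2) • x = x := by rw [pow_two, mul_smul, hxy, ← h4]
  have ho : 2 ∣ orderOf h := by
    by_contra h6
    obtain ⟨m, hm⟩ : Odd (orderOf h) := by rwa [← Nat.not_even_iff_odd, even_iff_two_dvd]
    have h7 : h * (h ^ 2) ^ m = 1 := by rw [← pow_mul, ← pow_succ', ← hm, pow_orderOf_eq_one]
    have h8 : (h ^ 2) ^ m • x = x :=
      (MulAction.stabilizer (SL F) x).pow_mem (MulAction.mem_stabilizer_iff.2 h5) m
    have h9 : (h * (h ^ 2) ^ m) • x = x := by rw [h7, one_smul]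
    rw [mul_smul, h8, hxy] at h9
    exact hy h9
  obtain ⟨m, hm⟩ := ho
  have hpos := orderOf_pos h
  have h10 := hno (h ^ m) (H.pow_mem hh m) ((sq_one_iff _).1 (by
    rw [← pow_two, ← pow_mul, mul_comm, ← hm, pow_orderOf_eq_one]))
  have := Nat.le_of_dvd (by omega) (orderOf_dvd_of_pow_eq_one h10)
  omega

theorem hno_of {H : Subgroup (SL F)} (hT : ∀ x y : Om F, ∃ h ∈ H, h • x = y)
    (hb : H ⊓ UU F = ⊥) : ∀ h ∈ H, tr h = 0 → h = 1 := by
  intro h hh ht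
  obtain ⟨x, hx⟩ := tr_zero_fix ht
  obtain ⟨k, hk, rfl⟩ := hT (pinf F) x
  have h1 : k⁻¹ * h * k ∈ BB F := by
    rw [mem_BB, ← smul_pinf, mul_smul, mul_smul, hx, inv_smul_smul]
  have h2 : tr (k⁻¹ * h * k) = 0 := by
    have := tr_conj h k⁻¹
    rw [inv_inv] at this; rw [this, ht]
  have h3 : k⁻¹ * h * k ∈ H ⊓ UU F := ⟨H.mul_mem (H.mul_mem (H.inv_mem hk) hh) hk,
    (tr_BB ⟨_, h1⟩).1 h2⟩
  rw [hb, Subgroup.mem_bot] at h3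
  by_contra h4
  exact sl_conj_ne (k := k⁻¹) h4 (by rw [inv_inv]; exact h3)

/-- diagonal part of H at infinity -/
def dH (H : Subgroup (SL F)) : ↥(H ⊓ BB F) →* Fˣ := dg.comp (Subgroup.inclusion inf_le_right)

theorem d_le (H : Subgroup (SL F)) (hb : H ⊓ UU F ≠ ⊥) :
    Nat.card (dH H).range + 1 ≤ Nat.card ↥(H ⊓ UU F) := by
  obtain ⟨⟨u, hu⟩, hu1⟩ := Subgroup.ne_bot_iff_exists_ne_one.1 hb
  obtain ⟨c, hc⟩ := mem_UU' hu.2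
  have hc0 : c ≠ 0 := fun e => hu1 (Subtype.ext (by change u = 1; rw [hc, e, uu_zero]))
  have hk : ∀ k : SL F, k ∈ H ⊓ BB F → uu (k 0 0 ^ 2 * c) ∈ H ⊓ UU F := by
    intro k hk
    have : uu (k 0 0 ^ 2 * c) = k * uu c * k⁻¹ := by
      have hd := sl_det k
      have h2 := two0 (F := F)
      have h0 : k 1 0 = 0 := hk.2
      rw [h0] at hd
      apply sl_ext <;> simp [sl_mul, uu, mk00, mk01, mk10, mk11, inv00, inv01, inv10, inv11, h0] <;>
        first | linear_combination (-1 : F) * hd | linear_combination (-k 0 0 * k 0 1) * h2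
    refine ⟨?_, uu_mem _⟩
    rw [this, ← hc]
    exact H.mul_mem (H.mul_mem hk.1 hu.1) (H.inv_mem hk.1)
  have : ∀ o : Option (dH H).range, ∃ v : ↥(H ⊓ UU F), (v : SL F) =
      uu (match o with | none => 0 | some a => ((a : Fˣ) : F) ^ 2 * c) := by
    rintro (_ | ⟨_, k, rfl⟩)
    · exact ⟨1, by simp [uu_zero]⟩
    · exact ⟨⟨_, hk k k.2⟩, rfl⟩
  choose φ hφ using this
  have hinj : Function.Injective φ := by
    intro o o' h
    have h1 := congrArg (fun g : SL F => g 0 1) ((hφ o).symm.trans ((congrArg _ h).trans (hφ o')))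
    rcases o with _ | a <;> rcases o' with _ | a'
    · rfl
    · simp [uu, mk01, hc0] at h1
    · simp [uu, mk01, hc0] at h1
    · simp only [uu, mk01] at h1
      have := CharTwo.sq_injective (mul_right_cancel₀ hc0 h1)
      rw [Subtype.ext (Units.ext this)]
  have h3 := Nat.card_le_card_of_injective φ hinj
  rwa [Finite.card_option] at h3

theorem card_HB (H : Subgroup (SL F)) : Nat.card ↥(H ⊓ BB F) =
    Nat.card ↥(H ⊓ UU F) * Nat.card (dH H).range := by
  rw [← Subgroup.card_mul_index (dH H).ker, Subgroup.index_ker]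
  congr 1
  rw [← Subgroup.card_map_of_injective (H ⊓ BB F).subtype_injective]
  congr 2
  ext g
  simp only [Subgroup.mem_map, Subgroup.mem_inf]
  constructor
  · rintro ⟨x, hx, rfl⟩
    exact ⟨x.2.1, (dg_ker _).1 hx⟩
  · rintro ⟨h1, h2⟩
    exact ⟨⟨g, h1, UU_le_BB h2⟩, (dg_ker _).2 h2, rfl⟩

theorem top_of_b {H : Subgroup (SL F)} (h : Fintype.card F ≤ Nat.card ↥(H ⊓ UU F)) : UU F ≤ H := by
  have : H ⊓ UU F = UU F := Subgroup.eq_of_le_of_card_ge inf_le_right (by rwa [card_UU])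
  exact inf_eq_right.1 this
end dickson2
end CD
end

noncomputable section
namespace CD
open scoped Classical
open Representation

section dickson3
variable {F : Type} [Field F] [Fintype F] [CharP F 2]

theorem DC {H : Subgroup (SL F)} (hT : ∀ x y : Om F, ∃ h ∈ H, h • x = y) (P : SL F → Prop)
    (hP : ∀ g h, P g → P (h * g * h⁻¹)) :
    ∑ g with g ∈ H ∧ P g, fx g = (Fintype.card F + 1) *
      (Finset.univ.filter fun g : SL F => g ∈ H ∧ P g ∧ g • pinf F = pinf F).card := by
  simp only [fx, Finset.card_filter]
  rw [Finset.sum_comm]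
  have : ∀ x : Om F, (∑ g : SL F with g ∈ H ∧ P g, if g • x = x then 1 else 0) =
      (Finset.univ.filter fun g : SL F => g ∈ H ∧ P g ∧ g • pinf F = pinf F).card := by
    intro x
    obtain ⟨k, hk, rfl⟩ := hT (pinf F) x
    rw [← Finset.sum_filter, Finset.filter_filter, Finset.sum_const, smul_eq_mul, mul_one]
    refine Finset.card_nbij' (fun g => k⁻¹ * g * k⁻¹⁻¹) (fun g => k * g * k⁻¹) ?_ ?_ ?_ ?_
    · intro g hg
      simp only [Finset.coe_filter, Finset.mem_univ, true_and, Set.mem_ofPred_eq] at hg ⊢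
      refine ⟨H.mul_mem (H.mul_mem (H.inv_mem hk) hg.1.1) (H.inv_mem (H.inv_mem hk)), hP _ _ hg.1.2, ?_⟩
      rw [conj_fix, inv_inv, hg.2]
    · intro g hg
      simp only [Finset.coe_filter, Finset.mem_univ, true_and, Set.mem_ofPred_eq] at hg ⊢
      refine ⟨⟨H.mul_mem (H.mul_mem hk hg.1) (H.inv_mem hk), hP _ _ hg.2.1⟩, ?_⟩
      rw [conj_fix, inv_smul_smul, hg.2.2]
    · intro g _; simp [mul_assoc]
    · intro g _; simp [mul_assoc]
  rw [Finset.sum_congr rfl fun x _ => this x, Finset.sum_const, smul_eq_mul, Finset.card_univ,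
    ← Nat.card_eq_fintype_card, card_Om, Finset.card_filter]

theorem card_filt (K : Subgroup (SL F)) : Nat.card K = (Finset.univ.filter fun g => g ∈ K).card := by
  rw [Nat.card_eq_fintype_card, Fintype.card_subtype]

theorem card_H {H : Subgroup (SL F)} (hT : ∀ x y : Om F, ∃ h ∈ H, h • x = y) :
    Nat.card H = (Fintype.card F + 1) * Nat.card ↥(H ⊓ BB F) := by
  have h1 := Finset.card_eq_sum_card_fiberwise (s := Finset.univ.filter fun g => g ∈ H)
    (t := (Finset.univ : Finset (Om F))) (f := fun g : SL F => g • pinf F) (fun _ _ => by simp)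
  rw [card_filt, h1, card_filt]
  have : ∀ x : Om F, ((Finset.univ.filter fun g => g ∈ H).filter fun g => g • pinf F = x).card =
      (Finset.univ.filter fun g : SL F => g ∈ H ⊓ BB F).card := by
    intro x
    obtain ⟨k, hk, rfl⟩ := hT (pinf F) x
    refine Finset.card_nbij' (fun g => k⁻¹ * g) (fun g => k * g) ?_ ?_ ?_ ?_
    · intro g hg
      simp only [Finset.coe_filter, Finset.mem_univ, true_and, Set.mem_ofPred_eq, Finset.mem_filter] at hg ⊢
      refine ⟨H.mul_mem (H.inv_mem hk) hg.1, smul_pinf.1 ?_⟩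
      rw [mul_smul, hg.2, inv_smul_smul]
    · intro g hg
      simp only [Finset.coe_filter, Finset.mem_univ, true_and, Set.mem_ofPred_eq, Finset.mem_filter] at hg ⊢
      exact ⟨H.mul_mem hk hg.1, by rw [mul_smul, smul_pinf.2 hg.2]⟩
    · intro g _; simp
    · intro g _; simp
  rw [Finset.sum_congr rfl fun x _ => this x, Finset.sum_const, smul_eq_mul, Finset.card_univ,
    ← Nat.card_eq_fintype_card, card_Om]

theorem count {H : Subgroup (SL F)} (hT : ∀ x y : Om F, ∃ h ∈ H, h • x = y) :
    (Fintype.card F + 1) * Nat.card ↥(H ⊓ UU F) +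
      2 * (Finset.univ.filter fun g : SL F => g ∈ H ∧ NS g).card = Nat.card H + 2 * Fintype.card F := by
  have d1 := DC hT (fun g => tr g = tr g) (fun _ _ _ => rfl)
  have d2 := DC hT (fun g => tr g = 0) (fun g h e => by rw [tr_conj, e])
  have e1 : (Finset.univ.filter fun g : SL F => g ∈ H ∧ tr g = tr g ∧ g • pinf F = pinf F).card =
      Nat.card ↥(H ⊓ BB F) := by
    rw [card_filt]; congr 1; ext g
    simp [smul_pinf, Subgroup.mem_inf, mem_BB]
  have e2 : (Finset.univ.filter fun g : SL F => g ∈ H ∧ tr g = 0 ∧ g • pinf F = pinf F).card =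
      Nat.card ↥(H ⊓ UU F) := by
    rw [card_filt]; congr 1; ext g
    simp only [Finset.mem_filter, Finset.mem_univ, true_and, Subgroup.mem_inf, smul_pinf]
    refine and_congr_right fun _ => ⟨fun h => (tr_BB ⟨g, h.2⟩).1 h.1, fun h => ?_⟩
    exact ⟨(tr_BB ⟨g, UU_le_BB h⟩).2 h, UU_le_BB h⟩
  rw [e1, ← card_H hT] at d1
  rw [e2] at d2
  rw [← d2]
  have hf1 : fx (1 : SL F) = Fintype.card F + 1 := by exact_mod_cast fx_one (F := F)
  have e3 : Nat.card H + Nat.card H = ∑ g : SL F with g ∈ H, (1 + 1) := by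
    rw [Finset.sum_const, ← card_filt]; simp; ring
  have e4 : ∑ g : SL F with g ∈ H ∧ tr g = tr g, fx g = ∑ g : SL F with g ∈ H, fx g := by simp
  rw [e4] at d1
  have e5 : ∑ g : SL F with g ∈ H, (fx g + (if tr g = 0 then fx g else 0) + (if NS g then 2 else 0)) =
     ∑ g : SL F with g ∈ H, (2 + if g = 1 then 2 * Fintype.card F else 0) := by
    refine Finset.sum_congr rfl fun g _ => ?_
    by_cases h1 : g = 1
    · subst h1
      have : ¬ NS (1 : SL F) := fun h => h (pinf F) (one_smul _ _)
      simp only [tr_one, this, if_true, if_false, hf1]; ring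
    · by_cases h0 : tr g = 0
      · have : ¬ NS g := fun h => NS_tr h h0
        simp [h0, h1, this, fx_inv h1 h0]
      · by_cases hn : NS g
        · simp [h0, h1, hn, fx_NS hn]
        · have : ∃ x : Om F, g • x = x := by
            by_contra h; exact hn fun x hx => h ⟨x, hx⟩
          simp [h0, h1, hn, fx_split h0 this.choose_spec]
  rw [Finset.sum_add_distrib, Finset.sum_add_distrib, Finset.sum_add_distrib, d1, ← Finset.sum_filter,
    ← Finset.sum_filter, Finset.filter_filter, Finset.filter_filter, Finset.sum_const, Finset.sum_const,
    ← card_filt, Finset.sum_ite_eq' ] at e5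
  simp only [Finset.mem_filter, Finset.mem_univ, true_and, H.one_mem, if_true, smul_eq_mul] at e5
  omega

theorem trans_of {H : Subgroup (SL F)} (h : ∀ x : Om F, ∃ h ∈ H, h • pinf F = x) :
    ∀ x y : Om F, ∃ h ∈ H, h • x = y := by
  intro x y
  obtain ⟨a, ha, rfl⟩ := h x
  obtain ⟨b, hb, rfl⟩ := h y
  exact ⟨b * a⁻¹, H.mul_mem hb (H.inv_mem ha), by rw [mul_smul, inv_smul_smul]⟩

theorem T1 (H : Subgroup (SL F)) (hp : ∀ s : ℕ, s.Prime → s ∣ Fintype.card F + 1 → ¬ s ∣ H.index)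
    {r : ℕ} (hr : r.Prime) (hrd : r ∣ Fintype.card F - 1) (hrn : ¬ r ∣ H.index) :
    ∃ x : Om F, (x : Subgroup (SL F)) ≤ H := by
  obtain ⟨w, hw, tw, ⟨x, hwx⟩, -⟩ := lemP_sp H hr one_pos hrn (by simpa using hrd)
  obtain ⟨z, hz, hn, hc⟩ := CH_full_ns H hp hw tw ⟨x, hwx⟩
  have hT : ∀ x y : Om F, ∃ h ∈ H, h • x = y := by
    intro x
    have hinj : Function.Injective (fun c : CH H z => (c : SL F) • x) := by
      intro c c' h
      by_contra hne
      have h1 : ((c' : SL F)⁻¹ * c) • x = x := by rw [mul_smul, inv_smul_eq_iff]; exact h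
      have hm : ((c' : SL F)⁻¹ * c) ∈ CH H z := (CH H z).mul_mem ((CH H z).inv_mem c'.2) c.2
      refine hn x (fix_of_comm (g := (c' : SL F)⁻¹ * (c : SL F)) ?_ (mem_CH.1 hm).2.symm h1)
      intro e
      exact hne (Subtype.ext (inv_mul_eq_one.1 e).symm)
    have hs := (Function.Injective.bijective_of_nat_card_le hinj (by rw [hc, card_Om])).2
    intro y
    obtain ⟨c, hcx⟩ := hs y
    exact ⟨c, (mem_CH.1 c.2).1, hcx⟩
  by_cases hb : H ⊓ UU F = ⊥
  · exact (swap hT (hno_of hT hb) hw tw hwx).elim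
  refine ⟨pinf F, ?_⟩
  rw [coe_pinf]
  apply top_of_b
  have hdl := d_le H hb
  have hcH := card_H hT
  rw [card_HB] at hcH
  have hct := count hT
  have hX : (XX H z).card ≤ (Finset.univ.filter fun g : SL F => g ∈ H ∧ NS g).card := by
    refine Finset.card_le_card fun k hk => ?_
    have h1 := (XX_split (tr_ne_one (NS_tr hn)) hk).1 hn
    obtain ⟨h, hh, e, he, -, rfl⟩ := mem_XX.1 hk
    simp only [Finset.mem_filter, Finset.mem_univ, true_and]
    exact ⟨H.mul_mem (H.mul_mem hh (mem_CH.1 he).1) (H.inv_mem hh), h1⟩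
  have hXc := XX_card (H := H) (NS_tr hn)
  rw [hc, Nat.add_sub_cancel] at hXc
  have hdd : Nat.card (dH H).range ∣ Fintype.card F - 1 := by
    have := Subgroup.card_subgroup_dvd_card (dH H).range
    rwa [Nat.card_units, Nat.card_eq_fintype_card (α := F)] at this
  have hrd2 : r ∣ Nat.card (dH H).range := by
    have h1 : r ∣ Nat.card H := by
      have := hrd.mul_left (Fintype.card F) |>.mul_right (Fintype.card F + 1)
      rw [← card_SL, ← Subgroup.card_mul_index H] at this
      exact (hr.dvd_mul.1 this).resolve_right hrn
    rw [hcH] at h1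
    rcases hr.dvd_mul.1 h1 with h | h
    · exact (cop1 hr hrd h).elim
    · refine (hr.dvd_mul.1 h).resolve_left fun h2 => cop2 hr hrd (h2.trans ?_)
      rw [← card_UU (F := F)]
      exact Subgroup.card_dvd_of_le inf_le_right
  have hr3 : 3 ≤ r := by
    have := hr.two_le
    have : r ≠ 2 := fun e => cop2 hr hrd (e ▸ two_dvd_q)
    omega
  have hd0 : 0 < Nat.card (dH H).range := Nat.card_pos
  have hd3 := hr3.trans (Nat.le_of_dvd hd0 hrd2)
  have hq1 : 1 < Fintype.card F := Fintype.one_lt_card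
  generalize Nat.card (dH H).range = d at *
  generalize Nat.card ↥(H ⊓ UU F) = b at *
  generalize hqq : Fintype.card F = q at *
  generalize (Finset.univ.filter fun g : SL F => g ∈ H ∧ NS g).card = N at *
  have h1 : b * d * q ≤ 2 * N := by
    rw [hcH] at hXc
    have : (q + 1) * (b * d * q) ≤ (q + 1) * (2 * (XX H z).card) := by nlinarith
    have := Nat.le_of_mul_le_mul_left this (by omega)
    omega
  have h2 : (q + 1) * b ≤ b * d + 2 * q := by
    rw [hcH] at hct; nlinarith
  obtain ⟨m, hm⟩ := hdd
  have hm0 : m ≠ 0 := by rintro rfl; omega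
  by_cases hm1 : m = 1
  · rw [hm1, mul_one] at hm; omega
  · exfalso
    have h5 : d * 2 ≤ q - 1 := by rw [hm]; exact Nat.mul_le_mul_left _ (by omega)
    have h6 : d * 2 + 1 ≤ q := by omega
    have h7 : 4 ≤ b := by omega
    nlinarith [Nat.mul_le_mul_left b h6, Nat.mul_le_mul_right q h7]

theorem T2 (hq : 2 < Fintype.card F) (H : Subgroup (SL F))
    (hp : ∀ s : ℕ, s.Prime → s ∣ Fintype.card F - 1 → ¬ s ∣ H.index)
    {r : ℕ} (hr : r.Prime) (hrd : r ∣ Fintype.card F + 1) (hrn : ¬ r ∣ H.index) :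
    ∃ x : Om F, (x : Subgroup (SL F)) ≤ H := by
  obtain ⟨w, hw, hwn, -⟩ := lemP_ns H hr one_pos hrn (by simpa using hrd)
  obtain ⟨z, hz, tz, ⟨x, hx⟩, hc⟩ := CH_full_sp hq H hp hw hwn
  obtain ⟨k, a, rfl, ha⟩ := split_conj tz hx
  let H' := H.comap (MulAut.conj k).toMonoidHom
  have hmem : ∀ g, g ∈ H' ↔ k * g * k⁻¹ ∈ H := fun g => Iff.rfl
  have hTT : TT F ≤ H' := by
    have h1 : (CH H (k * tt a * k⁻¹)).map (MulAut.conj k⁻¹).toMonoidHom = TT F :=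
      Subgroup.eq_of_le_of_card_ge (map_CH_le H k ha) (by
        rw [Subgroup.card_map_of_injective (MulAut.conj k⁻¹).injective, hc, card_TT])
    rw [← h1]
    rintro _ ⟨h, hh, rfl⟩
    rw [hmem]
    change k * (k⁻¹ * h * k⁻¹⁻¹) * k⁻¹ ∈ H
    simpa [mul_assoc] using (mem_CH.1 hh).1
  let v := k⁻¹ * w * k⁻¹⁻¹
  have hv : v ∈ H' := by rw [hmem]; simpa [v, mul_assoc] using hw
  have hvn : NS v := fun y hy => hwn _ (conj_fix.1 hy)
  have hT : ∀ x y : Om F, ∃ h ∈ H', h • x = y := by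
    apply trans_of
    have hrest : ∀ g ∈ H', g • pinf F ≠ pinf F → g • pinf F ≠ p0 F →
        ∀ x, x ≠ pinf F → x ≠ p0 F → ∃ h ∈ H', h • pinf F = x := by
      intro g hg h1 h2 x hx1 hx2
      obtain ⟨b, hb⟩ := bruhat h1
      obtain ⟨c, hc⟩ := bruhat hx1
      have hb0 : b ≠ 0 := by rintro rfl; rw [uu_zero, one_smul] at hb; exact h2 hb.symm
      have hc0 : c ≠ 0 := by rintro rfl; rw [uu_zero, one_smul] at hc; exact hx2 hc.symm
      obtain ⟨d, hd⟩ := tt_trans hb0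
      obtain ⟨e, he⟩ := tt_trans hc0
      refine ⟨tt e * (tt d)⁻¹ * g, H'.mul_mem (H'.mul_mem (hTT (tt_mem e)) (H'.inv_mem (hTT (tt_mem d)))) hg, ?_⟩
      rw [mul_smul, mul_smul, ← hb, ← hd, inv_smul_smul, he, hc]
    have h1 := hvn (pinf F)
    have hv2 : v • v • pinf F ≠ pinf F := by
      intro e
      rw [← mul_smul] at e
      have hvv : v * v ≠ 1 := fun h => NS_tr hvn ((sq_one_iff v).1 h)
      exact h1 (fix_of_comm hvv (by group) e)
    by_cases h2 : v • pinf F = p0 F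
    · have h3 := hvn (p0 F)
      rw [h2] at hv2
      have h4 := hrest (v * v) (H'.mul_mem hv hv) (by rwa [mul_smul, h2]) (by rwa [mul_smul, h2])
      intro x
      by_cases e1 : x = pinf F
      · exact ⟨1, H'.one_mem, by rw [one_smul, e1]⟩
      by_cases e2 : x = p0 F
      · exact ⟨v, hv, by rw [h2, e2]⟩
      exact h4 x e1 e2
    · have h4 := hrest v hv h1 h2
      intro x
      by_cases e1 : x = pinf F
      · exact ⟨1, H'.one_mem, by rw [one_smul, e1]⟩
      by_cases e2 : x = p0 F
      · have h5 : v⁻¹ • x ≠ x := fun h => hvn x (by rw [inv_smul_eq_iff] at h; exact h.symm)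
        have h6 : v⁻¹ • x ≠ pinf F := by
          intro h; rw [inv_smul_eq_iff, e2] at h; exact h2 h.symm
        obtain ⟨h, hh, h7⟩ := h4 _ h6 (by rw [← e2]; exact h5)
        exact ⟨v * h, H'.mul_mem hv hh, by rw [mul_smul, h7, smul_inv_smul]⟩
      exact h4 x e1 e2
  have hb : H' ⊓ UU F ≠ ⊥ := by
    intro hb
    refine swap hT (hno_of hT hb) (hTT (tt_mem a)) (fun h => ha ((tr_tt a).1 h)) (tt_smul_inf a)
  have hd := d_le H' hb
  have hdr : (dH H').range = ⊤ := by
    rw [eq_top_iff]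
    intro c _
    exact ⟨⟨tt c, hTT (tt_mem c), rfl⟩, Units.ext rfl⟩
  rw [hdr, Subgroup.card_top, Nat.card_units, Nat.card_eq_fintype_card (α := F)] at hd
  have hU : UU F ≤ H' := top_of_b (by omega)
  refine ⟨k • pinf F, ?_⟩
  rw [Sylow.coe_subgroup_smul, coe_pinf]
  rintro _ ⟨u, hu, rfl⟩
  exact hU hu

theorem dickson (H : Subgroup (SL F)) (hH : H ≠ ⊤) (hc : H.index.primeFactors.card ≤ 2)
    (h1 : 2 ≤ (Fintype.card F - 1).primeFactors.card)
    (h2 : 2 ≤ (Fintype.card F + 1).primeFactors.card) : ∃ x : Om F, ∀ h ∈ H, h • x = x := by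
  suffices ∃ x : Om F, (x : Subgroup (SL F)) ≤ H by
    obtain ⟨x, hx⟩ := this
    refine ⟨x, fun h hh => ?_⟩
    by_contra hm
    exact hH (gen_top' H hx hh hm)
  by_cases hn : 2 ∣ H.index
  swap
  · exact sylow_of_odd H hn
  have hi : H.index ≠ 0 := Subgroup.index_ne_zero_of_finite
  have hm2 : 2 ∈ H.index.primeFactors := Nat.mem_primeFactors.2 ⟨Nat.prime_two, hn, hi⟩
  have hq1 : 1 < Fintype.card F := Fintype.one_lt_card
  have h2q := two_dvd_q (F := F)
  have key : ∀ m : ℕ, m ≠ 0 → ¬ 2 ∣ m → 2 ≤ m.primeFactors.card →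
      ∃ s : ℕ, s.Prime ∧ s ∣ m ∧ ¬ s ∣ H.index := by
    intro m hm0 hm hc2
    by_contra hno
    push Not at hno
    have : m.primeFactors ⊆ H.index.primeFactors.erase 2 := by
      intro s hs
      obtain ⟨hs, hd, -⟩ := Nat.mem_primeFactors.1 hs
      exact Finset.mem_erase.2 ⟨fun e => hm (e ▸ hd), Nat.mem_primeFactors.2 ⟨hs, hno s hs hd, hi⟩⟩
    have := Finset.card_le_card this
    rw [Finset.card_erase_of_mem hm2] at this
    omega
  obtain ⟨r, hr, hrd, hrn⟩ := key _ (by omega) (by omega) h1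
  obtain ⟨s, hs, hsd, hsn⟩ := key _ (by omega) (by omega) h2
  by_cases hall : ∀ s : ℕ, s.Prime → s ∣ Fintype.card F + 1 → ¬ s ∣ H.index
  · exact T1 H hall hr hrd hrn
  · push Not at hall
    obtain ⟨t, ht, htd, htn⟩ := hall
    refine T2 ?_ H ?_ hs hsd hsn
    · by_contra h
      have : Fintype.card F - 1 = 1 := by omega
      rw [this] at h1; simp at h1
    · intro u hu hud hun
      have h3 : ({2, t, u} : Finset ℕ) ⊆ H.index.primeFactors := by
        intro y hy
        simp only [Finset.mem_insert, Finset.mem_singleton] at hy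
        rcases hy with rfl | rfl | rfl
        · exact hm2
        · exact Nat.mem_primeFactors.2 ⟨ht, htn, hi⟩
        · exact Nat.mem_primeFactors.2 ⟨hu, hun, hi⟩
      have h4 := Finset.card_le_card h3
      have e1 : 2 ≠ t := by rintro rfl; omega
      have e2 : 2 ≠ u := by rintro rfl; omega
      have e3 : t ≠ u := by rintro rfl; exact cop1 ht hud htd
      rw [Finset.card_insert_of_notMem (by simp [e1, e2]), Finset.card_pair e3] at h4
      omega
end dickson3
end CD
end

noncomputable section
namespace CD
open scoped Classical
open Representation

section autos
variable {F : Type} [Field F] [Fintype F] [CharP F 2]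

theorem aut_smul (φ : MulAut (SL F)) (g : SL F) (x : Om F) : φ • g • x = φ g • φ • x := by
  rw [Sylow.smul_def, Sylow.smul_def, ← mul_smul, ← mul_smul]
  congr 1
  ext1 h
  simp [MulAut.mul_apply, MulAut.conj_apply]

theorem u1_ne : uu (1 : F) • p0 F ≠ pinf F ∧ uu (1 : F) • p0 F ≠ p0 F := by
  constructor
  · exact fun h => p0_ne (smul_left_cancel (uu 1) (h.trans (uu_smul_inf 1).symm))
  · rw [Ne, smul_p0]; simp [uu, mk01]

theorem aut_triv {φ : MulAut (SL F)} (h : ∀ x : Om F, φ • x = x) : φ = 1 := by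
  ext1 g
  have h1 : ∀ x : Om F, (g⁻¹ * φ g) • x = x := by
    intro x
    rw [mul_smul, inv_smul_eq_iff]
    have := aut_smul φ g x
    rw [h, h] at this
    exact this.symm
  have := three_fix p0_ne.symm u1_ne.1.symm u1_ne.2.symm (h1 _) (h1 _) (h1 _)
  exact (inv_mul_eq_one.1 this).symm

theorem TT_rest {z z' : Om F} (h1 : z ≠ pinf F) (h2 : z ≠ p0 F) (h1' : z' ≠ pinf F) (h2' : z' ≠ p0 F) :
    ∃ a : Fˣ, tt a • z = z' := by
  obtain ⟨b, hb⟩ := bruhat h1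
  obtain ⟨c, hc⟩ := bruhat h1'
  have hb0 : b ≠ 0 := by rintro rfl; rw [uu_zero, one_smul] at hb; exact h2 hb.symm
  have hc0 : c ≠ 0 := by rintro rfl; rw [uu_zero, one_smul] at hc; exact h2' hc.symm
  obtain ⟨d, hd⟩ := tt_trans hb0
  obtain ⟨e, he⟩ := tt_trans hc0
  refine ⟨e * d⁻¹, ?_⟩
  have : tt (d⁻¹) = (tt d)⁻¹ := map_inv (tH (F := F)) d
  rw [tt_mul, this, mul_smul, ← hb, ← hd, inv_smul_smul, he, hc]

theorem aut_TT {φ : MulAut (SL F)} (h1 : φ • pinf F = pinf F) (h2 : φ • p0 F = p0 F) (a : Fˣ) :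
    ∃ b : Fˣ, φ (tt a) = tt b := by
  have e1 := aut_smul φ (tt a) (pinf F)
  have e2 := aut_smul φ (tt a) (p0 F)
  rw [tt_smul_inf, h1] at e1
  rw [tt_smul_p0, h2] at e2
  obtain ⟨b, hb⟩ := mem_TT.2 ⟨smul_pinf.1 e1.symm, smul_p0.1 e2.symm⟩
  exact ⟨b, hb.symm⟩

theorem tt_pow (a : Fˣ) (i : ℤ) : tt (a ^ i) = tt a ^ i := map_zpow (tH (F := F)) a i

theorem A0_comm {φ ψ : MulAut (SL F)} (h1 : φ • pinf F = pinf F) (h2 : φ • p0 F = p0 F)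
    (h3 : φ • uu (1 : F) • p0 F = uu (1 : F) • p0 F) (k1 : ψ • pinf F = pinf F)
    (k2 : ψ • p0 F = p0 F) (k3 : ψ • uu (1 : F) • p0 F = uu (1 : F) • p0 F) : φ * ψ = ψ * φ := by
  suffices (ψ * φ)⁻¹ * (φ * ψ) = 1 from (inv_mul_eq_one.1 this).symm
  apply aut_triv
  intro x
  rw [mul_smul, inv_smul_eq_iff]
  by_cases e1 : x = pinf F
  · rw [e1]; simp only [mul_smul, h1, k1]
  by_cases e2 : x = p0 F
  · rw [e2]; simp only [mul_smul, h2, k2]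
  obtain ⟨a, rfl⟩ := TT_rest u1_ne.1 u1_ne.2 e1 e2
  obtain ⟨τ, hτ⟩ := IsCyclic.exists_generator (α := Fˣ)
  obtain ⟨i, rfl⟩ := Subgroup.mem_zpowers_iff.1 (hτ a)
  obtain ⟨b, hb⟩ := aut_TT h1 h2 τ
  obtain ⟨c, hc⟩ := aut_TT k1 k2 τ
  obtain ⟨m, rfl⟩ := Subgroup.mem_zpowers_iff.1 (hτ b)
  obtain ⟨n, rfl⟩ := Subgroup.mem_zpowers_iff.1 (hτ c)
  have e3 : (φ * ψ) • uu (1 : F) • p0 F = uu (1 : F) • p0 F := by rw [mul_smul, k3, h3]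
  have e4 : (ψ * φ) • uu (1 : F) • p0 F = uu (1 : F) • p0 F := by rw [mul_smul, h3, k3]
  rw [aut_smul (φ * ψ), aut_smul (ψ * φ), e3, e4]
  congr 1
  simp only [MulAut.mul_apply, tt_pow, map_zpow, hb, hc, ← zpow_mul]
  congr 1; ring

theorem lemK {φ : MulAut (SL F)} {n : ℕ} (hn : φ ^ n = 1) (hc : n.Coprime (Nat.card (SL F))) {t : SL F}
    (ht : φ t = t) {z : Om F} (hz : φ • z = t • z) (hf : t ^ n • z = z → t ^ n = 1) : φ • z = z := by
  have h1 : ∀ k : ℕ, φ ^ k • z = t ^ k • z := by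
    intro k
    induction k with
    | zero => simp
    | succ k ih => rw [pow_succ', mul_smul, ih, aut_smul, map_pow, ht, hz, ← mul_smul, pow_succ]
  have h2 := hf (by rw [← h1, hn, one_smul])
  have h3 : orderOf t = 1 :=
    Nat.eq_one_of_dvd_coprimes hc (orderOf_dvd_of_pow_eq_one h2) (orderOf_dvd_natCard t)
  rw [hz, orderOf_eq_one_iff.1 h3, one_smul]

theorem fix_sp (hq : 4 < Fintype.card F) {ψ : MulAut (SL F)} {n : ℕ} (hn : (ψ ^ 2) ^ n = 1)
    (hc : n.Coprime (Nat.card (SL F))) {a : Fˣ} (ha : orderOf a = Fintype.card F - 1)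
    (hψ : ψ (tt a) = tt a) : ψ ^ 2 = 1 := by
  have hgen : ∀ c : Fˣ, c ∈ Subgroup.zpowers a := by
    intro c
    have : Subgroup.zpowers a = ⊤ := by
      apply Subgroup.eq_top_of_card_eq
      rw [Nat.card_zpowers, ha, Nat.card_units, Nat.card_eq_fintype_card]
    rw [this]; trivial
  have hall : ∀ c : Fˣ, ψ (tt c) = tt c := by
    intro c
    obtain ⟨i, rfl⟩ := Subgroup.mem_zpowers_iff.1 (hgen c)
    rw [tt_pow, map_zpow, hψ]
  have ha1 : a ≠ 1 := by rintro rfl; simp at ha; omega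
  have ht : tt a ≠ 1 := tr_ne_one (fun h => ha1 ((tr_tt a).1 h))
  have h2 : ∀ x : Om F, tt a • x = x → x = pinf F ∨ x = p0 F := by
    intro x hx
    by_contra hno
    push Not at hno
    exact ht (three_fix p0_ne.symm hno.1.symm hno.2.symm (tt_smul_inf a) (tt_smul_p0 a) hx)
  have h3 : ∀ x : Om F, tt a • x = x → tt a • ψ • x = ψ • x := fun x hx => by
    have := aut_smul ψ (tt a) x
    rw [hψ, hx] at this; exact this.symm
  have h4 := h2 _ (h3 _ (tt_smul_inf a))
  have h5 := h2 _ (h3 _ (tt_smul_p0 a))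
  have hne : ψ • pinf F ≠ ψ • p0 F := fun h => p0_ne (smul_left_cancel _ h).symm
  have h6 : ψ ^ 2 • pinf F = pinf F ∧ ψ ^ 2 • p0 F = p0 F := by
    rw [pow_two, mul_smul, mul_smul]
    rcases h4 with h4 | h4 <;> rcases h5 with h5 | h5
    · exact (hne (h4.trans h5.symm)).elim
    · rw [h4, h5]; exact ⟨h4, h5⟩
    · exact ⟨by rw [h4, h5], by rw [h5, h4]⟩
    · exact (hne (h4.trans h5.symm)).elim
  apply aut_triv
  intro x
  by_cases e1 : x = pinf F
  · rw [e1]; exact h6.1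
  by_cases e2 : x = p0 F
  · rw [e2]; exact h6.2
  obtain ⟨c, hc'⟩ := TT_rest e1 e2 (z' := ψ ^ 2 • x)
    (fun h => e1 (smul_left_cancel _ (h.trans h6.1.symm)))
    (fun h => e2 (smul_left_cancel _ (h.trans h6.2.symm)))
  have hp : tt c ^ n = tt (c ^ n) := (map_pow (tH (F := F)) c n).symm
  refine lemK hn hc (t := tt c) (by rw [pow_two, MulAut.mul_apply, hall, hall]) hc'.symm ?_
  rw [hp]
  exact fun h => three_fix p0_ne.symm (Ne.symm e1) (Ne.symm e2) (tt_smul_inf _) (tt_smul_p0 _) h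

theorem fix_ns {φ : MulAut (SL F)} {n : ℕ} (hn : φ ^ n = 1)
    (hc : n.Coprime (Nat.card (SL F))) {g : SL F} (hg : orderOf g = Fintype.card F + 1)
    (hφ : φ g = g) : φ = 1 := by
  have hNS : ∀ (i : ℤ) (x : Om F), g ^ i • x = x → g ^ i = 1 := by
    intro i x h
    by_contra h1
    refine NS_of_order h1 ?_ x h
    rw [← hg]; exact orderOf_dvd_of_mem_zpowers ⟨i, rfl⟩
  apply aut_triv
  intro x
  have hinj : Function.Injective (fun c : Subgroup.zpowers g => (c : SL F) • x) := by
    rintro ⟨_, i, rfl⟩ ⟨_, j, rfl⟩ h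
    simp only at h
    rw [← inv_smul_eq_iff, ← mul_smul, ← zpow_neg, ← zpow_add] at h
    have := hNS _ _ h
    rw [zpow_add, zpow_neg, inv_mul_eq_one] at this
    exact Subtype.ext this.symm
  obtain ⟨⟨_, i, rfl⟩, hi⟩ := (Function.Injective.bijective_of_nat_card_le hinj
    (by rw [Nat.card_zpowers, hg, card_Om])).2 (φ • x)
  refine lemK hn hc (t := g ^ i) (by rw [map_zpow, hφ]) hi.symm ?_
  rw [← zpow_natCast, ← zpow_mul]
  exact hNS _ x

theorem caseOne (hq : 4 < Fintype.card F) {A : Type} [Group A] [Finite A] (N : Subgroup A) [N.Normal]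
    (e : N ≃* SL F) (hcent : Subgroup.centralizer (N : Set A) = ⊥) {p : ℕ} (hp : p.Prime)
    (hpA : p ∣ Nat.card A) (hpS : ¬ p ∣ Nat.card (SL F)) :
    (∃ n ∈ charDegrees A, p * (Fintype.card F + 1) ∣ n) ∧
    (∃ n ∈ charDegrees A, p * (Fintype.card F - 1) ∣ n) := by
  have := Fintype.ofFinite A
  have : Fact p.Prime := ⟨hp⟩
  let α : A →* MulAut (SL F) := (MulAut.congr e).toMonoidHom.comp MulAut.conjNormal
  have hα : ∀ a g, α a g = e (MulAut.conjNormal a (e.symm g)) := fun a g => rfl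
  have hinj : ∀ a, α a = 1 → a = 1 := by
    intro a ha
    have : a ∈ Subgroup.centralizer (N : Set A) := by
      rw [Subgroup.mem_centralizer_iff]
      intro h hh
      have h1 : α a (e ⟨h, hh⟩) = e ⟨h, hh⟩ := by rw [ha]; rfl
      rw [hα, e.symm_apply_apply] at h1
      have h2 := congrArg Subtype.val (e.injective h1)
      rw [MulAut.conjNormal_apply] at h2
      exact (mul_inv_eq_iff_eq_mul.1 h2).symm
    rwa [hcent, Subgroup.mem_bot] at this
  have hαs : ∀ s : SL F, α (e.symm s : N) = MulAut.conj s := by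
    intro s
    ext1 g
    rw [hα]
    have : MulAut.conjNormal ((e.symm s : N) : A) (e.symm g) = e.symm (s * g * s⁻¹) := by
      ext; simp [MulAut.conjNormal_apply]
    rw [this, e.apply_symm_apply]; rfl
  have hdec : ∀ a : A, ∃ s : N, α ((s : A)⁻¹ * a) • pinf F = pinf F ∧
      α ((s : A)⁻¹ * a) • p0 F = p0 F ∧ α ((s : A)⁻¹ * a) • uu (1 : F) • p0 F = uu (1 : F) • p0 F := by
    intro a
    have hn : ∀ {x y : Om F}, x ≠ y → α a • x ≠ α a • y := fun h h' => h (smul_left_cancel _ h')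
    obtain ⟨s, h1, h2, h3⟩ := three_trans (hn p0_ne.symm) (hn u1_ne.1.symm) (hn u1_ne.2.symm)
    refine ⟨e.symm s, ?_⟩
    have : ∀ x : Om F, α (((e.symm s : N) : A)⁻¹ * a) • x = s⁻¹ • α a • x := by
      intro x
      rw [map_mul, map_inv, hαs, mul_smul, ← map_inv]; rfl
    refine ⟨?_, ?_, ?_⟩ <;> rw [this, inv_smul_eq_iff] <;> symm <;> assumption
  have hab : ∀ a b : A, a * b * (b * a)⁻¹ ∈ N := by
    intro a b
    obtain ⟨s, a1, a2, a3⟩ := hdec a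
    obtain ⟨t, b1, b2, b3⟩ := hdec b
    have h1 := A0_comm a1 a2 a3 b1 b2 b3
    rw [← map_mul, ← map_mul] at h1
    have h2 : ((s : A)⁻¹ * a) * ((t : A)⁻¹ * b) = ((t : A)⁻¹ * b) * ((s : A)⁻¹ * a) := by
      rw [← mul_inv_eq_one]
      apply hinj
      rw [map_mul, h1, map_inv, mul_inv_cancel]
    have h3 := congrArg (QuotientGroup.mk' N) h2
    have hs : QuotientGroup.mk' N (s : A) = 1 := (QuotientGroup.eq_one_iff _).2 s.2
    have ht : QuotientGroup.mk' N (t : A) = 1 := (QuotientGroup.eq_one_iff _).2 t.2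
    simp only [map_mul, map_inv, hs, ht, inv_one, one_mul] at h3
    rw [← QuotientGroup.eq_one_iff]
    change QuotientGroup.mk' N _ = 1
    rw [map_mul, map_inv, map_mul, map_mul, h3, mul_inv_cancel]
  obtain ⟨x, hx⟩ := exists_prime_orderOf_dvd_card' p hpA
  have hp2 : p ≠ 2 := by
    rintro rfl; exact hpS (by rw [card_SL]; exact (two_dvd_q.mul_right _).mul_right _)
  have hquo : ∀ K : Subgroup A, x ∉ K → ∀ s ∈ K, ∀ [K.Normal], p ∣ orderOf (s⁻¹ * x) ∧ p ∣ K.index := by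
    intro K hxK s hs _
    have h1 : orderOf (QuotientGroup.mk' K x) = p := by
      refine ((Nat.dvd_prime hp).1 (hx ▸ orderOf_map_dvd (QuotientGroup.mk' K) x)).resolve_left fun h => ?_
      exact hxK ((QuotientGroup.eq_one_iff x).1 (orderOf_eq_one_iff.1 h))
    constructor
    · have h2 := orderOf_map_dvd (QuotientGroup.mk' K) (s⁻¹ * x)
      have h3 : QuotientGroup.mk' K s = 1 := (QuotientGroup.eq_one_iff _).2 hs
      rwa [map_mul, map_inv, h3, inv_one, one_mul, h1] at h2
    · rw [← h1, Subgroup.index]; exact orderOf_dvd_natCard _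
  have hxN : x ∉ N := by
    intro h
    apply hpS
    rw [← Nat.card_congr e.toEquiv, ← hx]
    exact Subgroup.orderOf_dvd_natCard N h
  -- main step
  have main : ∀ m : ℕ, 
      (¬ ∀ (V : Type) [AddCommGroup V] [Module ℂ V] [FiniteDimensional ℂ V]
      (ρ : Representation ℂ (SL F) V), ρ.IsIrreducible → m ∣ Module.finrank ℂ V →
      ∀ g, ρ.character (α x g) = ρ.character g) → ∃ n ∈ charDegrees A, p * m ∣ n := by
    intro m h
    push Not at h
    obtain ⟨V, _, _, _, ρ, hρ, hm, g, hg⟩ := h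
    let lam : Representation ℂ N V := ρ.comp e.toMonoidHom
    have hl : lam.IsIrreducible := (irr_comp ρ e.toMonoidHom e.surjective).1 hρ
    have hxs : x ∉ stab N lam := by
      intro h
      apply hg
      have := h (e.symm g)
      change ρ.character (e _) = ρ.character (e _) at this
      rwa [e.apply_symm_apply] at this
    have : (stab N lam).Normal := by
      constructor
      intro n hn a
      have h1 := le_stab N lam (hab a n)
      have : a * n * a⁻¹ = a * n * (n * a)⁻¹ * n := by group
      rw [this]; exact (stab N lam).mul_mem h1 hn
    obtain ⟨n, hn, hd⟩ := cliff_S1 N lam hl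
    exact ⟨n, hn, (mul_dvd_mul (hquo _ hxs 1 (Subgroup.one_mem _)).2 hm).trans hd⟩
  have fin : ∀ s g : SL F, α x g = s * g * s⁻¹ →
      (∀ ψ : MulAut (SL F), ∀ n : ℕ, (ψ ^ 2) ^ n = 1 → n.Coprime (Nat.card (SL F)) → ψ g = g →
        ψ ^ 2 = 1) → False := by
    intro s g hs hk
    let w : A := ((e.symm s : N) : A)⁻¹ * x
    have hw : α w g = g := by
      rw [map_mul, map_inv, hαs, MulAut.mul_apply, hs, ← map_inv, MulAut.conj_apply]; group
    have hpw := (hquo N hxN _ (e.symm s).2).1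
    obtain ⟨k, m, hm, hkm⟩ := Nat.exists_eq_pow_mul_and_not_dvd (orderOf_pos w).ne' p hp.ne_one
    have h1 := hk (α (w ^ m)) (p ^ k) (by
      rw [← map_pow, ← map_pow, ← pow_mul, ← pow_mul, show m * (2 * p ^ k) = p ^ k * m * 2 by ring, ← hkm,
        pow_mul, pow_orderOf_eq_one, one_pow, map_one])
      (Nat.Coprime.pow_left k ((Nat.Prime.coprime_iff_not_dvd hp).2 hpS)) (by
        rw [map_pow]
        clear hkm hm
        induction m with
        | zero => rfl
        | succ j ih => rw [pow_succ, MulAut.mul_apply, hw, ih])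
    rw [← map_pow, ← pow_mul] at h1
    have h2 := hpw.trans (orderOf_dvd_of_pow_eq_one (hinj _ h1))
    rcases hp.dvd_mul.1 h2 with h | h
    · exact hm h
    · exact hp2 ((Nat.prime_dvd_prime_iff_eq hp Nat.prime_two).1 h)
  constructor
  · refine main _ fun hall => ?_
    obtain ⟨a, ha⟩ := exists_sp F
    have ha1 : a ≠ 1 := by rintro rfl; simp at ha; omega
    have h0 : tr (tt a) ≠ 0 := fun h => ha1 ((tr_tt a).1 h)
    have h1 : tr (α x (tt a)) ≠ 0 := by
      intro h
      rw [← sq_one_iff, ← map_mul] at h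
      exact h0 ((sq_one_iff _).1 ((α x).injective (h.trans (map_one _).symm)))
    obtain ⟨k, b, hb, hb1⟩ := split_conj h1 (x := α x • pinf F) (by rw [← aut_smul, tt_smul_inf])
    obtain ⟨s, hs⟩ := sep_split hb1 ha1 (fun V _ _ _ ρ hρ hd => by
      rw [← hall V ρ hρ hd (tt a), hb, char_conj])
    refine fin (k * s) (tt a) (by rw [hb, ← hs]; group) (fun ψ n h1 h2 h3 => fix_sp hq h1 h2 ha h3)
  · refine main _ fun hall => ?_
    obtain ⟨g, hg⟩ := exists_ns F
    have hg1 : g ≠ 1 := by rintro rfl; simp at hg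
    have ho : orderOf (α x g) = Fintype.card F + 1 := by rw [← hg]; exact (α x).orderOf_eq g
    obtain ⟨s, hs⟩ := sep_ns (g := α x g) (g' := g)
      (NS_of_order (fun h => by rw [h, orderOf_one] at ho; omega) ho.dvd)
      (NS_of_order hg1 hg.dvd) (fun V _ _ _ ρ hρ hd => hall V ρ hρ hd g)
    exact fin s g hs.symm (fun ψ n h1 h2 h3 => fix_ns h1 h2 hg (by
      rw [pow_two, MulAut.mul_apply, h3, h3]))
end autos
end CD
end

noncomputable section
namespace CD
open scoped Classical
open Representation

theorem pf_succ {p d k : ℕ} (hp : p.Prime) (hd : d ≠ 0) (hpd : ¬ p ∣ d)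
    (hk : k ≤ d.primeFactors.card) : k + 1 ≤ (p * d).primeFactors.card := by
  rw [Nat.Coprime.primeFactors_mul ((Nat.Prime.coprime_iff_not_dvd hp).2 hpd), hp.primeFactors,
    Finset.card_union_of_disjoint, Finset.card_singleton]
  · omega
  · rw [Finset.disjoint_singleton_left]
    exact fun h => hpd (Nat.dvd_of_mem_primeFactors h)

theorem cd_pos {G : Type} [Group G] [Finite G] {n : ℕ} (hn : n ∈ charDegrees G) : n ≠ 0 := by
  obtain ⟨V, _, _, _, ρ, hρ, rfl⟩ := mem_cd.1 hn
  exact (irr_fin_pos hρ).ne'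

theorem clique {G : Type} [Group G] [Finite G] (h4 : (charGraph G).CliqueFree 4) {n m : ℕ}
    (hn : n ∈ charDegrees G) (hm : m ∣ n) : m.primeFactors.card ≤ 3 := by
  by_contra hc
  obtain ⟨t, ht, hc4⟩ := Finset.exists_subset_card_eq (show 4 ≤ m.primeFactors.card by omega)
  have hd : ∀ p ∈ t, p.Prime ∧ p ∣ n := fun p hp =>
    ⟨Nat.prime_of_mem_primeFactors (ht hp), (Nat.dvd_of_mem_primeFactors (ht hp)).trans hm⟩
  have hmem : ∀ p ∈ t, p ∈ charPrimes G := fun p hp => ⟨(hd p hp).1, n, hn, (hd p hp).2⟩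
  refine h4 (t.subtype (· ∈ charPrimes G)) ⟨?_, ?_⟩
  · intro x hx y hy hxy
    rw [Finset.mem_coe, Finset.mem_subtype] at hx hy
    have hne : (x : ℕ) ≠ y := fun h => hxy (Subtype.ext h)
    exact ⟨hne, n, hn, Nat.Coprime.mul_dvd_of_dvd_of_dvd
      ((Nat.coprime_primes (hd _ hx).1 (hd _ hy).1).2 hne) (hd _ hx).2 (hd _ hy).2⟩
  · rw [Finset.card_subtype, Finset.filter_true_of_mem hmem, hc4]

section fin
variable {F : Type} [Field F] [Fintype F] [CharP F 2]

theorem center_SL : Subgroup.center (SL F) = ⊥ := by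
  rw [eq_bot_iff]
  intro A hA
  obtain ⟨r, hr, h⟩ := Matrix.SpecialLinearGroup.mem_center_iff.1 hA
  have : r = 1 := by
    simp only [Fintype.card_fin, sq_eq_one_iff] at hr
    exact hr.elim id fun h => h.trans (CharTwo.neg_eq 1)
  rw [Subgroup.mem_bot]
  apply Subtype.ext
  rw [← h, this]; simp

theorem caseTwo (hq : 4 < Fintype.card F) {M : Type} [Group M] [Finite M] (θ : M →* SL F)
    (hθ : Function.Surjective θ) {W : Type} [AddCommGroup W] [Module ℂ W] [FiniteDimensional ℂ W]
    (lam : Representation ℂ θ.ker W) (hl : lam.IsIrreducible) {p : ℕ} (hp : p.Prime)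
    (hpW : p ∣ Module.finrank ℂ W) (hpS : ¬ p ∣ Nat.card (SL F))
    (h1 : 2 ≤ (Fintype.card F - 1).primeFactors.card)
    (h2 : 2 ≤ (Fintype.card F + 1).primeFactors.card)
    (h3 : 3 ≤ (Fintype.card F - 1).primeFactors.card ∨ 3 ≤ (Fintype.card F + 1).primeFactors.card) :
    ∃ n ∈ charDegrees M, ∃ m, m ∣ n ∧ 4 ≤ m.primeFactors.card := by
  have := Fintype.ofFinite M
  have hS0 : Nat.card (SL F) ≠ 0 := Nat.card_pos.ne'
  have key : ∀ n ∈ charDegrees M, ∀ d, d ∣ Nat.card (SL F) → p * d ∣ n → 3 ≤ d.primeFactors.card →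
      ∃ n ∈ charDegrees M, ∃ m, m ∣ n ∧ 4 ≤ m.primeFactors.card := by
    intro n hn d hd hpd hc
    exact ⟨n, hn, _, hpd, pf_succ hp (ne_zero_of_dvd_ne_zero hS0 hd) (fun h => hpS (h.trans hd)) hc⟩
  obtain ⟨H, hH⟩ : ∃ H, H = (stab θ.ker lam).map θ := ⟨_, rfl⟩
  have hi : H.index = (stab θ.ker lam).index := by
    rw [hH]; exact Subgroup.index_map_eq _ hθ (le_stab _ _)
  by_cases hc : 3 ≤ H.index.primeFactors.card
  · obtain ⟨n, hn, hd⟩ := cliff_S1 θ.ker lam hl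
    refine key n hn H.index (Subgroup.index_dvd_card H) ?_ hc
    rw [hi, mul_comm]
    exact (mul_dvd_mul_left _ hpW).trans hd
  obtain ⟨Γ, _, _, π, A, hA1, hA2, hA3, hA4⟩ := exists_Gam θ.ker lam hl
  let ψ : Γ →* SL F := θ.comp π
  have hr : ψ.range = H := by rw [MonoidHom.range_comp, hA2, hH]
  obtain ⟨η, hη, hη2⟩ := exists_eta θ.ker lam hl π A hA1 hA4 ψ (fun γ => Iff.rfl)
  have hker : ∀ (γ : Γ) (n : θ.ker), π γ = n → γ ∈ ψ.ker := by
    intro γ n h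
    change θ (π γ) = 1
    rw [h]; exact n.2
  by_cases hT : H = ⊤
  · have hψ : Function.Surjective ψ := MonoidHom.range_eq_top.1 (hr.trans hT)
    obtain ⟨μ, hμ⟩ := ext_red ψ hψ η hη (fun P _ _ ψ h1 h2 η => schur_SL hq P ψ h1 h2 η)
    have fin : ∀ d, d ∣ Nat.card (SL F) → 3 ≤ d.primeFactors.card → (∃ (V : Type) (_ : AddCommGroup V)
        (_ : Module ℂ V) (_ : FiniteDimensional ℂ V) (ρ : Representation ℂ (SL F) V),
        ρ.IsIrreducible ∧ d ∣ Module.finrank ℂ V) →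
        ∃ n ∈ charDegrees M, ∃ m, m ∣ n ∧ 4 ≤ m.primeFactors.card := by
      rintro d hdS hd3 ⟨V, _, _, _, ρ, hρ, hd⟩
      let δ : Representation ℂ Γ V :=
        { toFun := fun γ => (μ γ : ℂ) • ρ (ψ γ)
          map_one' := by simp
          map_mul' := fun a b => by
            rw [map_mul, map_mul, map_mul, Units.val_mul, smul_mul_smul_comm] }
      have hδ : δ.IsIrreducible := by
        have h := (irr_comp ρ ψ hψ).1 hρ
        rw [irr_iff] at h ⊢
        refine ⟨h.1, fun U hU => h.2 U fun γ u hu => ?_⟩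
        have h5 := U.smul_mem ((μ γ : ℂ)⁻¹) (hU γ u hu)
        change (μ γ : ℂ)⁻¹ • (μ γ : ℂ) • ρ (ψ γ) u ∈ U at h5
        rwa [inv_smul_smul₀ (Units.ne_zero _)] at h5
      have := cliff_S2 θ.ker lam hl π A hA2 hA3 hA4 δ hδ (fun γ n c e1 e2 e3 => by
        have hk := hker γ n e1
        have e4 : ψ γ = 1 := hk
        change (μ γ : ℂ) • ρ (ψ γ) = _
        rw [e4, map_one, hμ ⟨γ, hk⟩, hη2 ⟨γ, hk⟩ n c e1 e2 e3])
      exact key _ this d hdS ((mul_dvd_mul hpW hd).mul_left _) hd3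
    rw [card_SL] at fin
    rcases h3 with h3 | h3
    · exact fin _ ((dvd_mul_left _ _).mul_right _) h3 (exists_V_minus hq)
    · exact fin _ (dvd_mul_left _ _) h3 (exists_V_plus hq)
  obtain ⟨x, hx⟩ := dickson H hT (by omega) h1 h2
  let B := MulAction.stabilizer (SL F) x
  have hHB : H ≤ B := fun h hh => hx h hh
  have hBi : B.index = Fintype.card F + 1 := by
    rw [← card_Om]; exact MulAction.index_stabilizer_of_transitive (SL F) x
  have hBc : Nat.card B = Fintype.card F * (Fintype.card F - 1) := by
    have := Subgroup.card_mul_index B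
    rw [hBi, card_SL] at this
    exact Nat.eq_of_mul_eq_mul_right (by omega) this
  have hri := Subgroup.relIndex_mul_index hHB
  have hi0 : H.index ≠ 0 := Subgroup.index_ne_zero_of_finite
  have hpf : (Fintype.card F + 1).primeFactors = H.index.primeFactors := by
    apply Finset.eq_of_subset_of_card_le
    · exact Nat.primeFactors_mono (hBi ▸ Dvd.intro_left _ hri) hi0
    · omega
  have hrd : H.relIndex B ∣ Nat.card B := Subgroup.index_dvd_card _
  have hr1 : H.relIndex B = 1 := by
    by_contra hne
    obtain ⟨r, hr, hrr⟩ := Nat.exists_prime_and_dvd hne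
    have : r ∈ (Fintype.card F + 1).primeFactors := by
      rw [hpf, Nat.mem_primeFactors]
      exact ⟨hr, hrr.trans (Dvd.intro _ hri), hi0⟩
    exact hr.one_lt.ne' (Nat.eq_one_of_dvd_coprimes coprime_pm (hBc ▸ hrr.trans hrd)
      (Nat.dvd_of_mem_primeFactors this))
  have hHe : H = B := le_antisymm hHB (Subgroup.relIndex_eq_one.1 hr1)
  obtain ⟨g, hg⟩ := om_trans x
  obtain ⟨a, ha⟩ := exists_sp F
  have hlift : ∀ b : SL F, b • pinf F = pinf F → ∃ γ, ψ γ = g * b * g⁻¹ := by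
    intro b hb
    have : g * b * g⁻¹ ∈ ψ.range := by
      rw [hr, hHe, MulAction.mem_stabilizer_iff, mul_smul, mul_smul, ← hg, inv_smul_smul, hb]
    exact this
  obtain ⟨γ1, e1⟩ := hlift _ (uu_smul_inf 1)
  obtain ⟨γ2, e2⟩ := hlift _ (tt_smul_inf a)
  have hne : ψ (γ1 * γ2) ≠ ψ (γ2 * γ1) := by
    intro h
    rw [map_mul, map_mul, e1, e2] at h
    have h' : uu 1 * tt a = tt a * uu 1 := by
      have := congrArg (fun y => g⁻¹ * y * g) h
      simpa [mul_assoc] using this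
    have h6 : tt a • uu (1 : F) • p0 F = uu (1 : F) • p0 F := by
      rw [← mul_smul, ← h', mul_smul, tt_smul_p0]
    have h7 := three_fix p0_ne.symm u1_ne.1.symm u1_ne.2.symm (tt_smul_inf a) (tt_smul_p0 a) h6
    have ha1 : a ≠ 1 := by rintro rfl; simp at ha; omega
    exact tr_ne_one (fun h => ha1 ((tr_tt a).1 h)) h7
  obtain ⟨D, _, _, _, δ, hδ, hD, hδk⟩ := nonabelian ψ η hη γ1 γ2 hne
  have hz := lemZ δ hδ ψ (fun k hk => ⟨_, hδk ⟨k, hk⟩⟩)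
  rw [hr, hHe, hBc] at hz
  have hcd := cliff_S2 θ.ker lam hl π A hA2 hA3 hA4 δ hδ (fun γ n c e1 e2 e3 => by
    have hk := hker γ n e1
    rw [hδk ⟨γ, hk⟩, hη2 ⟨γ, hk⟩ n c e1 e2 e3])
  obtain ⟨r, hrp, hrD⟩ := Nat.exists_prime_and_dvd hD.ne'
  have hrq := hrD.trans hz
  refine key _ hcd (r * (Fintype.card F + 1)) ?_ ?_ (pf_succ hrp (by omega) ?_ h2)
  · rw [card_SL]; exact mul_dvd_mul_right hrq _
  · rw [← hi, hHe, hBi, ← mul_assoc, mul_comm]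
    exact mul_dvd_mul_left _ (mul_dvd_mul hpW hrD)
  · exact fun h => hrp.one_lt.ne' (Nat.eq_one_of_dvd_coprimes coprime_pm hrq h)

theorem finalThm (hq : 4 < Fintype.card F) {G : Type} [Group G] [Finite G]
    (h4 : (charGraph G).CliqueFree 4) (h7 : Nat.card ↥(charPrimes G) = 7)
    (R M : Subgroup G) [R.Normal] [M.Normal] (hRM : R ≤ M)
    (e : ↥(M.map (QuotientGroup.mk' R)) ≃* SL F)
    (hcent : Subgroup.centralizer ((M.map (QuotientGroup.mk' R)) : Set (G ⧸ R)) = ⊥)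
    (h1 : 2 ≤ (Fintype.card F - 1).primeFactors.card)
    (h2 : 2 ≤ (Fintype.card F + 1).primeFactors.card)
    (h3 : 3 ≤ (Fintype.card F - 1).primeFactors.card ∨ 3 ≤ (Fintype.card F + 1).primeFactors.card)
    (h5 : (Fintype.card F - 1).primeFactors.card + (Fintype.card F + 1).primeFactors.card = 5) :
    False := by
  have := Fintype.ofFinite G
  have hS0 : Nat.card (SL F) ≠ 0 := Nat.card_pos.ne'
  obtain ⟨p, hpc, hpS⟩ : ∃ p ∈ charPrimes G, ¬ p ∣ Nat.card (SL F) := by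
    by_contra hno
    push Not at hno
    have hsub : charPrimes G ⊆ ((Nat.card (SL F)).primeFactors : Set ℕ) := fun p hp =>
      Nat.mem_primeFactors.2 ⟨hp.1, hno p hp, hS0⟩
    have hle := Set.ncard_le_ncard hsub (Finset.finite_toSet _)
    rw [Set.ncard_coe_finset, ← Nat.card_coe_set_eq, h7, card_SL,
      Nat.primeFactors_mul (by rw [card_SL] at hS0; exact left_ne_zero_of_mul hS0) (by omega),
      Nat.primeFactors_mul (by omega) (by omega)] at hle
    obtain ⟨f, hf, hf0⟩ := card_F_pow (F := F)
    have hc1 : (Fintype.card F).primeFactors.card = 1 := by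
      rw [hf, Nat.primeFactors_prime_pow hf0.ne' Nat.prime_two]; rfl
    have := Finset.card_union_le ((Fintype.card F).primeFactors ∪ (Fintype.card F - 1).primeFactors)
      (Fintype.card F + 1).primeFactors
    have := Finset.card_union_le (Fintype.card F).primeFactors (Fintype.card F - 1).primeFactors
    omega
  have hp := hpc.1
  by_cases hpA : p ∣ Nat.card (G ⧸ R)
  · obtain ⟨⟨n, hn, hnd⟩, ⟨m, hm, hmd⟩⟩ :=
      caseOne hq (M.map (QuotientGroup.mk' R)) e hcent hp hpA hpS
    have hs := QuotientGroup.mk'_surjective R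
    have c1 := clique h4 (cd_of_surj _ hs hn) hnd
    have c2 := clique h4 (cd_of_surj _ hs hm) hmd
    rw [card_SL] at hpS
    rcases h3 with h3 | h3
    · have := pf_succ hp (by omega) (fun h => hpS ((h.mul_left _).mul_right _)) h3
      omega
    · have := pf_succ hp (by omega) (fun h => hpS (h.mul_left _)) h3
      omega
  · obtain ⟨n, hn, hpn⟩ := hpc.2
    obtain ⟨V, _, _, _, ρ, hρ, rfl⟩ := mem_cd.1 hn
    obtain ⟨W, _, _, _, lam, hl, hpW⟩ := cliff_S3 ρ hρ R p hp hpn hpA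
    let θ : M →* SL F := e.toMonoidHom.comp ((QuotientGroup.mk' R).subgroupMap M)
    have hθ : Function.Surjective θ :=
      e.surjective.comp ((QuotientGroup.mk' R).subgroupMap_surjective M)
    have hk : ∀ m : M, m ∈ θ.ker ↔ (m : G) ∈ R := by
      intro m
      rw [MonoidHom.mem_ker]
      change e _ = 1 ↔ _
      rw [map_eq_one_iff e e.injective, ← QuotientGroup.eq_one_iff]
      exact Subtype.ext_iff
    let j : θ.ker →* R :=
      { toFun := fun k => ⟨k.1.1, (hk _).1 k.2⟩
        map_one' := rfl
        map_mul' := fun _ _ => rfl }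
    have hj : Function.Surjective j := fun r => ⟨⟨⟨r.1, hRM r.2⟩, (hk _).2 r.2⟩, rfl⟩
    obtain ⟨n, hn, m, hmn, hm4⟩ := caseTwo hq θ hθ (lam.comp j) ((irr_comp lam j hj).1 hl) hp hpW hpS
      h1 h2 h3
    obtain ⟨U, _, _, _, σ, hσ, rfl⟩ := mem_cd.1 hn
    obtain ⟨n', hn', hd⟩ := cliff_S1 M σ hσ
    have := clique h4 hn' (hmn.trans ((dvd_mul_left _ _).trans hd))
    omega
end fin
end CD
end

theorem stmt14 (G : Type) [Group G] [Finite G]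
    (h4 : (charGraph G).CliqueFree 4)
    (h7 : Nat.card ↥(charPrimes G) = 7)
    (M : Subgroup G) (hM : M.Normal) (hRM : solvableRadical G < M)
    (f : ℕ) (hf : 2 ≤ f)
    (hS : Nonempty (↥(radicalQuotImage M) ≃* PSL2 (GaloisField 2 f)))
    (hcent : Subgroup.centralizer ((radicalQuotImage M) : Set (G ⧸ solvableRadical G)) = ⊥)
    (hbip : ¬ (((charGraph G).induce
      {x : ↥(charPrimes G) | (x : ℕ) ∈ (Nat.card ↥(radicalQuotImage M)).primeFactors})ᶜ).Colorable 2) :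
    ¬ (((2 ^ f - 1).primeFactors.card = 2 ∧ (2 ^ f + 1).primeFactors.card = 3) ∨
       ((2 ^ f - 1).primeFactors.card = 3 ∧ (2 ^ f + 1).primeFactors.card = 2)) := by
  intro hc
  obtain ⟨e⟩ := hS
  have hf3 : 3 ≤ f := by
    rcases hf.eq_or_lt with rfl | h
    · have h3 : (2 ^ 2 - 1 : ℕ).primeFactors.card = 1 := by
        rw [show 2 ^ 2 - 1 = 3 from rfl, Nat.prime_three.primeFactors]; rfl
      omega
    · exact h
  let _ : Fintype (GaloisField 2 f) := Fintype.ofFinite _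
  have hcard : Fintype.card (GaloisField 2 f) = 2 ^ f := by
    rw [← Nat.card_eq_fintype_card]; exact GaloisField.card 2 f (by omega)
  have hq : 4 < Fintype.card (GaloisField 2 f) := by
    rw [hcard]
    calc 4 < 2 ^ 3 := by norm_num
      _ ≤ 2 ^ f := Nat.pow_le_pow_right (by norm_num) hf3
  let e' : PSL2 (GaloisField 2 f) ≃* CD.SL (GaloisField 2 f) :=
    (QuotientGroup.quotientMulEquivOfEq CD.center_SL).trans QuotientGroup.quotientBot
  refine CD.finalThm hq h4 h7 (solvableRadical G) M hRM.le (e.trans e') hcent ?_ ?_ ?_ ?_ <;>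
    rw [hcard] <;> omega
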